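/- Let κ > 1 be a real number and set A_κ = (2e^γ)^κ Γ(κ+1). Then there exists a continuous function σ_κ : (0,∞) → ℝ with σ_κ(u) = u^κ / A_κ for 0 < u ≤ 2 and such that u ↦ u^{−κ}σ_κ(u) is differentiable on (2,∞) with derivative −κ u^{−κ−1} σ_κ(u−2); moreover there exist real numbers α_κ ≥ β_κ ≥ 2 and continuous functions F_κ, f_κ : (0,∞) → ℝ satisfying: F_κ(u) = 1/σ_κ(u) for 0 < u ≤ α_κ; f_κ(u) = 0 for 0 < u ≤ β_κ; u ↦ u^κ F_κ(u) is differentiable on (α_κ,∞) with derivative κ u^{κ−1} f_κ(u−1); u ↦ u^κ f_κ(u) is differentiable on (β_κ,∞) with derivative κ u^{κ−1} F_κ(u−1); F_κ decreases monotonically to 1 and f_κ increases monotonically to 1 as u → ∞; and there is a constant C > 0 with |F_κ(u) − 1| ≤ C e^{−u} and |f_κ(u) − 1| ≤ C e^{−u} for all u ≥ 1. -/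

import Mathlib

namespace DiamondHalberstam

open Set Filter Topology MeasureTheory

/-- The function `x ↦ (1 - exp (-x)) / x`, extended by continuity to `0`. -/
noncomputable def ein (x : ℝ) : ℝ := dslope (fun t : ℝ => -Real.exp (-t)) 0 x

/-- The entire exponential integral `∫₀ˣ (1 - exp (-t)) / t dt`. -/
noncomputable def Ein (x : ℝ) : ℝ := ∫ t in (0 : ℝ)..x, ein t

lemma mul_ein (x : ℝ) : x * ein x = 1 - Real.exp (-x) := by
  have h := sub_smul_dslope (fun t : ℝ => -Real.exp (-t)) 0 x
  simp only [sub_zero, smul_eq_mul, neg_zero, Real.exp_zero] at h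
  rw [ein, h]; ring

lemma continuous_ein : Continuous ein := by
  have hd : Differentiable ℝ (fun t : ℝ => -Real.exp (-t)) := by fun_prop
  have h := (continuousOn_dslope (f := fun t : ℝ => -Real.exp (-t)) (a := (0 : ℝ))
    (s := univ) univ_mem).2 ⟨hd.continuous.continuousOn, hd 0⟩
  exact continuousOn_univ.1 h

lemma ein_nonneg {x : ℝ} (hx : 0 ≤ x) : 0 ≤ ein x := by
  rcases hx.eq_or_lt with rfl | hx
  · have : ein 0 = 1 := by
      have h : HasDerivAt (fun t : ℝ => -Real.exp (-t)) 1 0 := by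
        have := ((hasDerivAt_neg (0 : ℝ)).exp).fun_neg
        simpa using this
      rw [ein, dslope_same, h.deriv]
    rw [this]; norm_num
  · have h := mul_ein x
    have : Real.exp (-x) ≤ 1 := Real.exp_le_one_iff.2 (by linarith)
    by_contra hc
    push Not at hc
    nlinarith

lemma ein_le_one {x : ℝ} (hx : 0 ≤ x) : ein x ≤ 1 := by
  rcases hx.eq_or_lt with rfl | hx
  · have h : HasDerivAt (fun t : ℝ => -Real.exp (-t)) 1 0 := by
      have := ((hasDerivAt_neg (0 : ℝ)).exp).fun_neg
      simpa using this
    rw [ein, dslope_same, h.deriv]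
  · have h := mul_ein x
    have : -x + 1 ≤ Real.exp (-x) := Real.add_one_le_exp _
    by_contra hc
    push Not at hc
    nlinarith

lemma hasDerivAt_Ein (x : ℝ) : HasDerivAt Ein (ein x) x :=
  intervalIntegral.integral_hasDerivAt_right (continuous_ein.intervalIntegrable _ _)
    continuous_ein.aestronglyMeasurable.stronglyMeasurableAtFilter continuous_ein.continuousAt

lemma continuous_Ein : Continuous Ein :=
  continuous_iff_continuousAt.2 fun x => (hasDerivAt_Ein x).continuousAt

@[simp] lemma Ein_zero : Ein 0 = 0 := by simp [Ein]

/-- A monotonicity criterion on a half-line given by pointwise derivatives. -/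
lemma monotoneOn_Ici_of_hasDerivAt {g g' : ℝ → ℝ} {a : ℝ} (hc : ContinuousOn g (Ici a))
    (hd : ∀ x, a < x → HasDerivAt g (g' x) x) (h : ∀ x, a < x → 0 ≤ g' x) :
    MonotoneOn g (Ici a) := by
  apply monotoneOn_of_deriv_nonneg (convex_Ici a) hc
  · intro x hx
    rw [interior_Ici] at hx
    exact (hd x hx).differentiableAt.differentiableWithinAt
  · intro x hx
    rw [interior_Ici] at hx
    rw [(hd x hx).deriv]; exact h x hx

lemma antitoneOn_Ici_of_hasDerivAt {g g' : ℝ → ℝ} {a : ℝ} (hc : ContinuousOn g (Ici a))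
    (hd : ∀ x, a < x → HasDerivAt g (g' x) x) (h : ∀ x, a < x → g' x ≤ 0) :
    AntitoneOn g (Ici a) := by
  apply antitoneOn_of_deriv_nonpos (convex_Ici a) hc
  · intro x hx
    rw [interior_Ici] at hx
    exact (hd x hx).differentiableAt.differentiableWithinAt
  · intro x hx
    rw [interior_Ici] at hx
    rw [(hd x hx).deriv]; exact h x hx

lemma monotoneOn_Icc_of_hasDerivAt {g g' : ℝ → ℝ} {a b : ℝ} (hc : ContinuousOn g (Icc a b))
    (hd : ∀ x, a < x → x < b → HasDerivAt g (g' x) x) (h : ∀ x, a < x → x < b → 0 ≤ g' x) :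
    MonotoneOn g (Icc a b) := by
  apply monotoneOn_of_deriv_nonneg (convex_Icc a b) hc
  · intro x hx
    rw [interior_Icc] at hx
    exact (hd x hx.1 hx.2).differentiableAt.differentiableWithinAt
  · intro x hx
    rw [interior_Icc] at hx
    rw [(hd x hx.1 hx.2).deriv]; exact h x hx.1 hx.2

lemma antitoneOn_Icc_of_hasDerivAt {g g' : ℝ → ℝ} {a b : ℝ} (hc : ContinuousOn g (Icc a b))
    (hd : ∀ x, a < x → x < b → HasDerivAt g (g' x) x) (h : ∀ x, a < x → x < b → g' x ≤ 0) :
    AntitoneOn g (Icc a b) := by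
  apply antitoneOn_of_deriv_nonpos (convex_Icc a b) hc
  · intro x hx
    rw [interior_Icc] at hx
    exact (hd x hx.1 hx.2).differentiableAt.differentiableWithinAt
  · intro x hx
    rw [interior_Icc] at hx
    rw [(hd x hx.1 hx.2).deriv]; exact h x hx.1 hx.2

lemma Ein_nonneg {x : ℝ} (hx : 0 ≤ x) : 0 ≤ Ein x := by
  have := monotoneOn_Ici_of_hasDerivAt (a := 0) continuous_Ein.continuousOn
    (fun x _ => hasDerivAt_Ein x) (fun x hx => ein_nonneg hx.le) self_mem_Ici hx hx
  simpa using this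

lemma Ein_le_self {x : ℝ} (hx : 0 ≤ x) : Ein x ≤ x := by
  have := antitoneOn_Ici_of_hasDerivAt (a := 0) (g := fun x => Ein x - x)
    (continuous_Ein.sub continuous_id).continuousOn
    (fun x _ => (hasDerivAt_Ein x).sub (hasDerivAt_id x))
    (fun x hx => sub_nonpos.2 (ein_le_one hx.le)) self_mem_Ici hx hx
  simp at this; exact this

lemma antitoneOn_Ein_sub_log : AntitoneOn (fun x => Ein x - Real.log x) (Ioi 0) := by
  apply antitoneOn_of_deriv_nonpos (convex_Ioi 0)
  · exact continuous_Ein.continuousOn.sub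
      (Real.continuousOn_log.mono fun x hx => ne_of_gt hx)
  · intro x hx
    rw [interior_Ioi] at hx
    exact ((hasDerivAt_Ein x).sub (Real.hasDerivAt_log (ne_of_gt hx))).differentiableAt
      |>.differentiableWithinAt
  · intro x hx
    rw [interior_Ioi] at hx
    have hx' : 0 < x := hx
    have := ((hasDerivAt_Ein x).sub (Real.hasDerivAt_log (ne_of_gt hx'))).deriv
    have h2 : deriv (fun x => Ein x - Real.log x) x = ein x - x⁻¹ := this
    rw [h2, sub_nonpos, ← one_div, le_div_iff₀ hx', mul_comm, mul_ein]
    have := Real.exp_pos (-x)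
    linarith

lemma Ein_le_log {x : ℝ} (hx : 0 ≤ x) : Ein x ≤ 1 + Real.log (1 + x) := by
  rcases le_total x 1 with h | h
  · have := Ein_le_self hx
    have := Real.log_nonneg (by linarith : (1 : ℝ) ≤ 1 + x)
    linarith
  · have h1 := antitoneOn_Ein_sub_log (by norm_num : (1 : ℝ) ∈ Ioi 0)
      (by linarith : (0 : ℝ) < x) h
    have h2 := Ein_le_self (zero_le_one (α := ℝ))
    have h3 : Real.log x ≤ Real.log (1 + x) := Real.log_le_log (by linarith) (by linarith)
    simp at h1
    linarith

lemma exp_neg_sub_one_sub_div_pow {n : ℕ} {s : ℝ} (hs : 0 ≤ s) (hsn : s ≤ n) :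
    0 ≤ Real.exp (-s) - (1 - s / n) ^ n ∧
      Real.exp (-s) - (1 - s / n) ^ n ≤ s ^ 2 / n * Real.exp (-s) := by
  rcases Nat.eq_zero_or_pos n with rfl | hn
  · simp at hsn
    have : s = 0 := le_antisymm hsn hs
    simp [this]
  have hn' : (0 : ℝ) < n := by exact_mod_cast hn
  have h0 : 0 ≤ 1 - s / n := by
    rw [sub_nonneg, div_le_one hn']; exact hsn
  have key : ∀ t : ℝ, (Real.exp (t / n)) ^ n = Real.exp t := by
    intro t
    rw [← Real.exp_nat_mul]; congr 1; field_simp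
  constructor
  · rw [sub_nonneg, ← key (-s)]
    apply pow_le_pow_left₀ h0
    have := Real.add_one_le_exp (-s / n)
    rw [neg_div] at this ⊢
    linarith
  · have h1 : (1 + s / n) ^ n ≤ Real.exp s := by
      rw [← key s]
      apply pow_le_pow_left₀ (by positivity)
      have := Real.add_one_le_exp (s / n)
      linarith
    have h2 : 1 - s ^ 2 / n ≤ (1 - s ^ 2 / n ^ 2) ^ n := by
      have h4 : -2 ≤ -(s ^ 2 / (n : ℝ) ^ 2) := by
        rw [neg_le_neg_iff, ← div_pow]
        have : s / n ≤ 1 := by linarith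
        have h5 : 0 ≤ s / n := by positivity
        nlinarith
      have := one_add_mul_le_pow h4 n
      have h6 : (n : ℝ) * -(s ^ 2 / (n : ℝ) ^ 2) = -(s ^ 2 / n) := by field_simp
      rw [h6] at this
      simpa [sub_eq_add_neg] using this
    have h3 : (1 - s ^ 2 / (n : ℝ) ^ 2) ^ n = (1 + s / n) ^ n * (1 - s / n) ^ n := by
      rw [← mul_pow]; congr 1; ring
    have h4 : 1 - s ^ 2 / n ≤ Real.exp s * (1 - s / n) ^ n := by
      rw [h3] at h2
      exact h2.trans (mul_le_mul_of_nonneg_right h1 (pow_nonneg h0 n))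
    have h5 : Real.exp (-s) * (1 - s ^ 2 / n) ≤ (1 - s / n) ^ n := by
      calc _ ≤ Real.exp (-s) * (Real.exp s * (1 - s / n) ^ n) :=
            mul_le_mul_of_nonneg_left h4 (Real.exp_pos _).le
        _ = _ := by rw [← mul_assoc, ← Real.exp_add]; simp
    linarith

/-- The polynomial `∑_{k ≤ n} (1 - (1 - x)^k) / k`. -/
noncomputable def harmonicPoly (n : ℕ) (x : ℝ) : ℝ :=
  ∑ k ∈ Finset.range n, (1 - (1 - x) ^ (k + 1)) / ((k : ℝ) + 1)

lemma harmonicPoly_one (n : ℕ) : harmonicPoly n 1 = (harmonic n : ℝ) := by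
  simp [harmonicPoly, harmonic]

lemma hasDerivAt_harmonicPoly (n : ℕ) (x : ℝ) :
    HasDerivAt (harmonicPoly n) (∑ k ∈ Finset.range n, (1 - x) ^ k) x := by
  unfold harmonicPoly
  apply HasDerivAt.fun_sum
  intro k _
  have h1 : HasDerivAt (fun x : ℝ => 1 - x) (-1) x := by
    simpa using (hasDerivAt_id x).const_sub 1
  have h2 := ((h1.fun_pow (k + 1)).const_sub 1).div_const ((k : ℝ) + 1)
  refine h2.congr_deriv ?_
  have : (k : ℝ) + 1 ≠ 0 := by positivity
  push_cast
  field_simp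

lemma abs_Ein_sub_harmonic (n : ℕ) : |Ein n - (harmonic n : ℝ)| ≤ 1 / n := by
  rcases Nat.eq_zero_or_pos n with rfl | hn
  · simp
  have hn' : (0 : ℝ) < n := by exact_mod_cast hn
  set g : ℝ → ℝ := fun s => Ein s - harmonicPoly n (s / n)
  have hg : ∀ s, HasDerivAt g (ein s - (∑ k ∈ Finset.range n, (1 - s / n) ^ k) / n) s := by
    intro s
    have h1 : HasDerivAt (fun s : ℝ => s / n) (1 / n) s := (hasDerivAt_id s).div_const _
    have h2 := (hasDerivAt_harmonicPoly n (s / n)).comp s h1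
    have h3 := (hasDerivAt_Ein s).fun_sub h2
    refine h3.congr_deriv ?_
    ring
  have hval : ∀ s, 0 < s → s * (ein s - (∑ k ∈ Finset.range n, (1 - s / n) ^ k) / n)
      = (1 - s / n) ^ n - Real.exp (-s) := by
    intro s hs
    have h1 := geom_sum_mul (1 - s / n) n
    have h2 := mul_ein s
    have h3 : s * ((∑ k ∈ Finset.range n, (1 - s / n) ^ k) / n)
      = -((∑ k ∈ Finset.range n, (1 - s / n) ^ k) * ((1 - s / n) - 1)) := by
      field_simp; ring
    rw [mul_sub, h3, h1, h2]; ring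
  have hgc : Continuous g := continuous_iff_continuousAt.2 fun x => (hg x).continuousAt
  have hg0 : g 0 = 0 := by simp [g, harmonicPoly]
  have hgn : g n = Ein n - (harmonic n : ℝ) := by
    simp only [g]
    rw [div_self hn'.ne', harmonicPoly_one]
  rw [← hgn]
  have hup : g n ≤ 0 := by
    have := antitoneOn_Icc_of_hasDerivAt (a := 0) (b := n) hgc.continuousOn (fun x _ _ => hg x)
      (fun x hx hxn => by
        have h1 := hval x hx
        have h2 := (exp_neg_sub_one_sub_div_pow hx.le hxn.le).1
        by_contra hc
        push Not at hc
        have := mul_pos hx hc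
        linarith)
      (left_mem_Icc.2 hn'.le) (right_mem_Icc.2 hn'.le) hn'.le
    linarith
  have hlo : -(1 / n) ≤ g n := by
    have hd : ∀ x, HasDerivAt (fun s => g s - (1 + s) * Real.exp (-s) / n)
        (ein x - (∑ k ∈ Finset.range n, (1 - x / n) ^ k) / n + x * Real.exp (-x) / n) x := by
      intro x
      have h1 : HasDerivAt (fun s : ℝ => (1 + s) * Real.exp (-s) / n)
          ((1 * Real.exp (-x) + (1 + x) * (Real.exp (-x) * -1)) / n) x := by
        apply HasDerivAt.div_const
        apply HasDerivAt.mul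
        · simpa using (hasDerivAt_id x).const_add 1
        · exact (hasDerivAt_neg x).exp
      refine ((hg x).fun_sub h1).congr_deriv ?_
      ring
    have := monotoneOn_Icc_of_hasDerivAt (a := 0) (b := n)
      (g := fun s => g s - (1 + s) * Real.exp (-s) / n)
      (continuous_iff_continuousAt.2 fun x => (hd x).continuousAt).continuousOn
      (fun x _ _ => hd x)
      (fun x hx hxn => by
        have h1 := hval x hx
        have h2 := (exp_neg_sub_one_sub_div_pow hx.le hxn.le).2
        have h3 : 0 ≤ x * (ein x - (∑ k ∈ Finset.range n, (1 - x / n) ^ k) / n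
            + x * Real.exp (-x) / n) := by
          rw [mul_add, h1]
          have : x * (x * Real.exp (-x) / n) = x ^ 2 / n * Real.exp (-x) := by ring
          rw [this]; linarith
        exact nonneg_of_mul_nonneg_right h3 hx)
      (left_mem_Icc.2 hn'.le) (right_mem_Icc.2 hn'.le) hn'.le
    simp only [hg0] at this
    have h5 : 0 ≤ (1 + (n : ℝ)) * Real.exp (-n) / n := by positivity
    simp at this
    simp
    linarith
  rw [abs_le]
  exact ⟨hlo, hup.trans (by positivity)⟩

lemma tendsto_Ein_sub_log :
    Tendsto (fun x => Ein x - Real.log x) atTop (𝓝 Real.eulerMascheroniConstant) := by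
  have h1 : Tendsto (fun n : ℕ => Ein n - (harmonic n : ℝ)) atTop (𝓝 0) := by
    apply squeeze_zero_norm (a := fun n : ℕ => 1 / (n : ℝ))
    · intro n; rw [Real.norm_eq_abs]; exact abs_Ein_sub_harmonic n
    · exact tendsto_one_div_atTop_nhds_zero_nat
  have h2 : Tendsto (fun n : ℕ => Ein n - Real.log n) atTop
      (𝓝 Real.eulerMascheroniConstant) := by
    have := h1.add Real.tendsto_harmonic_sub_log
    simpa using this
  have hfl : Tendsto (fun x : ℝ => ⌊x⌋₊) atTop atTop := tendsto_nat_floor_atTop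
  refine tendsto_of_tendsto_of_tendsto_of_le_of_le'
    (((tendsto_add_atTop_iff_nat 1).2 h2).comp hfl) (h2.comp hfl) ?_ ?_
  · filter_upwards [eventually_ge_atTop 1] with x hx
    have := Nat.lt_floor_add_one x
    apply antitoneOn_Ein_sub_log (by simp; linarith : x ∈ Ioi 0)
    · simp; positivity
    · push_cast; exact this.le
  · filter_upwards [eventually_ge_atTop 1] with x hx
    have h3 : 0 < ⌊x⌋₊ := Nat.floor_pos.2 hx
    apply antitoneOn_Ein_sub_log
    · show (0 : ℝ) < (⌊x⌋₊ : ℝ)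
      exact_mod_cast h3
    · simp; linarith
    · exact Nat.floor_le (by linarith)

lemma exp_Ein_le {x : ℝ} (hx : 0 ≤ x) : Real.exp (Ein x) ≤ Real.exp 1 * (1 + x) := by
  have h := Real.exp_le_exp.2 (Ein_le_log hx)
  rwa [Real.exp_add, Real.exp_log (by linarith)] at h

lemma tendsto_exp_Ein_div :
    Tendsto (fun x => Real.exp (Ein x) / x) atTop
      (𝓝 (Real.exp Real.eulerMascheroniConstant)) := by
  have h := (Real.continuous_exp.tendsto _).comp tendsto_Ein_sub_log
  refine h.congr' ?_
  filter_upwards [eventually_gt_atTop 0] with x hx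
  simp [Real.exp_sub, Real.exp_log hx]

/-- The Laplace transform of `exp (c * Ein x)`. -/
noncomputable def Lap (c y : ℝ) : ℝ := ∫ x in Ioi (0 : ℝ), Real.exp (-y * x + c * Ein x)

lemma exists_mul_Ein_le (c : ℝ) {δ : ℝ} (hδ : 0 < δ) :
    ∃ K, ∀ x, 0 ≤ x → c * Ein x ≤ δ * x + K := by
  set ε := δ / (|c| + 1) with hε
  have hc : 0 < |c| + 1 := by positivity
  have hε0 : 0 < ε := by positivity
  refine ⟨(|c| + 1) * (1 + (ε - Real.log ε - 1)), fun x hx => ?_⟩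
  have h1 := Ein_le_log hx
  have h2 : Real.log (1 + x) ≤ ε * (1 + x) - Real.log ε - 1 := by
    have := Real.log_le_sub_one_of_pos (by positivity : 0 < ε * (1 + x))
    rw [Real.log_mul hε0.ne' (by positivity)] at this
    linarith
  have h3 : c * Ein x ≤ (|c| + 1) * Ein x :=
    mul_le_mul_of_nonneg_right (by linarith [le_abs_self c]) (Ein_nonneg hx)
  have h4 : (|c| + 1) * Ein x ≤ (|c| + 1) * (1 + (ε * (1 + x) - Real.log ε - 1)) :=
    mul_le_mul_of_nonneg_left (by linarith) hc.le
  have h5 : (|c| + 1) * ε = δ := by rw [hε]; field_simp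
  have h6 : (|c| + 1) * (1 + (ε * (1 + x) - Real.log ε - 1))
      = (|c| + 1) * ε * x + (|c| + 1) * (1 + (ε - Real.log ε - 1)) := by ring
  rw [h6, h5] at h4
  linarith

lemma exists_lap_bound (c : ℝ) {y : ℝ} (hy : 0 < y) :
    ∃ K, 0 < K ∧ ∀ x, 0 ≤ x → (1 + x) * Real.exp (-y * x + c * Ein x)
      ≤ K * Real.exp (-(y / 2) * x) := by
  obtain ⟨K, hK⟩ := exists_mul_Ein_le c (δ := y / 4) (by positivity)
  refine ⟨Real.exp K * (1 + 4 / y), by positivity, fun x hx => ?_⟩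
  have h1 : 1 + x ≤ (1 + 4 / y) * Real.exp (y / 4 * x) := by
    have h2 := Real.add_one_le_exp (y / 4 * x)
    have h3 : 1 ≤ Real.exp (y / 4 * x) := Real.one_le_exp (by positivity)
    have h4 : x ≤ 4 / y * Real.exp (y / 4 * x) := by
      rw [div_mul_eq_mul_div, le_div_iff₀ hy]; linarith
    linarith
  have h2 : Real.exp (-y * x + c * Ein x) ≤ Real.exp (-y * x + (y / 4 * x + K)) :=
    Real.exp_le_exp.2 (by linarith [hK x hx])
  calc _ ≤ ((1 + 4 / y) * Real.exp (y / 4 * x)) * Real.exp (-y * x + (y / 4 * x + K)) :=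
        mul_le_mul h1 h2 (Real.exp_pos _).le (by positivity)
    _ = (1 + 4 / y) * (Real.exp (y / 4 * x) * Real.exp (-y * x + (y / 4 * x + K))) := by ring
    _ = (1 + 4 / y) * (Real.exp K * Real.exp (-(y / 2) * x)) := by
        rw [← Real.exp_add, ← Real.exp_add]; congr 2; ring
    _ = _ := by ring

lemma continuous_lap_integrand (c y : ℝ) :
    Continuous (fun x => Real.exp (-y * x + c * Ein x)) := by
  have := continuous_Ein
  fun_prop

lemma integrableOn_lap_mul (c : ℝ) {y : ℝ} (hy : 0 < y) {g : ℝ → ℝ} (hg : Continuous g)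
    (hb : ∀ x, 0 < x → |g x| ≤ 1 + x) :
    IntegrableOn (fun x => g x * Real.exp (-y * x + c * Ein x)) (Ioi 0) := by
  obtain ⟨K, hK0, hK⟩ := exists_lap_bound c hy
  have h1 : IntegrableOn (fun x => K * Real.exp (-(y / 2) * x)) (Ioi 0) :=
    (integrableOn_exp_mul_Ioi (by linarith) 0).const_mul K
  refine Integrable.mono' h1
    ((hg.mul (continuous_lap_integrand c y)).aestronglyMeasurable) ?_
  refine (ae_restrict_iff' measurableSet_Ioi).2 (ae_of_all _ fun x hx => ?_)
  have hx0 : 0 < x := hx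
  rw [norm_mul, Real.norm_eq_abs, Real.norm_eq_abs, Real.abs_exp]
  exact (mul_le_mul_of_nonneg_right (hb x hx0) (Real.exp_pos _).le).trans (hK x hx0.le)

lemma integrableOn_lap (c : ℝ) {y : ℝ} (hy : 0 < y) :
    IntegrableOn (fun x => Real.exp (-y * x + c * Ein x)) (Ioi 0) := by
  have := integrableOn_lap_mul c hy (g := fun _ => 1) continuous_const
    (fun x hx => by simp; exact hx.le)
  simpa using this

lemma tendsto_lap_integrand_mul (c : ℝ) {y : ℝ} (hy : 0 < y) {g : ℝ → ℝ}
    (hb : ∀ x, 0 < x → |g x| ≤ 1 + x) :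
    Tendsto (fun x => g x * Real.exp (-y * x + c * Ein x)) atTop (𝓝 0) := by
  obtain ⟨K, hK0, hK⟩ := exists_lap_bound c hy
  have h1 : Tendsto (fun x : ℝ => K * Real.exp (-(y / 2) * x)) atTop (𝓝 0) := by
    have : Tendsto (fun x : ℝ => Real.exp (-(y / 2) * x)) atTop (𝓝 0) := by
      refine Real.tendsto_exp_atBot.comp ?_
      exact tendsto_id.const_mul_atTop_of_neg (by linarith)
    simpa using this.const_mul K
  refine squeeze_zero_norm' ?_ h1
  filter_upwards [eventually_gt_atTop 0] with x hx
  rw [norm_mul, Real.norm_eq_abs, Real.norm_eq_abs, Real.abs_exp]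
  exact (mul_le_mul_of_nonneg_right (hb x hx) (Real.exp_pos _).le).trans (hK x hx.le)

lemma Lap_pos (c : ℝ) {y : ℝ} (hy : 0 < y) : 0 < Lap c y := by
  unfold Lap
  rw [setIntegral_pos_iff_support_of_nonneg_ae]
  · have : Function.support (fun x => Real.exp (-y * x + c * Ein x)) = univ := by
      ext x; simp [Real.exp_ne_zero]
    rw [this]; simp
  · exact ae_of_all _ fun x => (Real.exp_pos _).le
  · exact integrableOn_lap c hy

lemma hasDerivAt_lap_integrand (c y x : ℝ) :
    HasDerivAt (fun x => Real.exp (-y * x + c * Ein x))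
      (Real.exp (-y * x + c * Ein x) * (-y + c * ein x)) x := by
  apply HasDerivAt.exp
  have h1 : HasDerivAt (fun x : ℝ => -y * x) (-y) x := by
    simpa using (hasDerivAt_id x).const_mul (-y)
  exact h1.add ((hasDerivAt_Ein x).const_mul c)

lemma hasDerivAt_Lap (c : ℝ) {y : ℝ} (hy : 0 < y) :
    HasDerivAt (Lap c) (-∫ x in Ioi (0 : ℝ), x * Real.exp (-y * x + c * Ein x)) y := by
  have hs : Metric.ball y (y / 2) ∈ 𝓝 y := Metric.ball_mem_nhds y (by positivity)
  have h := (hasDerivAt_integral_of_dominated_loc_of_deriv_le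
    (μ := volume.restrict (Ioi (0 : ℝ)))
    (F := fun y x => Real.exp (-y * x + c * Ein x))
    (F' := fun y x => Real.exp (-y * x + c * Ein x) * (-x))
    (bound := fun x => x * Real.exp (-(y / 2) * x + c * Ein x)) (x₀ := y) hs
    (Eventually.of_forall fun z => (continuous_lap_integrand c z).aestronglyMeasurable)
    (integrableOn_lap c hy)
    ((continuous_lap_integrand c y).mul continuous_neg).aestronglyMeasurable ?_ ?_ ?_).2
  · refine h.congr_deriv ?_
    rw [← integral_neg]
    congr 1; ext x; ring
  · refine (ae_restrict_iff' measurableSet_Ioi).2 (ae_of_all _ fun x hx z hz => ?_)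
    have hx0 : 0 < x := hx
    rw [norm_mul, Real.norm_eq_abs, Real.norm_eq_abs, Real.abs_exp, abs_neg, abs_of_pos hx0,
      mul_comm]
    apply mul_le_mul_of_nonneg_left _ hx0.le
    apply Real.exp_le_exp.2
    rw [Metric.mem_ball, Real.dist_eq, abs_lt] at hz
    nlinarith [hz.1]
  · exact integrableOn_lap_mul c (by positivity : 0 < y / 2) continuous_id
      (fun x hx => by show |x| ≤ 1 + x; rw [abs_of_pos hx]; linarith)
  · refine ae_of_all _ fun x z _ => ?_
    apply HasDerivAt.exp
    have h1 : HasDerivAt (fun z : ℝ => -z * x) (-1 * x) z := (hasDerivAt_neg z).mul_const x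
    simpa using h1.add_const (c * Ein x)

lemma mul_Lap_eq (c : ℝ) {y : ℝ} (hy : 0 < y) :
    y * Lap c y = 1 + c * ∫ x in Ioi (0 : ℝ), ein x * Real.exp (-y * x + c * Ein x) := by
  have hE : ∀ x : ℝ, 0 < x → |ein x| ≤ 1 + x := fun x hx => by
    rw [abs_of_nonneg (ein_nonneg hx.le)]; linarith [ein_le_one hx.le]
  have hi := integrableOn_lap_mul c hy continuous_ein hE
  have h0 := integrableOn_lap c hy
  have h := integral_Ioi_of_hasDerivAt_of_tendsto' (a := 0)
    (f := fun x => Real.exp (-y * x + c * Ein x)) (m := 0)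
    (f' := fun x => Real.exp (-y * x + c * Ein x) * (-y + c * ein x))
    (fun x _ => hasDerivAt_lap_integrand c y x)
    (by
      have := (h0.const_mul (-y)).add (hi.const_mul c)
      refine this.congr (ae_of_all _ fun x => ?_)
      simp only [Pi.add_apply]; ring)
    (by
      have := tendsto_lap_integrand_mul c hy (g := fun _ => 1) (fun x hx => by simp; exact hx.le)
      simpa using this)
  have h2 : ∫ x in Ioi (0 : ℝ), Real.exp (-y * x + c * Ein x) * (-y + c * ein x)
      = -y * Lap c y + c * ∫ x in Ioi (0 : ℝ), ein x * Real.exp (-y * x + c * Ein x) := by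
    rw [Lap, ← integral_const_mul, ← integral_const_mul,
      ← integral_add (h0.const_mul (-y)) (hi.const_mul c)]
    congr 1; ext x; ring
  rw [h2] at h
  simp only [mul_zero, Ein_zero, add_zero, Real.exp_zero, zero_sub] at h
  linarith

lemma hasDerivAt_mul_Lap (c : ℝ) {y : ℝ} (hy : 0 < y) :
    HasDerivAt (fun y => y * Lap c y) (-c * Lap c y + c * Lap c (y + 1)) y := by
  have h0 := integrableOn_lap c hy
  have h1 := integrableOn_lap c (by linarith : 0 < y + 1)
  have hb : ∀ x : ℝ, 0 < x → |x| ≤ 1 + x := fun x hx => by rw [abs_of_pos hx]; linarith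
  have hx : IntegrableOn (fun x => x * Real.exp (-y * x + c * Ein x)) (Ioi 0) :=
    integrableOn_lap_mul c hy continuous_id hb
  have hd : ∀ x ∈ Ici (0 : ℝ), HasDerivAt (fun x => x * Real.exp (-y * x + c * Ein x))
      ((1 + c) * Real.exp (-y * x + c * Ein x) - y * (x * Real.exp (-y * x + c * Ein x))
        - c * Real.exp (-(y + 1) * x + c * Ein x)) x := by
    intro x _
    refine ((hasDerivAt_id x).mul (hasDerivAt_lap_integrand c y x)).congr_deriv ?_
    have h2 : Real.exp (-(y + 1) * x + c * Ein x)
        = Real.exp (-x) * Real.exp (-y * x + c * Ein x) := by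
      rw [← Real.exp_add]; congr 1; ring
    have h3 := mul_ein x
    rw [h2]
    have h4 : Real.exp (-x) = 1 - x * ein x := by linarith
    rw [h4]; simp only [id]; ring
  have h := integral_Ioi_of_hasDerivAt_of_tendsto' (a := 0) (m := 0) hd
    (((h0.const_mul (1 + c)).sub (hx.const_mul y)).sub (h1.const_mul c))
    (tendsto_lap_integrand_mul c hy hb)
  have h2 : ∫ x in Ioi (0 : ℝ), ((1 + c) * Real.exp (-y * x + c * Ein x)
      - y * (x * Real.exp (-y * x + c * Ein x)) - c * Real.exp (-(y + 1) * x + c * Ein x))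
      = (1 + c) * Lap c y - y * (∫ x in Ioi (0 : ℝ), x * Real.exp (-y * x + c * Ein x))
        - c * Lap c (y + 1) := by
    have hA : IntegrableOn (fun x => (1 + c) * Real.exp (-y * x + c * Ein x)
        - y * (x * Real.exp (-y * x + c * Ein x))) (Ioi 0) :=
      (h0.const_mul (1 + c)).sub (hx.const_mul y)
    rw [Lap, Lap, ← integral_const_mul, ← integral_const_mul, ← integral_const_mul,
      ← integral_sub (h0.const_mul _) (hx.const_mul _), ← integral_sub hA (h1.const_mul _)]
  rw [h2] at h
  refine ((hasDerivAt_id y).mul (hasDerivAt_Lap c hy)).congr_deriv ?_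
  simp at h ⊢
  linarith

lemma continuousOn_Lap (c : ℝ) : ContinuousOn (Lap c) (Ioi 0) :=
  fun _ hy => (hasDerivAt_Lap c hy).continuousAt.continuousWithinAt

lemma antitoneOn_Lap (c : ℝ) : AntitoneOn (Lap c) (Ioi 0) := by
  intro y hy z hz hyz
  apply setIntegral_mono_on (integrableOn_lap c hz) (integrableOn_lap c hy) measurableSet_Ioi
  intro x hx
  have hx0 : 0 < x := hx
  apply Real.exp_le_exp.2
  nlinarith

lemma integral_ein_mul_nonneg (c : ℝ) (y : ℝ) :
    0 ≤ ∫ x in Ioi (0 : ℝ), ein x * Real.exp (-y * x + c * Ein x) :=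
  setIntegral_nonneg measurableSet_Ioi fun _ hx =>
    mul_nonneg (ein_nonneg (le_of_lt hx)) (Real.exp_pos _).le

lemma integral_ein_mul_le (c : ℝ) {y : ℝ} (hy : 0 < y) :
    ∫ x in Ioi (0 : ℝ), ein x * Real.exp (-y * x + c * Ein x) ≤ Lap c y := by
  apply setIntegral_mono_on _ (integrableOn_lap c hy) measurableSet_Ioi
  · intro x hx
    have := ein_le_one (le_of_lt hx)
    have := Real.exp_pos (-y * x + c * Ein x)
    nlinarith
  · exact integrableOn_lap_mul c hy continuous_ein fun x hx => by
      rw [abs_of_nonneg (ein_nonneg hx.le)]; linarith [ein_le_one hx.le]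

lemma abs_mul_Lap_sub_one_le (c : ℝ) {y : ℝ} (hy : 0 < y) :
    |y * Lap c y - 1| ≤ |c| * Lap c y := by
  rw [mul_Lap_eq c hy, add_sub_cancel_left, abs_mul, abs_of_nonneg (integral_ein_mul_nonneg c y)]
  exact mul_le_mul_of_nonneg_left (integral_ein_mul_le c hy) (abs_nonneg c)

lemma mul_Lap_le_one {c y : ℝ} (hc : c ≤ 0) (hy : 0 < y) : y * Lap c y ≤ 1 := by
  rw [mul_Lap_eq c hy]
  have := integral_ein_mul_nonneg c y
  nlinarith

lemma Lap_le {c y : ℝ} (hy : |c| < y) : Lap c y ≤ 1 / (y - |c|) := by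
  have h0 : 0 < y := (abs_nonneg c).trans_lt hy
  have := (abs_le.1 (abs_mul_Lap_sub_one_le c h0)).2
  rw [le_div_iff₀ (by linarith)]
  linarith

lemma tendsto_Lap (c : ℝ) : Tendsto (Lap c) atTop (𝓝 0) := by
  have h1 : Tendsto (fun y : ℝ => 1 / (y - |c|)) atTop (𝓝 0) := by
    simp only [one_div]
    exact tendsto_inv_atTop_zero.comp (tendsto_atTop_add_const_right _ _ tendsto_id)
  refine squeeze_zero' ?_ ?_ h1
  · filter_upwards [eventually_gt_atTop 0] with y hy using (Lap_pos c hy).le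
  · filter_upwards [eventually_gt_atTop |c|] with y hy using Lap_le hy

lemma tendsto_mul_Lap (c : ℝ) : Tendsto (fun y => y * Lap c y) atTop (𝓝 1) := by
  rw [tendsto_iff_norm_sub_tendsto_zero]
  refine squeeze_zero' (Eventually.of_forall fun _ => norm_nonneg _) ?_
    (by simpa using (tendsto_Lap c).const_mul |c|)
  filter_upwards [eventually_gt_atTop 0] with y hy
  exact abs_mul_Lap_sub_one_le c hy

/-- `y ^ κ * (y * Lap κ y)` tends to `exp (γ κ) Γ(κ + 1)` at `0`. -/
lemma tendsto_rpow_mul_Lap {κ : ℝ} (hκ : 0 < κ) :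
    Tendsto (fun y => y ^ κ * (y * Lap κ y)) (𝓝[>] 0)
      (𝓝 (Real.exp Real.eulerMascheroniConstant ^ κ * Real.Gamma (κ + 1))) := by
  have hG : Real.exp Real.eulerMascheroniConstant ^ κ * Real.Gamma (κ + 1)
      = ∫ t in Ioi (0 : ℝ), (t * Real.exp Real.eulerMascheroniConstant) ^ κ * Real.exp (-t) := by
    rw [Real.Gamma_eq_integral (by linarith), ← integral_const_mul]
    apply setIntegral_congr_fun measurableSet_Ioi
    intro t ht
    have ht0 : 0 < t := ht
    simp only [add_sub_cancel_right]
    rw [Real.mul_rpow ht0.le (Real.exp_pos _).le]; ring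
  have hL : ∀ y, 0 < y → y ^ κ * (y * Lap κ y)
      = ∫ t in Ioi (0 : ℝ), (y * Real.exp (Ein (t / y))) ^ κ * Real.exp (-t) := by
    intro y hy
    have h := integral_comp_mul_left_Ioi (fun x => Real.exp (-y * x + κ * Ein x)) 0
      (inv_pos.2 hy)
    simp only [mul_zero, inv_inv, smul_eq_mul] at h
    rw [Lap, ← h, ← integral_const_mul]
    apply setIntegral_congr_fun measurableSet_Ioi
    intro t ht
    simp only
    rw [Real.mul_rpow hy.le (Real.exp_pos _).le, ← Real.exp_mul, mul_assoc, ← Real.exp_add]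
    congr 2
    rw [div_eq_inv_mul]
    field_simp
    ring
  rw [hG]
  refine Tendsto.congr' (f₁ := fun y => ∫ t in Ioi (0 : ℝ),
    (y * Real.exp (Ein (t / y))) ^ κ * Real.exp (-t)) ?_ ?_
  · filter_upwards [self_mem_nhdsWithin] with y hy using (hL y hy).symm
  apply tendsto_integral_filter_of_dominated_convergence
    (fun t => Real.exp 1 ^ κ * ((1 + t) ^ κ * Real.exp (-t)))
  · filter_upwards [self_mem_nhdsWithin] with y hy
    have := continuous_Ein
    apply Continuous.aestronglyMeasurable
    apply Continuous.mul _ (by fun_prop)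
    apply Continuous.rpow_const (by fun_prop)
    intro t; right; exact hκ.le
  · filter_upwards [Ioc_mem_nhdsGT (zero_lt_one (α := ℝ))] with y hy
    refine (ae_restrict_iff' measurableSet_Ioi).2 (ae_of_all _ fun t ht => ?_)
    have ht0 : 0 < t := ht
    have hy0 : 0 < y := hy.1
    rw [Real.norm_of_nonneg (by positivity), ← mul_assoc,
      ← Real.mul_rpow (Real.exp_pos _).le (by positivity)]
    apply mul_le_mul_of_nonneg_right _ (Real.exp_pos _).le
    apply Real.rpow_le_rpow (by positivity) _ hκ.le
    have h1 := exp_Ein_le (x := t / y) (by positivity)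
    have h2 := mul_le_mul_of_nonneg_left h1 hy0.le
    refine h2.trans ?_
    have h3 : y * (Real.exp 1 * (1 + t / y)) = Real.exp 1 * (y + t) := by field_simp
    rw [h3]
    apply mul_le_mul_of_nonneg_left _ (Real.exp_pos _).le
    linarith [hy.2]
  · apply Integrable.const_mul
    have hc : Continuous (fun t : ℝ => (1 + t) ^ κ * Real.exp (-t)) :=
      Continuous.mul (Continuous.rpow_const (by fun_prop) fun t => Or.inr hκ.le) (by fun_prop)
    apply integrable_of_isBigO_exp_neg (b := 1 / 2) (by norm_num) hc.continuousOn
    have h1 := (isLittleO_rpow_exp_pos_mul_atTop κ (by norm_num : (0 : ℝ) < 1 / 2))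
    have h2 := h1.comp_tendsto (tendsto_atTop_add_const_left atTop (1 : ℝ) tendsto_id)
    have h3 := h2.isBigO.mul (Asymptotics.isBigO_refl (fun t : ℝ => Real.exp (-t)) atTop)
    refine h3.trans ?_
    apply Asymptotics.IsBigO.of_bound (Real.exp (1 / 2))
    filter_upwards with t
    simp only [Function.comp, id]
    rw [← Real.exp_add, Real.norm_eq_abs, Real.norm_eq_abs, Real.abs_exp, Real.abs_exp,
      ← Real.exp_add]
    apply Real.exp_le_exp.2
    linarith
  · refine (ae_restrict_iff' measurableSet_Ioi).2 (ae_of_all _ fun t ht => ?_)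
    have ht0 : 0 < t := ht
    apply Tendsto.mul_const
    apply Tendsto.rpow_const _ (Or.inr hκ.le)
    have h1 : Tendsto (fun y : ℝ => t / y) (𝓝[>] 0) atTop := by
      simp only [div_eq_mul_inv]
      exact tendsto_inv_nhdsGT_zero.const_mul_atTop ht0
    have h2 := (tendsto_exp_Ein_div.comp h1).const_mul t
    refine h2.congr' ?_
    filter_upwards [self_mem_nhdsWithin] with y hy
    have hy0 : 0 < y := hy
    simp only [Function.comp]
    field_simp

lemma tendsto_mul_exp_neg_Ein :
    Tendsto (fun x => x * Real.exp (-Ein x)) atTop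
      (𝓝 (Real.exp (-Real.eulerMascheroniConstant))) := by
  have h := tendsto_exp_Ein_div.inv₀ (Real.exp_ne_zero _)
  rw [← Real.exp_neg] at h
  refine h.congr fun x => ?_
  rw [inv_div, Real.exp_neg, div_eq_mul_inv]

lemma Lap_neg_one_one : Lap (-1) 1 = Real.exp (-Real.eulerMascheroniConstant) := by
  have hd : ∀ x ∈ Ici (0 : ℝ), HasDerivAt (fun x => x * Real.exp (-Ein x))
      (Real.exp (-1 * x + -1 * Ein x)) x := by
    intro x _
    refine ((hasDerivAt_id x).mul ((hasDerivAt_Ein x).neg.exp)).congr_deriv ?_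
    have h3 := mul_ein x
    have h4 : Real.exp (-x) = 1 - x * ein x := by linarith
    rw [Real.exp_add, neg_one_mul, neg_one_mul, h4]
    simp only [id, Pi.neg_apply]; ring
  have h := integral_Ioi_of_hasDerivAt_of_tendsto' (a := 0) hd
    (integrableOn_lap (-1) one_pos) tendsto_mul_exp_neg_Ein
  rw [Lap, h]; simp

/-- The constant `A_κ = (2 e^γ)^κ Γ(κ + 1)`. -/
noncomputable def dhConst (κ : ℝ) : ℝ :=
  (2 * Real.exp Real.eulerMascheroniConstant) ^ κ * Real.Gamma (κ + 1)

lemma dhConst_pos {κ : ℝ} (hκ : 0 < κ) : 0 < dhConst κ :=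
  mul_pos (Real.rpow_pos_of_pos (by positivity) _) (Real.Gamma_pos_of_pos (by linarith))

lemma hasDerivAt_window {g : ℝ → ℝ} {a c u : ℝ} (hg : ContinuousOn g (Ioi a)) (hc : 0 ≤ c)
    (hu : a + c < u) :
    HasDerivAt (fun v => ∫ x in (v - c)..v, g x) (g u - g (u - c)) u := by
  have hI : ∀ p q, a < p → a < q → IntervalIntegrable g volume p q := fun p q hp hq =>
    (hg.mono fun x hx => lt_of_lt_of_le (lt_min hp hq) hx.1).intervalIntegrable
  have hD : ∀ w, a < w → HasDerivAt (fun v => ∫ x in u..v, g x) (g w) w := fun w hw =>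
    intervalIntegral.integral_hasDerivAt_right (hI u w (by linarith) hw)
      (hg.stronglyMeasurableAtFilter isOpen_Ioi w hw) (hg.continuousAt (Ioi_mem_nhds hw))
  have h1 := hD u (by linarith)
  have h2 : HasDerivAt (fun v => ∫ x in u..(v - c), g x) (g (u - c)) u :=
    (hD (u - c) (by linarith)).comp_sub_const u c
  refine (h1.fun_sub h2).congr_of_eventuallyEq ?_
  filter_upwards [Ioi_mem_nhds hu] with v hv
  have hv' : a + c < v := hv
  rw [intervalIntegral.integral_interval_sub_left (hI _ _ (by linarith) (by linarith))
    (hI _ _ (by linarith) (by linarith))]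

/-- The integral operator whose fixed point is `σ_κ`. -/
noncomputable def sigOp (κ : ℝ) (s : ℝ → ℝ) (u : ℝ) : ℝ :=
  (max u 0) ^ κ * (1 / dhConst κ - κ * ∫ t in (2 : ℝ)..u, (max t 2) ^ (-κ - 1) * s (t - 2))

noncomputable def sigIter (κ : ℝ) : ℕ → ℝ → ℝ
  | 0 => fun u => (max u 0) ^ κ / dhConst κ
  | n + 1 => sigOp κ (sigIter κ n)

/-- The sieve function `σ_κ`, extended by `0` to the negative half-line. -/
noncomputable def sig (κ : ℝ) (u : ℝ) : ℝ := sigIter κ ⌈u⌉₊ u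

section

variable {κ : ℝ}

lemma continuous_sigOp_integrand {s : ℝ → ℝ} (hs : Continuous s) :
    Continuous (fun t : ℝ => (max t 2) ^ (-κ - 1) * s (t - 2)) := by
  apply Continuous.mul _ (by fun_prop)
  apply Continuous.rpow_const (by fun_prop)
  intro t; left
  have := le_max_right t 2
  linarith

lemma continuous_sigOp (hκ : 0 < κ) {s : ℝ → ℝ} (hs : Continuous s) :
    Continuous (sigOp κ s) := by
  unfold sigOp
  have h1 : Continuous (fun u : ℝ => (max u 0) ^ κ) :=
    Continuous.rpow_const (by fun_prop) fun t => Or.inr hκ.le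
  have h2 : Continuous (fun u => ∫ t in (2 : ℝ)..u, (max t 2) ^ (-κ - 1) * s (t - 2)) :=
    intervalIntegral.continuous_primitive
      (fun a b => (continuous_sigOp_integrand hs).intervalIntegrable a b) 2
  fun_prop

lemma continuous_sigIter (hκ : 0 < κ) : ∀ n, Continuous (sigIter κ n)
  | 0 => (Continuous.rpow_const (by fun_prop) fun t => Or.inr hκ.le).div_const _
  | n + 1 => continuous_sigOp hκ (continuous_sigIter hκ n)

lemma sigIter_of_nonpos (hκ : 0 < κ) {u : ℝ} (hu : u ≤ 0) : ∀ n, sigIter κ n u = 0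
  | 0 => by simp [sigIter, max_eq_right hu, Real.zero_rpow hκ.ne']
  | n + 1 => by simp [sigIter, sigOp, max_eq_right hu, Real.zero_rpow hκ.ne']

lemma sigOp_congr {s s' : ℝ → ℝ} {u : ℝ} (h : ∀ v ≤ max (u - 2) 0, s v = s' v) :
    sigOp κ s u = sigOp κ s' u := by
  unfold sigOp
  congr 3
  apply intervalIntegral.integral_congr
  intro t ht
  simp only
  rw [h]
  have h1 := ht.2
  rcases le_total u 2 with h2 | h2
  · rw [max_eq_left h2] at h1
    exact (by linarith : t - 2 ≤ 0).trans (le_max_right _ _)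
  · rw [max_eq_right h2] at h1
    exact (by linarith : t - 2 ≤ u - 2).trans (le_max_left _ _)

lemma sigOp_of_le_two {s : ℝ → ℝ} (hs : ∀ v ≤ 0, s v = 0) {u : ℝ} (hu : u ≤ 2) :
    sigOp κ s u = (max u 0) ^ κ / dhConst κ := by
  have : ∫ t in (2 : ℝ)..u, (max t 2) ^ (-κ - 1) * s (t - 2) = 0 := by
    rw [← intervalIntegral.integral_zero (a := 2) (b := u) (μ := volume)]
    apply intervalIntegral.integral_congr
    intro t ht
    have h1 := ht.2
    rw [max_eq_left hu] at h1
    simp [hs (t - 2) (by linarith)]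
  rw [sigOp, this]; ring

lemma sigIter_succ_eq (hκ : 0 < κ) : ∀ n : ℕ, ∀ u : ℝ, u ≤ 2 * n + 2 →
    sigIter κ (n + 1) u = sigIter κ n u
  | 0, u, hu => by
      exact sigOp_of_le_two (fun v hv => sigIter_of_nonpos hκ hv 0) (by simpa using hu)
  | n + 1, u, hu => by
      rw [sigIter, sigIter]
      apply sigOp_congr
      intro v hv
      apply sigIter_succ_eq hκ n v
      refine hv.trans (max_le ?_ (by positivity))
      push_cast at hu; linarith

lemma sigIter_eq (hκ : 0 < κ) {m n : ℕ} (hmn : n ≤ m) {u : ℝ} (hu : u ≤ 2 * n + 2) :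
    sigIter κ m u = sigIter κ n u := by
  induction m, hmn using Nat.le_induction with
  | base => rfl
  | succ m hm ih =>
    rw [sigIter_succ_eq hκ m u, ih]
    have : (n : ℝ) ≤ m := by exact_mod_cast hm
    linarith

lemma sig_eq_sigIter (hκ : 0 < κ) {n : ℕ} {u : ℝ} (hu : u ≤ 2 * n + 2) :
    sig κ u = sigIter κ n u := by
  have h1 : u ≤ 2 * (⌈u⌉₊ : ℝ) + 2 := by
    have := Nat.le_ceil u
    have : (0 : ℝ) ≤ (⌈u⌉₊ : ℝ) := by positivity
    linarith
  rcases le_total n ⌈u⌉₊ with h | h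
  · exact sigIter_eq hκ h hu
  · exact (sigIter_eq hκ h h1).symm

lemma continuous_sig (hκ : 0 < κ) : Continuous (sig κ) := by
  rw [continuous_iff_continuousAt]
  intro u
  refine ((continuous_sigIter hκ (⌈u⌉₊)).continuousAt).congr ?_
  have h1 := Nat.le_ceil u
  have h2 : (0 : ℝ) ≤ (⌈u⌉₊ : ℝ) := by positivity
  filter_upwards [Iio_mem_nhds (by linarith : u < 2 * (⌈u⌉₊ : ℝ) + 2)] with v hv
  exact (sig_eq_sigIter hκ (le_of_lt hv)).symm

lemma sig_of_nonpos (hκ : 0 < κ) {u : ℝ} (hu : u ≤ 0) : sig κ u = 0 :=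
  sigIter_of_nonpos hκ hu _

lemma sig_eq_sigOp (hκ : 0 < κ) (u : ℝ) : sig κ u = sigOp κ (sig κ) u := by
  have h1 := Nat.le_ceil u
  have h2 : (0 : ℝ) ≤ (⌈u⌉₊ : ℝ) := by positivity
  rw [sig_eq_sigIter hκ (n := ⌈u⌉₊ + 1) (u := u) (by push_cast; linarith), sigIter]
  apply sigOp_congr
  intro v hv
  rw [sig_eq_sigIter hκ]
  exact hv.trans (max_le (by linarith) (by positivity))

lemma sig_of_le_two (hκ : 0 < κ) {u : ℝ} (h0 : 0 ≤ u) (hu : u ≤ 2) :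
    sig κ u = u ^ κ / dhConst κ := by
  rw [sig_eq_sigOp hκ, sigOp_of_le_two (fun v hv => sig_of_nonpos hκ hv) hu, max_eq_left h0]

lemma hasDerivAt_rpow_neg_mul_sig (hκ : 0 < κ) {u : ℝ} (hu : 0 < u) :
    HasDerivAt (fun v => v ^ (-κ) * sig κ v) (-(κ * u ^ (-κ - 1) * sig κ (u - 2))) u := by
  have hc := continuous_sigOp_integrand (κ := κ) (continuous_sig hκ)
  have h1 : HasDerivAt (fun u => ∫ t in (2 : ℝ)..u, (max t 2) ^ (-κ - 1) * sig κ (t - 2))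
      ((max u 2) ^ (-κ - 1) * sig κ (u - 2)) u :=
    intervalIntegral.integral_hasDerivAt_right (hc.intervalIntegrable _ _)
      hc.aestronglyMeasurable.stronglyMeasurableAtFilter hc.continuousAt
  have h2 := (h1.const_mul κ).const_sub (1 / dhConst κ)
  have h3 : (max u 2) ^ (-κ - 1) * sig κ (u - 2) = u ^ (-κ - 1) * sig κ (u - 2) := by
    rcases le_total u 2 with h | h
    · rw [sig_of_nonpos hκ (by linarith)]; simp
    · rw [max_eq_left h]
  rw [h3] at h2
  refine (h2.congr_deriv (by ring)).congr_of_eventuallyEq ?_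
  filter_upwards [Ioi_mem_nhds hu] with v hv
  have hv0 : 0 < v := hv
  rw [sig_eq_sigOp hκ v, sigOp, max_eq_left hv0.le, ← mul_assoc, ← Real.rpow_add hv0]
  simp

lemma hasDerivAt_sig (hκ : 0 < κ) {u : ℝ} (hu : 0 < u) :
    HasDerivAt (sig κ) (κ / u * (sig κ u - sig κ (u - 2))) u := by
  have h1 := hasDerivAt_rpow_neg_mul_sig hκ hu
  have h2 := (Real.hasDerivAt_rpow_const (p := κ) (Or.inl hu.ne')).mul h1
  have h3 : u ^ (-κ) * u ^ κ = 1 := by rw [← Real.rpow_add hu]; simp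
  have h4 : u ^ (κ - 1) = u ^ κ / u := Real.rpow_sub_one hu.ne' κ
  have h5 : u ^ (-κ - 1) = u ^ (-κ) / u := Real.rpow_sub_one hu.ne' (-κ)
  refine (h2.congr_deriv ?_).congr_of_eventuallyEq ?_
  · rw [h4, h5]
    linear_combination (κ / u * (sig κ u - sig κ (u - 2))) * h3
  · filter_upwards [Ioi_mem_nhds hu] with v hv
    have hv0 : 0 < v := hv
    simp only [Pi.mul_apply]
    rw [← mul_assoc, ← Real.rpow_add hv0]; simp

lemma strictMonoOn_Icc_sig (hκ : 0 < κ) {b : ℝ}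
    (h : ∀ u, 0 < u → u < b → sig κ (u - 2) < sig κ u) : StrictMonoOn (sig κ) (Icc 0 b) := by
  apply strictMonoOn_of_deriv_pos (convex_Icc 0 b) (continuous_sig hκ).continuousOn
  intro u hu
  rw [interior_Icc] at hu
  rw [(hasDerivAt_sig hκ hu.1).deriv]
  have := hu.1
  exact mul_pos (by positivity) (sub_pos.2 (h u hu.1 hu.2))

lemma sig_pos_of_le_two (hκ : 0 < κ) {u : ℝ} (h0 : 0 < u) (hu : u ≤ 2) : 0 < sig κ u := by
  rw [sig_of_le_two hκ h0.le hu]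
  exact div_pos (Real.rpow_pos_of_pos h0 _) (dhConst_pos hκ)

lemma sig_sub_two_lt (hκ : 0 < κ) {u : ℝ} (h0 : 0 < u) : sig κ (u - 2) < sig κ u := by
  by_contra hc
  push Not at hc
  set T : Set ℝ := {v | 2 ≤ v ∧ sig κ v ≤ sig κ (v - 2)} with hT
  have hpos : ∀ v, 0 < v → v ≤ 2 → sig κ (v - 2) < sig κ v := fun v hv hv2 => by
    rw [sig_of_nonpos hκ (by linarith : v - 2 ≤ 0)]
    exact sig_pos_of_le_two hκ hv hv2
  have hcl : IsClosed T :=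
    isClosed_Ici.inter (isClosed_le (continuous_sig hκ)
      ((continuous_sig hκ).comp (continuous_id.sub continuous_const)))
  have hne : T.Nonempty := ⟨u, by
    by_contra h
    push Not at h
    exact absurd (hpos u h0 h.le) (not_lt.2 hc), hc⟩
  have hbd : BddBelow T := ⟨2, fun v hv => hv.1⟩
  have hmem := hcl.csInf_mem hne hbd
  set v := sInf T
  have hlt : ∀ x, 0 < x → x < v → sig κ (x - 2) < sig κ x := by
    intro x hx hxv
    rcases le_total x 2 with h2 | h2
    · exact hpos x hx h2
    · by_contra h
      push Not at h
      exact absurd (csInf_le hbd ⟨h2, h⟩) (not_le.2 hxv)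
  have hm := strictMonoOn_Icc_sig hκ hlt
  have h1 := hmem.1
  have h2 := hmem.2
  have := hm ⟨by linarith, by linarith⟩ (right_mem_Icc.2 (by linarith : (0 : ℝ) ≤ v))
    (by linarith : v - 2 < v)
  linarith

lemma strictMonoOn_sig (hκ : 0 < κ) : StrictMonoOn (sig κ) (Ici 0) := by
  intro x hx y hy hxy
  exact strictMonoOn_Icc_sig hκ (b := y) (fun u hu _ => sig_sub_two_lt hκ hu) ⟨hx, hxy.le⟩
    ⟨hy, le_rfl⟩ hxy

lemma sig_pos (hκ : 0 < κ) {u : ℝ} (hu : 0 < u) : 0 < sig κ u := by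
  have := strictMonoOn_sig hκ self_mem_Ici (mem_Ici.2 hu.le) hu
  rwa [sig_of_nonpos hκ le_rfl] at this

lemma sig_nonneg (hκ : 0 < κ) (u : ℝ) : 0 ≤ sig κ u := by
  rcases le_or_gt u 0 with h | h
  · rw [sig_of_nonpos hκ h]
  · exact (sig_pos hκ h).le

lemma monotone_sig (hκ : 0 < κ) : Monotone (sig κ) := by
  intro x y hxy
  rcases le_or_gt x 0 with h | h
  · rw [sig_of_nonpos hκ h]; exact sig_nonneg hκ y
  · exact (strictMonoOn_sig hκ).monotoneOn h.le (h.le.trans hxy) hxy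

lemma eq_of_hasDerivAt_zero {g : ℝ → ℝ} {a : ℝ} (hd : ∀ x, a < x → HasDerivAt g 0 x) {x y : ℝ}
    (hx : a < x) (hy : a < y) : g x = g y := by
  have hfd : ∀ z ∈ Ioi a, HasDerivWithinAt g 0 (Ioi a) z := fun z hz =>
    (hd z hz).hasDerivWithinAt
  exact (convex_Ioi a).is_const_of_fderivWithin_eq_zero (𝕜 := ℝ)
    (fun z hz => (hd z hz).differentiableAt.differentiableWithinAt)
    (fun z hz => by
      have := (hd z hz).hasFDerivAt.hasFDerivWithinAt (s := Ioi a)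
      rw [this.fderivWithin (isOpen_Ioi.uniqueDiffWithinAt hz)]
      ext; simp) hx hy

lemma mul_Lap_sub_integral (c : ℝ) {y : ℝ} (hy : 0 < y) :
    y * Lap c y - c * ∫ x in y..(y + 1), Lap c x = 1 := by
  set g : ℝ → ℝ := fun y => y * Lap c y - c * ∫ x in y..(y + 1), Lap c x
  have hd : ∀ x, 0 < x → HasDerivAt g 0 x := by
    intro x hx
    have h1 : HasDerivAt (fun v => ∫ t in (v - 1)..v, Lap c t)
        (Lap c (x + 1) - Lap c (x + 1 - 1)) (x + 1) :=
      hasDerivAt_window (continuousOn_Lap c) zero_le_one (by linarith)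
    have h2 := h1.comp_add_const x 1
    simp only [add_sub_cancel_right] at h2
    refine ((hasDerivAt_mul_Lap c hx).fun_sub (h2.const_mul c)).congr_deriv ?_
    ring
  have hlim : Tendsto g atTop (𝓝 (1 - c * 0)) := by
    apply (tendsto_mul_Lap c).sub
    apply Tendsto.const_mul
    refine squeeze_zero' ?_ ?_ (tendsto_Lap c)
    · filter_upwards [eventually_gt_atTop 0] with y hy
      exact intervalIntegral.integral_nonneg (by linarith)
        fun x hx => (Lap_pos c (hy.trans_le hx.1)).le
    · filter_upwards [eventually_gt_atTop 0] with y hy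
      have hI : IntervalIntegrable (Lap c) volume y (y + 1) := by
        apply ContinuousOn.intervalIntegrable
        apply (continuousOn_Lap c).mono
        intro x hx
        rw [uIcc_of_le (by linarith)] at hx
        exact hy.trans_le hx.1
      have := intervalIntegral.integral_mono_on (by linarith : y ≤ y + 1) hI
        (intervalIntegrable_const (c := Lap c y))
        (fun x hx => antitoneOn_Lap c (mem_Ioi.2 hy) (mem_Ioi.2 (hy.trans_le hx.1)) hx.1)
      simpa using this
  have hev : ∀ᶠ z in atTop, g z = g y := by
    filter_upwards [eventually_gt_atTop 0] with z hz
    exact eq_of_hasDerivAt_zero hd hz hy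
  have := tendsto_nhds_unique (hlim.congr' hev) tendsto_const_nhds
  linarith

lemma integrand_sig_Lap_continuousOn (hκ : 0 < κ) :
    ContinuousOn (fun x => sig κ (2 * x) * Lap κ (x + 1)) (Ioi (-1)) := by
  apply ContinuousOn.mul
  · exact ((continuous_sig hκ).comp (by fun_prop)).continuousOn
  · apply (continuousOn_Lap κ).comp (by fun_prop)
    intro x hx
    simp only [mem_Ioi] at hx ⊢; linarith

lemma sig_Lap_invariant (hκ : 0 < κ) {y : ℝ} (hy : 0 < y) :
    y * sig κ (2 * y) * Lap κ y - κ * ∫ x in (y - 1)..y, sig κ (2 * x) * Lap κ (x + 1) = 1 := by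
  set g : ℝ → ℝ := fun y =>
    (y * Lap κ y) * sig κ (2 * y) - κ * ∫ x in (y - 1)..y, sig κ (2 * x) * Lap κ (x + 1)
    with hg
  have hcont := integrand_sig_Lap_continuousOn hκ
  have hd : ∀ x, 0 < x → HasDerivAt g 0 x := by
    intro x hx
    have h1 := hasDerivAt_window hcont zero_le_one (by linarith : -1 + 1 < x)
    have h2 : HasDerivAt (fun y => sig κ (2 * y))
        (κ / (2 * x) * (sig κ (2 * x) - sig κ (2 * x - 2)) * (2 * 1)) x :=
      (hasDerivAt_sig hκ (by linarith : 0 < 2 * x)).comp x ((hasDerivAt_id x).const_mul 2)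
    refine (((hasDerivAt_mul_Lap κ hx).mul h2).fun_sub (h1.const_mul κ)).congr_deriv ?_
    have h3 : (2 : ℝ) * (x - 1) = 2 * x - 2 := by ring
    rw [sub_add_cancel, h3]
    field_simp
    ring
  have hlim : Tendsto g (𝓝[>] 0) (𝓝 (1 - κ * 0)) := by
    apply Tendsto.sub
    · have h := (tendsto_rpow_mul_Lap hκ).const_mul (2 ^ κ / dhConst κ)
      have h1 : 2 ^ κ / dhConst κ * (Real.exp Real.eulerMascheroniConstant ^ κ
          * Real.Gamma (κ + 1)) = 1 := by
        have h2 := (dhConst_pos hκ).ne'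
        have h3 : dhConst κ = 2 ^ κ * (Real.exp Real.eulerMascheroniConstant ^ κ
          * Real.Gamma (κ + 1)) := by
          rw [dhConst, Real.mul_rpow (by norm_num) (Real.exp_pos _).le]; ring
        rw [div_mul_eq_mul_div, ← h3, div_self h2]
      rw [h1] at h
      refine h.congr' ?_
      filter_upwards [Ioc_mem_nhdsGT (zero_lt_one (α := ℝ))] with y hy
      rw [sig_of_le_two hκ (by linarith [hy.1]) (by linarith [hy.2]),
        Real.mul_rpow (by norm_num) hy.1.le]
      ring
    · apply Tendsto.const_mul
      have h1 : Tendsto (fun y : ℝ => ∫ x in (0 : ℝ)..y, sig κ (2 * x) * Lap κ (x + 1))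
          (𝓝[>] 0) (𝓝 0) := by
        have h2 : HasDerivAt (fun y : ℝ => ∫ x in (0 : ℝ)..y, sig κ (2 * x) * Lap κ (x + 1))
            (sig κ (2 * 0) * Lap κ (0 + 1)) 0 := by
          refine intervalIntegral.integral_hasDerivAt_right (by simp) ?_ ?_
          · exact hcont.stronglyMeasurableAtFilter isOpen_Ioi 0 (by simp)
          · exact hcont.continuousAt (Ioi_mem_nhds (by norm_num))
        have h3 := h2.continuousAt.tendsto
        rw [intervalIntegral.integral_same] at h3
        exact h3.mono_left nhdsWithin_le_nhds
      refine h1.congr' ?_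
      filter_upwards [Ioc_mem_nhdsGT (zero_lt_one (α := ℝ))] with y hy
      have h4 : ∀ p q, -1 < p → -1 < q →
          IntervalIntegrable (fun x => sig κ (2 * x) * Lap κ (x + 1)) volume p q :=
        fun p q hp hq => (hcont.mono fun x hx =>
          lt_of_lt_of_le (lt_min hp hq) hx.1).intervalIntegrable
      rw [← intervalIntegral.integral_add_adjacent_intervals
        (h4 (y - 1) 0 (by linarith [hy.1]) (by norm_num))
        (h4 0 y (by norm_num) (by linarith [hy.1]))]
      have h5 : ∫ x in (y - 1)..0, sig κ (2 * x) * Lap κ (x + 1) = 0 := by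
        refine (intervalIntegral.integral_congr (g := fun _ => 0) ?_).trans
          intervalIntegral.integral_zero
        intro x hx
        rw [uIcc_of_le (by linarith [hy.2])] at hx
        simp [sig_of_nonpos hκ (by linarith [hx.2] : 2 * x ≤ 0)]
      rw [h5, zero_add]
  have hev : ∀ᶠ z in 𝓝[>] 0, g z = g y := by
    filter_upwards [self_mem_nhdsWithin] with z hz
    exact eq_of_hasDerivAt_zero hd hz hy
  have := tendsto_nhds_unique (hlim.congr' hev) tendsto_const_nhds
  simp only [hg] at this
  linarith

lemma intervalIntegrable_Lap_add_one (c : ℝ) {y : ℝ} (hy : 0 < y) :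
    IntervalIntegrable (fun x => Lap c (x + 1)) volume (y - 1) y := by
  apply ContinuousOn.intervalIntegrable
  apply (continuousOn_Lap c).comp (by fun_prop)
  intro x hx
  rw [uIcc_of_le (by linarith)] at hx
  have := hx.1
  simp only [mem_Ioi]; linarith

lemma sig_le_one (hκ : 0 < κ) (u : ℝ) : sig κ u ≤ 1 := by
  rcases le_or_gt u 0 with h | h
  · rw [sig_of_nonpos hκ h]; exact zero_le_one
  obtain ⟨y, rfl⟩ : ∃ y, u = 2 * y := ⟨u / 2, by ring⟩
  have hy : 0 < y := by linarith
  have h1 := sig_Lap_invariant hκ hy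
  have h2 := mul_Lap_sub_integral κ hy
  have hI : IntervalIntegrable (fun x => sig κ (2 * x) * Lap κ (x + 1)) volume (y - 1) y :=
    ((integrand_sig_Lap_continuousOn hκ).mono fun x hx => by
      rw [uIcc_of_le (by linarith)] at hx
      exact lt_of_lt_of_le (by linarith) hx.1).intervalIntegrable
  have h3 : ∫ x in (y - 1)..y, sig κ (2 * x) * Lap κ (x + 1)
      ≤ ∫ x in (y - 1)..y, sig κ (2 * y) * Lap κ (x + 1) := by
    apply intervalIntegral.integral_mono_on (by linarith) hI
      ((intervalIntegrable_Lap_add_one κ hy).const_mul _)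
    intro x hx
    exact mul_le_mul_of_nonneg_right (monotone_sig hκ (by linarith [hx.2]))
      (Lap_pos κ (by linarith [hx.1])).le
  rw [intervalIntegral.integral_const_mul] at h3
  have h4 : ∫ x in (y - 1)..y, Lap κ (x + 1) = ∫ x in y..(y + 1), Lap κ x := by
    rw [intervalIntegral.integral_comp_add_right, sub_add_cancel]
  rw [h4] at h3
  have h5 : sig κ (2 * y) * (y * Lap κ y - κ * ∫ x in y..(y + 1), Lap κ x) ≤ 1 := by
    have := mul_le_mul_of_nonneg_left h3 hκ.le
    linarith
  rw [h2] at h5; linarith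

lemma tendsto_sig (hκ : 0 < κ) : Tendsto (sig κ) atTop (𝓝 1) := by
  have hb : BddAbove (range (sig κ)) := ⟨1, by rintro _ ⟨u, rfl⟩; exact sig_le_one hκ u⟩
  have h1 := tendsto_atTop_ciSup (monotone_sig hκ) hb
  set L := ⨆ i, sig κ i
  have h2 : Tendsto (fun y : ℝ => sig κ (2 * y)) atTop (𝓝 L) :=
    h1.comp (tendsto_id.const_mul_atTop (by norm_num))
  have h3 : Tendsto (fun y => (y * Lap κ y) * sig κ (2 * y)
      - κ * ∫ x in (y - 1)..y, sig κ (2 * x) * Lap κ (x + 1)) atTop (𝓝 (1 * L - κ * 0)) := by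
    apply ((tendsto_mul_Lap κ).mul h2).sub
    apply Tendsto.const_mul
    refine squeeze_zero' ?_ ?_ (tendsto_Lap κ)
    · filter_upwards [eventually_gt_atTop 0] with y hy
      apply intervalIntegral.integral_nonneg (by linarith)
      intro x hx
      exact mul_nonneg (sig_nonneg hκ _) (Lap_pos κ (by linarith [hx.1])).le
    · filter_upwards [eventually_gt_atTop 0] with y hy
      have hI : IntervalIntegrable (fun x => sig κ (2 * x) * Lap κ (x + 1)) volume (y - 1) y :=
        ((integrand_sig_Lap_continuousOn hκ).mono fun x hx => by
          rw [uIcc_of_le (by linarith)] at hx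
          exact lt_of_lt_of_le (by linarith) hx.1).intervalIntegrable
      have := intervalIntegral.integral_mono_on (by linarith : y - 1 ≤ y) hI
        (intervalIntegrable_const (c := Lap κ y)) (fun x hx => by
          have h4 := antitoneOn_Lap κ (mem_Ioi.2 hy)
            (mem_Ioi.2 (by linarith [hx.1] : 0 < x + 1)) (by linarith [hx.1])
          have h5 := sig_le_one hκ (2 * x)
          have h6 := sig_nonneg hκ (2 * x)
          have h7 := Lap_pos κ (by linarith [hx.1] : 0 < x + 1)
          nlinarith)
      simpa using this
  have h4 := h3.congr' (f₂ := fun _ => (1 : ℝ)) (by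
    filter_upwards [eventually_gt_atTop 0] with y hy
    have := sig_Lap_invariant hκ hy
    linarith)
  have h5 := tendsto_nhds_unique h4 tendsto_const_nhds
  have : L = 1 := by linarith
  rwa [this] at h1

lemma mul_one_sub_sig_le (hκ : 0 < κ) {u : ℝ} (hu : 0 < u) :
    u * (1 - sig κ u) ≤ κ * ∫ x in (u - 2)..u, (1 - sig κ x) := by
  set g : ℝ → ℝ := fun t => u * (1 - sig κ t) - κ * ∫ x in (t - 2)..t, (1 - sig κ x) with hg
  have hc : Continuous fun x => 1 - sig κ x := continuous_const.sub (continuous_sig hκ)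
  have hd : ∀ t, 0 < t → HasDerivAt g (-((u - t) * (κ / t * (sig κ t - sig κ (t - 2))))) t := by
    intro t ht
    have h1 := hasDerivAt_window (a := t - 3) hc.continuousOn zero_le_two
      (by linarith : t - 3 + 2 < t)
    refine ((((hasDerivAt_sig hκ ht).const_sub 1).const_mul u).fun_sub
      (h1.const_mul κ)).congr_deriv ?_
    field_simp
    ring
  have hmono : MonotoneOn g (Ici u) := by
    apply monotoneOn_Ici_of_hasDerivAt
    · exact fun x hx => (hd x (hu.trans_le hx)).continuousAt.continuousWithinAt
    · exact fun x hx => hd x (hu.trans hx)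
    · intro x hx
      have h1 := sub_pos.2 (sig_sub_two_lt hκ (hu.trans hx))
      have h2 : 0 < κ / x := div_pos hκ (hu.trans hx)
      have h3 := mul_pos h2 h1
      nlinarith
  have hW : Tendsto (fun t => 1 - sig κ t) atTop (𝓝 0) := by
    simpa using (tendsto_sig hκ).const_sub 1
  have hlim : Tendsto g atTop (𝓝 (u * 0 - κ * 0)) := by
    apply (hW.const_mul u).sub
    apply Tendsto.const_mul
    have h1 : Tendsto (fun t => 2 * (1 - sig κ (t - 2))) atTop (𝓝 0) := by
      have := (hW.comp (tendsto_atTop_add_const_right atTop (-2 : ℝ) tendsto_id)).const_mul 2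
      simpa [← sub_eq_add_neg] using this
    refine squeeze_zero (fun t => ?_) (fun t => ?_) h1
    · exact intervalIntegral.integral_nonneg (by linarith)
        fun x _ => sub_nonneg.2 (sig_le_one hκ x)
    · have := intervalIntegral.integral_mono_on (μ := volume) (by linarith : t - 2 ≤ t)
        (hc.intervalIntegrable _ _) (intervalIntegrable_const (c := 1 - sig κ (t - 2)))
        (fun x hx => by have := monotone_sig hκ hx.1; linarith)
      rwa [intervalIntegral.integral_const, sub_sub_cancel, smul_eq_mul] at this
  have h0 : g u ≤ u * 0 - κ * 0 := by
    apply ge_of_tendsto hlim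
    filter_upwards [eventually_ge_atTop u] with t ht
    exact hmono self_mem_Ici ht ht
  simp only [hg] at h0
  linarith

lemma one_sub_sig_le (hκ : 0 < κ) {u : ℝ} (hu : 0 < u) :
    u * (1 - sig κ u) ≤ 2 * κ * (1 - sig κ (u - 2)) := by
  have hc : Continuous fun x => 1 - sig κ x := continuous_const.sub (continuous_sig hκ)
  have h := intervalIntegral.integral_mono_on (μ := volume) (by linarith : u - 2 ≤ u)
        (hc.intervalIntegrable _ _) (intervalIntegrable_const (c := 1 - sig κ (u - 2)))
        (fun x hx => by have := monotone_sig hκ hx.1; linarith)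
  rw [intervalIntegral.integral_const, sub_sub_cancel, smul_eq_mul] at h
  have := mul_one_sub_sig_le hκ hu
  nlinarith

/-- `1 - σ_κ` decays exponentially. -/
lemma exists_one_sub_sig_le (hκ : 0 < κ) :
    ∃ C, 0 < C ∧ ∀ u, 1 - sig κ u ≤ C * Real.exp (-(3 * u)) := by
  set U := 2 * κ * Real.exp 6 with hU
  have hU0 : 0 < U := by positivity
  refine ⟨Real.exp (3 * U), Real.exp_pos _, fun u => ?_⟩
  have key : ∀ n : ℕ, ∀ u ≤ U + n, 1 - sig κ u ≤ Real.exp (3 * U) * Real.exp (-(3 * u)) := by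
    intro n
    induction n with
    | zero =>
      intro u hu
      have h1 := sig_nonneg hκ u
      rw [← Real.exp_add]
      have h2 : 1 ≤ Real.exp (3 * U + -(3 * u)) := Real.one_le_exp (by simp at hu; linarith)
      linarith
    | succ n ih =>
      intro u hu
      push_cast at hu
      rcases le_or_gt u U with h | h
      · exact ih u (by have : (0 : ℝ) ≤ n := n.cast_nonneg
                       linarith)
      have hu0 : 0 < u := hU0.trans h
      have h1 := one_sub_sig_le hκ hu0
      have h2 := ih (u - 2) (by linarith)
      have h3 : Real.exp (-(3 * (u - 2))) = Real.exp 6 * Real.exp (-(3 * u)) := by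
        rw [← Real.exp_add]; congr 1; ring
      rw [h3] at h2
      have h4 : u * (1 - sig κ u) ≤ u * (Real.exp (3 * U) * Real.exp (-(3 * u))) :=
        calc _ ≤ 2 * κ * (1 - sig κ (u - 2)) := h1
          _ ≤ 2 * κ * (Real.exp (3 * U) * (Real.exp 6 * Real.exp (-(3 * u)))) :=
            mul_le_mul_of_nonneg_left h2 (by positivity)
          _ = U * (Real.exp (3 * U) * Real.exp (-(3 * u))) := by rw [hU]; ring
          _ ≤ _ := mul_le_mul_of_nonneg_right h.le (by positivity)
      exact le_of_mul_le_mul_left h4 hu0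
  obtain ⟨n, hn⟩ := exists_nat_ge (u - U)
  exact key n u (by linarith)

end

/-- The tail integral `κ ∫_u^∞ t^(κ-1) g(t-1) dt`. -/
noncomputable def tail (κ : ℝ) (g : ℝ → ℝ) (u : ℝ) : ℝ :=
  κ * ∫ t in Ioi u, t ^ (κ - 1) * g (t - 1)

/-- Nonnegative antitone functions on `(0, ∞)` with exponential decay of rate `2`. -/
structure IsDefect (g : ℝ → ℝ) : Prop where
  anti : AntitoneOn g (Ioi 0)
  nonneg : ∀ t, 0 < t → 0 ≤ g t
  decay : ∃ C, ∀ t, 1 ≤ t → g t ≤ C * Real.exp (-(2 * t))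

section

variable {κ : ℝ} {g g' : ℝ → ℝ}

lemma exists_rpow_mul_le (hκ : 1 < κ) : ∃ K, 0 < K ∧ ∀ t, 1 ≤ t →
    t ^ (κ - 1) ≤ K * Real.exp t := by
  have h := isLittleO_rpow_exp_pos_mul_atTop (κ - 1) one_pos
  obtain ⟨T, hT⟩ := eventually_atTop.1 (h.bound one_pos)
  set T' := max T 1
  refine ⟨max 1 (T' ^ (κ - 1)), by positivity, fun t ht => ?_⟩
  have h1 : (1 : ℝ) ≤ Real.exp t := Real.one_le_exp (by linarith)
  rcases le_total T' t with h2 | h2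
  · have h3 := hT t ((le_max_left _ _).trans h2)
    rw [Real.norm_of_nonneg (by positivity), Real.norm_of_nonneg (by positivity), one_mul,
      one_mul] at h3
    exact h3.trans (le_mul_of_one_le_left (Real.exp_pos _).le (le_max_left _ _))
  · calc t ^ (κ - 1) ≤ T' ^ (κ - 1) := Real.rpow_le_rpow (by linarith) h2 (by linarith)
      _ ≤ max 1 (T' ^ (κ - 1)) * 1 := by rw [mul_one]; exact le_max_right _ _
      _ ≤ _ := mul_le_mul_of_nonneg_left h1 (by positivity)

/-- Pointwise bound of the tail integrand. -/
lemma exists_tail_integrand_le (hκ : 1 < κ) {m C : ℝ}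
    (hg : ∀ t, 1 ≤ t → g t ≤ C * Real.exp (-((m + 1) * t))) (hg0 : ∀ t, 1 ≤ t → 0 ≤ g t) :
    ∃ K, 0 < K ∧ ∀ t, 2 ≤ t → t ^ (κ - 1) * g (t - 1) ≤ K * Real.exp (-(m * t)) := by
  obtain ⟨K, hK, hb⟩ := exists_rpow_mul_le hκ
  refine ⟨K * (|C| + 1) * Real.exp (m + 1), by positivity, fun t ht => ?_⟩
  have h1 := hb t (by linarith)
  have h2 : g (t - 1) ≤ (|C| + 1) * Real.exp (-((m + 1) * (t - 1))) :=
    (hg (t - 1) (by linarith)).trans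
      (mul_le_mul_of_nonneg_right (by linarith [le_abs_self C]) (Real.exp_pos _).le)
  have h3 : Real.exp t * Real.exp (-((m + 1) * (t - 1)))
      = Real.exp (m + 1) * Real.exp (-(m * t)) := by
    rw [← Real.exp_add, ← Real.exp_add]; congr 1; ring
  calc _ ≤ (K * Real.exp t) * ((|C| + 1) * Real.exp (-((m + 1) * (t - 1)))) :=
        mul_le_mul h1 h2 (hg0 _ (by linarith)) (by positivity)
    _ = K * (|C| + 1) * (Real.exp t * Real.exp (-((m + 1) * (t - 1)))) := by ring
    _ = _ := by rw [h3]; ring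

lemma IsDefect.integrableOn (hg : IsDefect g) (hκ : 1 < κ) :
    IntegrableOn (fun t => t ^ (κ - 1) * g (t - 1)) (Ioi 2) := by
  obtain ⟨C, hC⟩ := hg.decay
  obtain ⟨K, hK, hb⟩ := exists_tail_integrand_le (g := g) hκ (m := 1) (C := C)
    (by simpa [one_add_one_eq_two] using hC) (fun t ht => hg.nonneg t (by linarith))
  have h1 : IntegrableOn (fun t : ℝ => K * Real.exp (-1 * t)) (Ioi 2) :=
    (integrableOn_exp_mul_Ioi (by norm_num) 2).const_mul K
  refine Integrable.mono' h1 ?_ ?_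
  · apply AEStronglyMeasurable.mul
    · apply ContinuousOn.aestronglyMeasurable _ measurableSet_Ioi
      intro t ht
      have : (0 : ℝ) < t := lt_trans two_pos ht
      exact (Real.continuousAt_rpow_const t _ (Or.inl this.ne')).continuousWithinAt
    · apply AEMeasurable.aestronglyMeasurable
      apply aemeasurable_restrict_of_antitoneOn measurableSet_Ioi
      intro x hx y hy hxy
      simp only [mem_Ioi] at hx hy
      exact hg.anti (by simp; linarith) (by simp; linarith) (by linarith)
  · refine (ae_restrict_iff' measurableSet_Ioi).2 (ae_of_all _ fun t ht => ?_)
    have ht2 : 2 < t := ht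
    have h0 := hg.nonneg (t - 1) (by linarith)
    have ht0 : 0 ≤ t := by linarith
    rw [Real.norm_of_nonneg (mul_nonneg (by positivity) h0)]
    have := hb t ht2.le
    simpa using this

lemma IsDefect.integrableOn_Ioi (hg : IsDefect g) (hκ : 1 < κ) {u : ℝ} (hu : 2 ≤ u) :
    IntegrableOn (fun t => t ^ (κ - 1) * g (t - 1)) (Ioi u) :=
  (hg.integrableOn hκ).mono_set (Ioi_subset_Ioi hu)

lemma IsDefect.intervalIntegrable (hg : IsDefect g) (hκ : 1 < κ) {u v : ℝ} (hu : 2 ≤ u)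
    (hv : 2 ≤ v) : IntervalIntegrable (fun t => t ^ (κ - 1) * g (t - 1)) volume u v := by
  rw [intervalIntegrable_iff]
  exact (hg.integrableOn hκ).mono_set fun t ht => lt_of_le_of_lt (le_min hu hv) ht.1

lemma IsDefect.integrand_nonneg (hg : IsDefect g) {t : ℝ} (ht : 1 < t) :
    0 ≤ t ^ (κ - 1) * g (t - 1) :=
  mul_nonneg (Real.rpow_nonneg (by linarith) _) (hg.nonneg _ (by linarith))

lemma IsDefect.tail_nonneg (hg : IsDefect g) (hκ : 1 < κ) {u : ℝ} (hu : 2 ≤ u) :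
    0 ≤ tail κ g u :=
  mul_nonneg (by linarith) (setIntegral_nonneg measurableSet_Ioi fun t ht =>
    hg.integrand_nonneg (by have : u < t := ht
                            linarith))

lemma tail_mono (hg : IsDefect g) (hg' : IsDefect g') (hκ : 1 < κ)
    (h : ∀ t, 0 < t → g t ≤ g' t) {u : ℝ} (hu : 2 ≤ u) : tail κ g u ≤ tail κ g' u := by
  apply mul_le_mul_of_nonneg_left _ (by linarith)
  apply setIntegral_mono_on (hg.integrableOn_Ioi hκ hu) (hg'.integrableOn_Ioi hκ hu)
    measurableSet_Ioi
  intro t ht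
  have ht' : u < t := ht
  exact mul_le_mul_of_nonneg_left (h _ (by linarith)) (Real.rpow_nonneg (by linarith) _)

lemma IsDefect.tail_eq (hg : IsDefect g) (hκ : 1 < κ) {u v : ℝ} (hu : 2 ≤ u) (hv : 2 ≤ v) :
    tail κ g v = tail κ g u - κ * ∫ t in u..v, t ^ (κ - 1) * g (t - 1) := by
  have h := intervalIntegral.integral_Ioi_sub_Ioi' (hg.integrableOn_Ioi hκ hu)
    (hg.integrableOn_Ioi hκ hv)
  rw [tail, tail, ← h]; ring

lemma IsDefect.tail_anti (hg : IsDefect g) (hκ : 1 < κ) {u v : ℝ} (hu : 2 ≤ u) (huv : u ≤ v) :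
    tail κ g v ≤ tail κ g u := by
  rw [hg.tail_eq hκ hu (hu.trans huv)]
  have : 0 ≤ ∫ t in u..v, t ^ (κ - 1) * g (t - 1) :=
    intervalIntegral.integral_nonneg huv fun t ht => hg.integrand_nonneg (by linarith [ht.1])
  nlinarith

lemma IsDefect.hasDerivAt_tail (hg : IsDefect g) (hκ : 1 < κ) {u : ℝ} (hu : 2 < u)
    (hc : ContinuousAt g (u - 1)) :
    HasDerivAt (tail κ g) (-(κ * u ^ (κ - 1) * g (u - 1))) u := by
  have h1 : HasDerivAt (fun v => ∫ t in (2 : ℝ)..v, t ^ (κ - 1) * g (t - 1))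
      (u ^ (κ - 1) * g (u - 1)) u := by
    apply intervalIntegral.integral_hasDerivAt_right
      (hg.intervalIntegrable hκ le_rfl hu.le)
    · exact ⟨Ioi 2, Ioi_mem_nhds hu, (hg.integrableOn hκ).aestronglyMeasurable⟩
    · apply ContinuousAt.mul
      · exact Real.continuousAt_rpow_const u _ (Or.inl (by linarith))
      · exact ContinuousAt.comp (f := fun t : ℝ => t - 1) (by simpa using hc) (by fun_prop)
  have h2 := (h1.const_mul κ).const_sub (tail κ g 2)
  refine (h2.congr_of_eventuallyEq ?_).congr_deriv (by ring)
  filter_upwards [Ioi_mem_nhds hu] with v hv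
  exact hg.tail_eq hκ le_rfl (le_of_lt hv)

lemma IsDefect.continuousOn_tail (hg : IsDefect g) (hκ : 1 < κ) :
    ContinuousOn (tail κ g) (Ici 2) := by
  intro u hu
  have hu2 : (2 : ℝ) ≤ u := hu
  have h1 : ContinuousOn (fun v => ∫ t in (2 : ℝ)..v, t ^ (κ - 1) * g (t - 1))
      (uIcc 2 (u + 1)) :=
    intervalIntegral.continuousOn_primitive_interval'
      (hg.intervalIntegrable hκ le_rfl (by linarith : 2 ≤ u + 1)) left_mem_uIcc
  rw [uIcc_of_le (by linarith)] at h1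
  have h2 : ContinuousOn (tail κ g) (Icc 2 (u + 1)) := by
    refine ((continuousOn_const (c := tail κ g 2)).sub
      ((continuousOn_const (c := κ)).mul h1)).congr fun v hv => ?_
    exact hg.tail_eq hκ le_rfl hv.1
  apply (h2 u ⟨hu2, by linarith⟩).mono_of_mem_nhdsWithin
  rw [← Ici_inter_Iic]
  exact inter_mem_nhdsWithin _ (Iic_mem_nhds (by linarith))

/-- Exponential decay of the tail integral. -/
lemma exists_tail_le (hg : IsDefect g) (hκ : 1 < κ) {m C : ℝ} (hm : 0 < m)
    (hb : ∀ t, 1 ≤ t → g t ≤ C * Real.exp (-((m + 1) * t))) :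
    ∃ K, 0 < K ∧ ∀ u, 2 ≤ u → tail κ g u ≤ K * Real.exp (-(m * u)) := by
  obtain ⟨K, hK, hle⟩ := exists_tail_integrand_le hκ hb (fun t ht => hg.nonneg t (by linarith))
  refine ⟨κ * (K / m), by positivity, fun u hu => ?_⟩
  rw [tail, mul_assoc]
  apply mul_le_mul_of_nonneg_left _ (by linarith)
  have hi : IntegrableOn (fun t : ℝ => K * Real.exp (-m * t)) (Ioi u) :=
    (integrableOn_exp_mul_Ioi (by linarith) u).const_mul K
  have h := setIntegral_mono_on (hg.integrableOn_Ioi hκ hu) hi measurableSet_Ioi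
    (fun t ht => by
      have ht' : u < t := ht
      have := hle t (by linarith)
      rwa [← neg_mul] at this)
  refine h.trans (le_of_eq ?_)
  rw [integral_const_mul, integral_exp_mul_Ioi (by linarith)]
  rw [neg_mul]
  field_simp

lemma IsDefect.tendsto_tail (hg : IsDefect g) (hκ : 1 < κ) :
    Tendsto (tail κ g) atTop (𝓝 0) := by
  obtain ⟨C, hC⟩ := hg.decay
  obtain ⟨K, hK, hb⟩ := exists_tail_le (m := 1) hg hκ one_pos
    (by simpa [one_add_one_eq_two] using hC)
  have h1 : Tendsto (fun u : ℝ => K * Real.exp (-(1 * u))) atTop (𝓝 0) := by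
    have := (Real.tendsto_exp_neg_atTop_nhds_zero).const_mul K
    simpa using this
  refine squeeze_zero' ?_ ?_ h1
  · filter_upwards [eventually_ge_atTop 2] with u hu using hg.tail_nonneg hκ hu
  · filter_upwards [eventually_ge_atTop 2] with u hu using hb u hu

end

section

variable {κ : ℝ} {g g' : ℝ → ℝ}

lemma one_le_inv_sig (hκ : 0 < κ) {u : ℝ} (hu : 0 < u) : 1 ≤ 1 / sig κ u :=
  (one_le_div (sig_pos hκ hu)).2 (sig_le_one hκ u)

lemma antitoneOn_inv_sig (hκ : 0 < κ) : AntitoneOn (fun u => 1 / sig κ u) (Ioi 0) :=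
  fun _ hx _ _ hxy => one_div_le_one_div_of_le (sig_pos hκ hx) (monotone_sig hκ hxy)

lemma continuousOn_inv_sig (hκ : 0 < κ) : ContinuousOn (fun u => 1 / sig κ u) (Ioi 0) :=
  continuousOn_const.div (continuous_sig hκ).continuousOn fun _ hx => (sig_pos hκ hx).ne'

lemma exists_inv_sig_sub_one_le (hκ : 0 < κ) :
    ∃ C, 0 < C ∧ ∀ u, 1 ≤ u → 1 / sig κ u - 1 ≤ C * Real.exp (-((2 + 1) * u)) := by
  obtain ⟨C, hC, h⟩ := exists_one_sub_sig_le hκ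
  have h1 := sig_pos hκ one_pos
  refine ⟨C / sig κ 1, by positivity, fun u hu => ?_⟩
  have h2 : sig κ 1 ≤ sig κ u := monotone_sig hκ hu
  have h3 : 0 < sig κ u := h1.trans_le h2
  have h4 := sig_le_one hκ u
  have h5 : 1 / sig κ u - 1 = (1 - sig κ u) / sig κ u := by field_simp
  rw [h5, div_mul_eq_mul_div]
  norm_num
  exact div_le_div₀ ((sub_nonneg.2 h4).trans (h u)) (h u) h1 h2

lemma isDefect_of_le_inv_sig (hκ : 0 < κ) {F : ℝ → ℝ} (hF : AntitoneOn F (Ioi 0))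
    (h1 : ∀ u, 0 < u → 1 ≤ F u) (h2 : ∀ u, 0 < u → F u ≤ 1 / sig κ u) :
    IsDefect (fun u => F u - 1) ∧
      ∃ C, ∀ u, 1 ≤ u → F u - 1 ≤ C * Real.exp (-((2 + 1) * u)) := by
  obtain ⟨C, hC, h⟩ := exists_inv_sig_sub_one_le hκ
  have h3 : ∀ u, 1 ≤ u → F u - 1 ≤ C * Real.exp (-((2 + 1) * u)) := fun u hu =>
    (sub_le_sub_right (h2 u (by linarith)) 1).trans (h u hu)
  refine ⟨⟨fun x hx y hy hxy => sub_le_sub_right (hF hx hy hxy) 1,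
    fun t ht => sub_nonneg.2 (h1 t ht), C, fun t ht => (h3 t ht).trans ?_⟩, C, h3⟩
  exact mul_le_mul_of_nonneg_left (Real.exp_le_exp.2 (by linarith)) hC.le

lemma isDefect_inv_sig (hκ : 0 < κ) : IsDefect (fun u => 1 / sig κ u - 1) :=
  (isDefect_of_le_inv_sig hκ (antitoneOn_inv_sig hκ) (fun _ hu => one_le_inv_sig hκ hu)
    fun _ _ => le_rfl).1

lemma IsDefect.rpow_neg_mul_tail_anti (hg : IsDefect g) (hκ : 1 < κ) {u v : ℝ} (hu : 2 ≤ u)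
    (huv : u ≤ v) : v ^ (-κ) * tail κ g v ≤ u ^ (-κ) * tail κ g u :=
  mul_le_mul (Real.rpow_le_rpow_of_nonpos (by linarith) huv (by linarith))
    (hg.tail_anti hκ hu huv) (hg.tail_nonneg hκ (hu.trans huv))
    (Real.rpow_nonneg (by linarith) _)

lemma IsDefect.rpow_neg_mul_tail_nonneg (hg : IsDefect g) (hκ : 1 < κ) {u : ℝ} (hu : 2 ≤ u) :
    0 ≤ u ^ (-κ) * tail κ g u :=
  mul_nonneg (Real.rpow_nonneg (by linarith) _) (hg.tail_nonneg hκ hu)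

/-- The region where the upper sieve function is kept equal to `1 / σ_κ`. -/
def IsCapped (κ : ℝ) (g : ℝ → ℝ) (u : ℝ) : Prop :=
  u < 2 ∨ ∃ v, u ≤ v ∧ 2 ≤ v ∧ v ^ κ * (1 / sig κ v - 1) ≤ tail κ g v

open Classical in
/-- The upper function obtained from the defect `g = 1 - f` of the lower function. -/
noncomputable def upper (κ : ℝ) (g : ℝ → ℝ) (u : ℝ) : ℝ :=
  if IsCapped κ g u then 1 / sig κ u else 1 + u ^ (-κ) * tail κ g u

/-- The lower function obtained from the upper function `F`. -/
noncomputable def lower (κ : ℝ) (F : ℝ → ℝ) (u : ℝ) : ℝ :=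
  if u < 2 then 0 else max 0 (1 - u ^ (-κ) * tail κ (fun t => F t - 1) u)

lemma IsCapped.anti {u v : ℝ} (h : IsCapped κ g v) (huv : u ≤ v) : IsCapped κ g u := by
  rcases h with h | ⟨w, h1, h2⟩
  · exact Or.inl (huv.trans_lt h)
  · exact Or.inr ⟨w, huv.trans h1, h2⟩

lemma two_le_of_not_isCapped {u : ℝ} (h : ¬ IsCapped κ g u) : 2 ≤ u :=
  not_lt.1 fun h' => h (Or.inl h')

lemma upper_lt_of_not_isCapped {u : ℝ} (h : ¬ IsCapped κ g u) :
    1 + u ^ (-κ) * tail κ g u < 1 / sig κ u := by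
  have hu := two_le_of_not_isCapped h
  have h1 : tail κ g u < u ^ κ * (1 / sig κ u - 1) :=
    not_le.1 fun h' => h (Or.inr ⟨u, le_rfl, hu, h'⟩)
  have h2 : 0 < u ^ (-κ) := Real.rpow_pos_of_pos (by linarith) _
  have h3 : u ^ (-κ) * u ^ κ = 1 := by rw [← Real.rpow_add (by linarith)]; simp
  have h4 := mul_lt_mul_of_pos_left h1 h2
  rw [← mul_assoc, h3] at h4
  linarith

lemma upper_le (u : ℝ) : upper κ g u ≤ 1 / sig κ u := by
  unfold upper
  split_ifs with h
  · exact le_rfl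
  · exact (upper_lt_of_not_isCapped h).le

lemma one_le_upper (hκ : 1 < κ) (hg : IsDefect g) {u : ℝ} (hu : 0 < u) : 1 ≤ upper κ g u := by
  unfold upper
  split_ifs with h
  · exact one_le_inv_sig (by linarith) hu
  · linarith [hg.rpow_neg_mul_tail_nonneg hκ (two_le_of_not_isCapped h)]

lemma antitoneOn_upper (hκ : 1 < κ) (hg : IsDefect g) : AntitoneOn (upper κ g) (Ioi 0) := by
  intro u hu v hv huv
  by_cases h1 : IsCapped κ g u
  · calc upper κ g v ≤ 1 / sig κ v := upper_le v
      _ ≤ 1 / sig κ u := antitoneOn_inv_sig (by linarith) hu hv huv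
      _ = upper κ g u := by simp [upper, h1]
  · have h2 : ¬ IsCapped κ g v := fun h => h1 (h.anti huv)
    simp only [upper, h1, h2, if_false]
    linarith [hg.rpow_neg_mul_tail_anti hκ (two_le_of_not_isCapped h1) huv]

lemma upper_mono (hκ : 1 < κ) (hg : IsDefect g) (hg' : IsDefect g')
    (h : ∀ t, 0 < t → g t ≤ g' t) (u : ℝ) : upper κ g u ≤ upper κ g' u := by
  by_cases h1 : IsCapped κ g' u
  · calc upper κ g u ≤ 1 / sig κ u := upper_le u
      _ = upper κ g' u := by simp [upper, h1]
  · have h2 : ¬ IsCapped κ g u := by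
      rintro (h2 | ⟨v, hv1, hv2, hv3⟩)
      · exact h1 (Or.inl h2)
      · exact h1 (Or.inr ⟨v, hv1, hv2, hv3.trans (tail_mono hg hg' hκ h hv2)⟩)
    simp only [upper, h1, h2, if_false]
    have hu := two_le_of_not_isCapped h1
    have := mul_le_mul_of_nonneg_left (tail_mono hg hg' hκ h hu)
      (Real.rpow_nonneg (by linarith : 0 ≤ u) (-κ))
    linarith

lemma isDefect_upper (hκ : 1 < κ) (hg : IsDefect g) :
    IsDefect (fun u => upper κ g u - 1) :=
  (isDefect_of_le_inv_sig (by linarith) (antitoneOn_upper hκ hg)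
    (fun _ hu => one_le_upper hκ hg hu) fun u _ => upper_le u).1

lemma lower_nonneg (F : ℝ → ℝ) (u : ℝ) : 0 ≤ lower κ F u := by
  unfold lower
  split_ifs
  · exact le_rfl
  · exact le_max_left _ _

variable {F F' : ℝ → ℝ}

lemma lower_le_one (hκ : 1 < κ) (hF : IsDefect (fun t => F t - 1)) (u : ℝ) :
    lower κ F u ≤ 1 := by
  unfold lower
  split_ifs with h
  · exact zero_le_one
  · exact max_le zero_le_one (by linarith [hF.rpow_neg_mul_tail_nonneg hκ (not_lt.1 h)])

lemma monotone_lower (hκ : 1 < κ) (hF : IsDefect (fun t => F t - 1)) : Monotone (lower κ F) := by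
  intro u v huv
  by_cases hu : u < 2
  · have : lower κ F u = 0 := by simp [lower, hu]
    rw [this]; exact lower_nonneg F v
  · have hv : ¬ v < 2 := fun h => hu (huv.trans_lt h)
    simp only [lower, hu, hv, if_false]
    exact max_le_max le_rfl
      (by linarith [hF.rpow_neg_mul_tail_anti hκ (not_lt.1 hu) huv])

lemma lower_anti (hκ : 1 < κ) (hF : IsDefect (fun t => F t - 1))
    (hF' : IsDefect (fun t => F' t - 1)) (h : ∀ t, 0 < t → F t ≤ F' t) (u : ℝ) :
    lower κ F' u ≤ lower κ F u := by
  by_cases hu : u < 2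
  · simp [lower, hu]
  · simp only [lower, hu, if_false]
    have hu' := not_lt.1 hu
    have := mul_le_mul_of_nonneg_left
      (tail_mono hF hF' hκ (fun t ht => sub_le_sub_right (h t ht) 1) hu')
      (Real.rpow_nonneg (by linarith : 0 ≤ u) (-κ))
    exact max_le_max le_rfl (by linarith)

lemma one_sub_lower_le {u : ℝ} (hu : 2 ≤ u) :
    1 - lower κ F u ≤ u ^ (-κ) * tail κ (fun t => F t - 1) u := by
  simp only [lower, not_lt.2 hu, if_false]
  linarith [le_max_right 0 (1 - u ^ (-κ) * tail κ (fun t => F t - 1) u)]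

lemma continuousOn_rpow_neg_mul_tail (hκ : 1 < κ) (hg : IsDefect g) :
    ContinuousOn (fun u => u ^ (-κ) * tail κ g u) (Ici 2) :=
  ContinuousOn.mul (fun u hu => (Real.continuousAt_rpow_const u _
    (Or.inl (by have : (2 : ℝ) ≤ u := hu
                linarith))).continuousWithinAt) (hg.continuousOn_tail hκ)

lemma continuousOn_lower (hκ : 1 < κ) (hF : IsDefect (fun t => F t - 1)) :
    ContinuousOn (lower κ F) (Ici 2) := by
  have h : ContinuousOn (fun u => max (0 : ℝ) (1 - u ^ (-κ) * tail κ (fun t => F t - 1) u))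
      (Ici 2) :=
    ContinuousOn.sup continuousOn_const
      (continuousOn_const.sub (continuousOn_rpow_neg_mul_tail hκ hF))
  refine h.congr fun u hu => ?_
  simp only [lower, not_lt.2 (mem_Ici.1 hu), if_false]

/-- `1 - lower` for the largest admissible upper function `1 / σ_κ`. -/
lemma isDefect_one_sub_lower_inv_sig (hκ : 1 < κ) :
    IsDefect (fun u => 1 - lower κ (fun t => 1 / sig κ t) u) := by
  have hκ0 : 0 < κ := by linarith
  have hS := isDefect_inv_sig hκ0
  obtain ⟨C, hC, hb⟩ := exists_inv_sig_sub_one_le hκ0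
  obtain ⟨K, hK, hK'⟩ := exists_tail_le (m := 2) hS hκ two_pos hb
  refine ⟨fun x _ y _ hxy => sub_le_sub_left (monotone_lower hκ hS hxy) 1,
    fun t _ => sub_nonneg.2 (lower_le_one hκ hS t), max K (Real.exp 4), fun t ht => ?_⟩
  rcases le_or_gt 2 t with h | h
  · calc _ ≤ t ^ (-κ) * tail κ (fun t => 1 / sig κ t - 1) t := one_sub_lower_le h
      _ ≤ 1 * tail κ (fun t => 1 / sig κ t - 1) t :=
        mul_le_mul_of_nonneg_right (Real.rpow_le_one_of_one_le_of_nonpos ht (by linarith))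
          (hS.tail_nonneg hκ h)
      _ ≤ K * Real.exp (-(2 * t)) := by rw [one_mul]; exact hK' t h
      _ ≤ _ := mul_le_mul_of_nonneg_right (le_max_left _ _) (Real.exp_pos _).le
  · calc _ ≤ (1 : ℝ) := by linarith [lower_nonneg (κ := κ) (fun t => 1 / sig κ t) t]
      _ ≤ Real.exp 4 * Real.exp (-(2 * t)) := by
        rw [← Real.exp_add]; exact Real.one_le_exp (by linarith)
      _ ≤ _ := mul_le_mul_of_nonneg_right (le_max_right _ _) (Real.exp_pos _).le

end

lemma le_of_antitoneOn_Ici_of_tendsto {g : ℝ → ℝ} {a L : ℝ} (hg : AntitoneOn g (Ici a))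
    (hL : Tendsto g atTop (𝓝 L)) {v : ℝ} (hv : a ≤ v) : L ≤ g v :=
  le_of_tendsto hL (by
    filter_upwards [eventually_ge_atTop v] with w hw using hg hv (hv.trans hw) hw)

section

variable {κ : ℝ}

lemma isDefect_one_sub_max (hκ : 1 < κ) {f : ℝ → ℝ} (hf : Monotone f) (hf1 : ∀ u, f u ≤ 1) :
    IsDefect (fun u => 1 - max (f u) (lower κ (fun t => 1 / sig κ t) u)) := by
  have h1 := isDefect_one_sub_lower_inv_sig hκ
  have h2 := monotone_lower hκ (isDefect_inv_sig (by linarith : 0 < κ))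
  have h3 := lower_le_one hκ (isDefect_inv_sig (by linarith : 0 < κ))
  obtain ⟨C, hC⟩ := h1.decay
  exact ⟨fun x _ y _ hxy => sub_le_sub_left (max_le_max (hf hxy) (h2 hxy)) 1,
    fun t _ => sub_nonneg.2 (max_le (hf1 t) (h3 t)), C, fun t ht =>
      (sub_le_sub_left (le_max_right _ _) 1).trans (hC t ht)⟩

/-- One step of the iteration producing the lower sieve function. -/
noncomputable def lowerStep (κ : ℝ) (f : ℝ → ℝ) : ℝ → ℝ :=
  lower κ (upper κ fun u => 1 - max (f u) (lower κ (fun t => 1 / sig κ t) u))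

/-- The fixed point: a pair of monotone functions solving the coupled tail equations. -/
lemma exists_fixedPoint (hκ : 1 < κ) : ∃ f : ℝ → ℝ, IsDefect (fun u => 1 - f u) ∧ Monotone f ∧
    (∀ u, f u ≤ 1) ∧ (∀ u, lower κ (fun t => 1 / sig κ t) u ≤ f u) ∧
    f = lower κ (upper κ fun u => 1 - f u) := by
  have hD : ∀ f : ℝ →o unitInterval, IsDefect
      (fun u => 1 - max (f u : ℝ) (lower κ (fun t => 1 / sig κ t) u)) := fun f =>
    isDefect_one_sub_max hκ (f := fun u => (f u : ℝ)) (fun x y h => f.monotone h) fun u => (f u).2.2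
  let Θ : (ℝ →o unitInterval) →o (ℝ →o unitInterval) :=
    { toFun := fun f =>
        { toFun := fun u => ⟨lowerStep κ (fun t => (f t : ℝ)) u, lower_nonneg _ _,
            lower_le_one hκ (isDefect_upper hκ (hD f)) u⟩
          monotone' := fun x y h => monotone_lower hκ (isDefect_upper hκ (hD f)) h }
      monotone' := fun f f' h u => by
        refine lower_anti hκ (isDefect_upper hκ (hD f')) (isDefect_upper hκ (hD f))
          (fun t _ => upper_mono hκ (hD f') (hD f) (fun t _ => ?_) t) u
        have h1 : (f t : ℝ) ≤ f' t := h t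
        exact sub_le_sub_left (max_le_max h1 le_rfl) (1 : ℝ) }
  set p := OrderHom.lfp (α := ℝ →o unitInterval) Θ
  have hp : Θ p = p := OrderHom.map_lfp (α := ℝ →o unitInterval) Θ
  set f : ℝ → ℝ := fun u => (p u : ℝ) with hf
  have hfp : f = lowerStep κ f := by
    funext u
    have := congrArg (fun q : ℝ →o unitInterval => (q u : ℝ)) hp
    exact this.symm
  have hle : ∀ u, lower κ (fun t => 1 / sig κ t) u ≤ f u := fun u => by
    rw [hfp]
    exact lower_anti hκ (isDefect_upper hκ (hD p)) (isDefect_inv_sig (by linarith))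
      (fun t _ => upper_le t) u
  have hmax : (fun u => 1 - max (f u) (lower κ (fun t => 1 / sig κ t) u)) = fun u => 1 - f u := by
    funext u; rw [max_eq_left (hle u)]
  refine ⟨f, ?_, fun x y h => p.monotone h, fun u => (p u).2.2, hle, ?_⟩
  · rw [← hmax]; exact hD p
  · conv_lhs => rw [hfp]
    rw [lowerStep, hmax]

lemma tendsto_rpow_mul_one_sub_sig (hκ : 1 < κ) {a : ℝ} (ha : a ≤ κ) (b : ℝ) :
    Tendsto (fun v => v ^ a * (1 - sig κ (v - b))) atTop (𝓝 0) := by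
  obtain ⟨C, hC, hb⟩ := exists_one_sub_sig_le (by linarith : 0 < κ)
  have h1 := (tendsto_rpow_mul_exp_neg_mul_atTop_nhds_zero κ 3 (by norm_num)).const_mul
    (C * Real.exp (3 * b))
  rw [mul_zero] at h1
  refine squeeze_zero' ?_ ?_ h1
  · filter_upwards [eventually_ge_atTop 0] with v hv
    exact mul_nonneg (Real.rpow_nonneg hv _)
      (by linarith [sig_le_one (by linarith : 0 < κ) (v - b)])
  · filter_upwards [eventually_ge_atTop 1] with v hv
    calc v ^ a * (1 - sig κ (v - b)) ≤ v ^ κ * (C * Real.exp (-(3 * (v - b)))) := by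
          apply mul_le_mul (Real.rpow_le_rpow_of_exponent_le hv ha) (hb _)
            (by linarith [sig_le_one (by linarith : 0 < κ) (v - b)]) (by positivity)
      _ = _ := by
        rw [show -(3 * (v - b)) = 3 * b + -3 * v by ring, Real.exp_add]; ring

/-- A bound of `1 - f` in terms of `1 - σ` for large argument. -/
lemma exists_tail_inv_sig_le (hκ : 1 < κ) : ∃ V, 4 ≤ V ∧ ∀ v, V ≤ v →
    tail κ (fun t => 1 / sig κ t - 1) v ≤ 8 * κ * (v ^ (κ - 1) * (1 - sig κ (v - 1))) := by
  have hκ0 : 0 < κ := by linarith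
  obtain ⟨V₀, hV₀⟩ := eventually_atTop.1
    ((tendsto_sig hκ0).eventually (lt_mem_nhds (by norm_num : (1 / 2 : ℝ) < 1)))
  set V := max (V₀ + 2) (8 * κ + 4) with hV
  have hVV : V₀ + 2 ≤ V := le_max_left _ _
  have hV8 : 8 * κ + 4 ≤ V := le_max_right _ _
  have hS := isDefect_inv_sig hκ0
  set T : ℝ → ℝ := fun v => 8 * κ * (v ^ (κ - 1) * (1 - sig κ (v - 1)))
    - tail κ (fun t => 1 / sig κ t - 1) v with hT
  refine ⟨V, by linarith, fun v hv => ?_⟩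
  have hd : ∀ u, V - 1 < u → HasDerivAt T
      (8 * κ * ((κ - 1) * u ^ (κ - 1 - 1) * (1 - sig κ (u - 1)) + u ^ (κ - 1) *
        (-(κ / (u - 1) * (sig κ (u - 1) - sig κ (u - 1 - 2)))))
        + κ * u ^ (κ - 1) * (1 / sig κ (u - 1) - 1)) u := by
    intro u hu
    have h1 := hasDerivAt_sig hκ0 (by linarith : 0 < u - 1)
    have h2 : HasDerivAt (fun v => sig κ (v - 1)) (κ / (u - 1) *
        (sig κ (u - 1) - sig κ (u - 1 - 2))) u := by
      simpa using HasDerivAt.comp_sub_const u 1 h1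
    have h3 := (((Real.hasDerivAt_rpow_const (p := κ - 1)
      (Or.inl (by linarith : u ≠ 0))).mul (h2.const_sub 1)).const_mul (8 * κ))
    refine (h3.sub (hS.hasDerivAt_tail hκ (by linarith) ?_)).congr_deriv (by ring)
    exact ((continuousOn_inv_sig hκ0).continuousAt (Ioi_mem_nhds (by linarith))).sub_const 1
  have hneg : ∀ u, V - 1 < u →
      8 * κ * ((κ - 1) * u ^ (κ - 1 - 1) * (1 - sig κ (u - 1)) + u ^ (κ - 1) *
        (-(κ / (u - 1) * (sig κ (u - 1) - sig κ (u - 1 - 2)))))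
        + κ * u ^ (κ - 1) * (1 / sig κ (u - 1) - 1) ≤ 0 := by
    intro u hu
    have hu0 : 0 < u - 1 := by linarith
    have h1 := one_sub_sig_le hκ0 hu0
    have h2 := hV₀ (u - 1) (by linarith)
    have h3 := sig_le_one hκ0 (u - 1)
    set s := sig κ (u - 1)
    set s' := sig κ (u - 1 - 2)
    have hP : 0 < u ^ (κ - 1) := Real.rpow_pos_of_pos (by linarith) _
    have hP2 : u ^ (κ - 1 - 1) = u ^ (κ - 1) / u := Real.rpow_sub_one (by linarith) _
    rw [hP2]
    set P := u ^ (κ - 1)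
    have h4 : 1 / s - 1 ≤ 2 * (1 - s) := by
      rw [div_sub_one (by linarith), div_le_iff₀ (by linarith)]; nlinarith
    have h5 : (1 - s) / 2 ≤ κ / (u - 1) * (1 - s') := by
      rw [div_mul_eq_mul_div, div_le_div_iff₀ two_pos hu0]; linarith
    have h6 : 8 * κ * (κ / (u - 1)) ≤ κ := by
      rw [← mul_div_assoc, div_le_iff₀ hu0]; nlinarith
    have h7 : (κ - 1) / u ≤ κ / (u - 1) := by
      rw [div_le_div_iff₀ (by linarith) hu0]; nlinarith
    have h8 : (κ - 1) * (P / u) * (1 - s) + P * (-(κ / (u - 1) * (s - s')))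
        ≤ P * ((1 - s) * (2 * (κ / (u - 1)) - 1 / 2)) := by
      have e1 : (κ - 1) * (P / u) * (1 - s) + P * (-(κ / (u - 1) * (s - s')))
        = P * ((κ - 1) / u * (1 - s) + κ / (u - 1) * (1 - s) - κ / (u - 1) * (1 - s')) := by ring
      rw [e1]
      apply mul_le_mul_of_nonneg_left _ hP.le
      have := mul_le_mul_of_nonneg_right h7 (sub_nonneg.2 h3)
      linarith
    have h9 : 8 * κ * (P * ((1 - s) * (2 * (κ / (u - 1)) - 1 / 2))) + κ * P * (2 * (1 - s))
        = P * (1 - s) * (2 * (8 * κ * (κ / (u - 1))) - 2 * κ) := by ring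
    have h10 := mul_le_mul_of_nonneg_left h8 (by positivity : 0 ≤ 8 * κ)
    have h11 := mul_le_mul_of_nonneg_left h4 (by positivity : 0 ≤ κ * P)
    have h12 : P * (1 - s) * (2 * (8 * κ * (κ / (u - 1))) - 2 * κ) ≤ 0 :=
      mul_nonpos_of_nonneg_of_nonpos (mul_nonneg hP.le (by linarith)) (by linarith)
    linarith
  have hanti := antitoneOn_Ici_of_hasDerivAt (a := V)
    (fun u hu => (hd u (lt_of_lt_of_le (by linarith) hu)).continuousAt.continuousWithinAt)
    (fun u hu => hd u (by linarith)) fun u hu => hneg u (by linarith)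
  have hlim : Tendsto T atTop (𝓝 0) := by
    have h := ((tendsto_rpow_mul_one_sub_sig hκ (by linarith : κ - 1 ≤ κ) 1).const_mul
      (8 * κ)).sub (hS.tendsto_tail hκ)
    rwa [mul_zero, sub_zero] at h
  have := le_of_antitoneOn_Ici_of_tendsto hanti hlim hv
  linarith

lemma eventually_not_isCapped (hκ : 1 < κ) : ∃ V, 4 ≤ V ∧ ∀ g, IsDefect g →
    (∀ u, g u ≤ 1 - lower κ (fun t => 1 / sig κ t) u) → ∀ v, V ≤ v →
    tail κ g v < v ^ κ * (1 / sig κ v - 1) := by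
  have hκ0 : 0 < κ := by linarith
  obtain ⟨V₁, hV₁4, hV₁⟩ := exists_tail_inv_sig_le hκ
  set V := max (V₁ + 1) (20 * κ + 4) with hV
  have hVV : V₁ + 1 ≤ V := le_max_left _ _
  have hV8 : 20 * κ + 4 ≤ V := le_max_right _ _
  have hG := isDefect_one_sub_lower_inv_sig hκ
  set G := fun u => 1 - lower κ (fun t => 1 / sig κ t) u with hGdef
  have hGc : ∀ u, 2 < u → ContinuousAt G u := by
    intro u hu
    exact continuousAt_const.sub (((continuousOn_lower hκ (isDefect_inv_sig hκ0)).mono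
      Ioi_subset_Ici_self).continuousAt (Ioi_mem_nhds hu))
  have hGle : ∀ u, V₁ ≤ u → G u ≤ 8 * κ / u * (1 - sig κ (u - 1)) := by
    intro u hu
    have hu0 : 0 < u := by linarith
    have h1 := mul_le_mul_of_nonneg_left (hV₁ u hu) (Real.rpow_nonneg hu0.le (-κ))
    have h2 : u ^ (-κ) * (8 * κ * (u ^ (κ - 1) * (1 - sig κ (u - 1))))
        = 8 * κ / u * (1 - sig κ (u - 1)) := by
      rw [show -κ = -1 - (κ - 1) by ring, Real.rpow_sub hu0, Real.rpow_neg_one]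
      have : 0 < u ^ (κ - 1) := Real.rpow_pos_of_pos hu0 _
      field_simp
    rw [h2] at h1
    exact (one_sub_lower_le (by linarith)).trans h1
  set T : ℝ → ℝ := fun v => v ^ κ * (1 - sig κ v) - tail κ G v with hT
  have hd : ∀ u, V - 1 < u → HasDerivAt T
      (κ * u ^ (κ - 1) * (1 - sig κ u) + u ^ κ * (-(κ / u * (sig κ u - sig κ (u - 2))))
        + κ * u ^ (κ - 1) * G (u - 1)) u := by
    intro u hu
    have h3 := (Real.hasDerivAt_rpow_const (p := κ)
      (Or.inl (by linarith : u ≠ 0))).mul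
        ((hasDerivAt_sig hκ0 (by linarith : 0 < u)).const_sub 1)
    exact (h3.sub (hG.hasDerivAt_tail hκ (by linarith) (hGc _ (by linarith)))).congr_deriv (by ring)
  have hneg : ∀ u, V < u →
      κ * u ^ (κ - 1) * (1 - sig κ u) + u ^ κ * (-(κ / u * (sig κ u - sig κ (u - 2))))
        + κ * u ^ (κ - 1) * G (u - 1) ≤ 0 := by
    intro u hu
    have hu0 : 0 < u := by linarith
    have h1 := one_sub_sig_le hκ0 hu0
    have h2 := hGle (u - 1) (by linarith)
    have h3 := sig_le_one hκ0 u
    have h4 := sig_le_one hκ0 (u - 2)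
    have hP : 0 < u ^ (κ - 1) := Real.rpow_pos_of_pos (by linarith) _
    have hP2 : u ^ (κ - 1) = u ^ κ / u := Real.rpow_sub_one (by linarith) _
    have h5 : u ^ κ * (-(κ / u * (sig κ u - sig κ (u - 2))))
      = κ * u ^ (κ - 1) * (sig κ (u - 2) - sig κ u) := by rw [hP2]; field_simp; ring
    have h6 : 8 * κ / (u - 1) ≤ 1 / 2 := by
      rw [div_le_div_iff₀ (by linarith) two_pos]; linarith
    have h7 : 1 - sig κ u ≤ 1 / 10 * (1 - sig κ (u - 2)) := by
      nlinarith [mul_nonneg (by linarith : 0 ≤ u - 20 * κ) (sub_nonneg.2 h3)]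
    rw [show u - 1 - 1 = u - 2 by ring] at h2
    have h8 := mul_le_mul_of_nonneg_right h6 (sub_nonneg.2 h4)
    rw [h5, ← mul_add, ← mul_add]
    exact mul_nonpos_of_nonneg_of_nonpos (by positivity) (by linarith)
  have hanti := antitoneOn_Ici_of_hasDerivAt (a := V)
    (fun u hu => (hd u (lt_of_lt_of_le (by linarith) hu)).continuousAt.continuousWithinAt)
    (fun u hu => hd u (by linarith)) hneg
  have hlim : Tendsto T atTop (𝓝 0) := by
    have h := (tendsto_rpow_mul_one_sub_sig hκ le_rfl 0).sub (hG.tendsto_tail hκ)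
    simpa only [sub_zero] using h
  refine ⟨V, by linarith, fun g hg hle v hv => ?_⟩
  have h1 := le_of_antitoneOn_Ici_of_tendsto hanti hlim hv
  have h2 := tail_mono hg hG hκ (fun t _ => hle t) (by linarith : 2 ≤ v)
  have h3 : sig κ v < 1 := lt_of_lt_of_le
    (strictMonoOn_sig hκ0 (by simp; linarith) (by simp; linarith) (lt_add_one v)) (sig_le_one hκ0 _)
  have h4 := sig_pos hκ0 (by linarith : 0 < v)
  have h5 : 1 - sig κ v < 1 / sig κ v - 1 := by
    rw [div_sub_one h4.ne', lt_div_iff₀ h4]; nlinarith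
  have h6 := mul_lt_mul_of_pos_left h5 (Real.rpow_pos_of_pos (by linarith : 0 < v) κ)
  simp only [hT] at h1
  linarith

/-- A pair of monotone functions solving the tail equations of the Diamond–Halberstam sieve. -/
structure SievePair (κ : ℝ) (F f : ℝ → ℝ) (α : ℝ) : Prop where
  antitone : AntitoneOn F (Ioi 0)
  monotone : Monotone f
  le_inv_sig : ∀ u, F u ≤ 1 / sig κ u
  defect_upper : IsDefect fun u => F u - 1
  defect_lower : IsDefect fun u => 1 - f u
  lower_eq : f = lower κ F
  two_le : 2 ≤ α
  eq_inv_sig : ∀ u, u < α → F u = 1 / sig κ u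
  eq_tail : ∀ u, α ≤ u → F u = 1 + u ^ (-κ) * tail κ (fun t => 1 - f t) u
  boundary : α = 2 ∨ F α = 1 / sig κ α

lemma exists_sievePair (hκ : 1 < κ) : ∃ F f α, SievePair κ F f α := by
  have hκ0 : 0 < κ := by linarith
  obtain ⟨f, hg, hm, hf1, hfle, hf⟩ := exists_fixedPoint hκ
  obtain ⟨V, hV4, hV⟩ := eventually_not_isCapped hκ
  set g := fun u => 1 - f u with hgdef
  have hVg := hV g hg fun u => sub_le_sub_left (hfle u) 1
  set F := upper κ g with hF
  set E := {v | 2 ≤ v ∧ v ^ κ * (1 / sig κ v - 1) ≤ tail κ g v} with hE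
  have hcap : ∀ u, IsCapped κ g u ↔ u < 2 ∨ ∃ v ∈ E, u ≤ v := fun u => by
    constructor
    · rintro (h | ⟨v, h1, h2, h3⟩)
      · exact Or.inl h
      · exact Or.inr ⟨v, ⟨h2, h3⟩, h1⟩
    · rintro (h | ⟨v, ⟨h2, h3⟩, h1⟩)
      · exact Or.inl h
      · exact Or.inr ⟨v, h1, h2, h3⟩
  have main : ∃ α, 2 ≤ α ∧ (∀ u, u < α → IsCapped κ g u) ∧ (∀ u, α < u → ¬ IsCapped κ g u) ∧
      ((α = 2 ∧ ¬ IsCapped κ g α) ∨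
        (IsCapped κ g α ∧ 1 / sig κ α = 1 + α ^ (-κ) * tail κ g α)) := by
    rcases E.eq_empty_or_nonempty with h0 | hne
    · have h1 : ∀ u, 2 ≤ u → ¬ IsCapped κ g u := fun u hu h => by
        rcases (hcap u).1 h with h | ⟨v, hv, _⟩
        · linarith
        · rw [h0] at hv; exact hv
      exact ⟨2, le_rfl, fun u hu => Or.inl hu, fun u hu => h1 u hu.le,
        Or.inl ⟨rfl, h1 2 le_rfl⟩⟩
    · have hbdd : BddAbove E := ⟨V, fun v hv => by
        by_contra hc
        exact absurd hv.2 (not_le.2 (hVg v (not_le.1 hc).le))⟩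
      have hsub : E ⊆ Ici 2 := fun v hv => hv.1
      have hc : ContinuousOn (fun v => v ^ κ * (1 / sig κ v - 1) - tail κ g v) (Ici 2) := by
        refine ContinuousOn.sub (ContinuousOn.mul ?_ ?_) (hg.continuousOn_tail hκ)
        · exact (Real.continuous_rpow_const hκ0.le).continuousOn
        · exact ((continuousOn_inv_sig hκ0).mono fun x hx =>
            mem_Ioi.2 (lt_of_lt_of_le two_pos (mem_Ici.1 hx))).sub
            continuousOn_const
      have hclosed : IsClosed E := by
        have h1 := hc.preimage_isClosed_of_isClosed isClosed_Ici isClosed_Iic (t := Iic 0)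
        convert h1 using 1
        ext v
        simp [hE]
      have hαE : sSup E ∈ E := hclosed.csSup_mem hne hbdd
      set α := sSup E
      have h2 : ∀ u, α < u → ¬ IsCapped κ g u := fun u hu h => by
        rcases (hcap u).1 h with h | ⟨v, hv, hv'⟩
        · linarith [hαE.1]
        · linarith [le_csSup hbdd hv]
      refine ⟨α, hαE.1, fun u hu => (hcap u).2 (Or.inr ⟨α, hαE, hu.le⟩), h2, Or.inr
        ⟨(hcap α).2 (Or.inr ⟨α, hαE, le_rfl⟩), ?_⟩⟩
      have h3 : 0 ≤ α ^ κ * (1 / sig κ α - 1) - tail κ g α := by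
        have hcα := (hc.mono (Ici_subset_Ici.2 hαE.1) α self_mem_Ici).mono
          (Ioi_subset_Ici_self (a := α))
        refine ge_of_tendsto hcα ?_
        filter_upwards [self_mem_nhdsWithin] with u hu
        have hu' : α < u := hu
        by_contra hcon
        exact h2 u hu ((hcap u).2 (Or.inr ⟨u, ⟨by linarith [hαE.1], by linarith⟩, le_rfl⟩))
      have h4 := hαE.2
      have hα : 0 < α := by linarith [hαE.1]
      have h5 : α ^ (-κ) * α ^ κ = 1 := by rw [← Real.rpow_add hα]; simp
      have h6 : tail κ g α = α ^ κ * (1 / sig κ α - 1) := by linarith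
      rw [h6, ← mul_assoc, h5]; ring
  obtain ⟨α, hα, h1, h2, h3⟩ := main
  refine ⟨F, f, α, antitoneOn_upper hκ hg, hm, fun u => upper_le u, isDefect_upper hκ hg, hg, hf,
    hα, fun u hu => by simp [hF, upper, h1 u hu], fun u hu => ?_, ?_⟩
  · change upper κ g u = 1 + u ^ (-κ) * tail κ g u
    rcases hu.eq_or_lt with rfl | hu
    · rcases h3 with h3 | h3
      · rw [upper, if_neg h3.2]
      · rw [← h3.2, upper, if_pos h3.1]
    · rw [upper, if_neg (h2 u hu)]
  · rcases h3 with h3 | h3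
    · exact Or.inl h3.1
    · right; simp [hF, upper, h3.1]

end

/-- A `SievePair` together with the point `β` where the lower function starts to be positive. -/
structure SieveData (κ : ℝ) (F f : ℝ → ℝ) (α β : ℝ) : Prop extends SievePair κ F f α where
  two_le_beta : 2 ≤ β
  eq_zero : ∀ u, u < β → f u = 0
  lower_eq_tail : ∀ u, β ≤ u → f u = 1 - u ^ (-κ) * tail κ (fun t => F t - 1) u
  boundary_lower : β = 2 ∨ f β = 0

section

variable {κ α β : ℝ} {F f : ℝ → ℝ}

lemma rpow_neg_mul_rpow {u : ℝ} (κ : ℝ) (hu : 0 < u) : u ^ (-κ) * u ^ κ = 1 := by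
  rw [← Real.rpow_add hu]; simp

lemma SievePair.exists_beta (hκ : 1 < κ) (h : SievePair κ F f α) : ∃ β, SieveData κ F f α β := by
  have hκ0 : 0 < κ := by linarith
  have hd := h.defect_upper
  set g := fun t => F t - 1 with hg
  set φ : ℝ → ℝ := fun u => u ^ κ - tail κ g u with hφ
  have hφc : ContinuousOn φ (Ici 2) :=
    (Real.continuous_rpow_const hκ0.le).continuousOn.sub (hd.continuousOn_tail hκ)
  have hφm : ∀ u v, 2 ≤ u → u < v → φ u < φ v := fun u v hu huv => by
    have h1 := hd.tail_anti hκ hu huv.le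
    have h2 := Real.rpow_lt_rpow (by linarith) huv hκ0
    simp only [hφ]; linarith
  have hφe : ∀ u, 2 ≤ u → 1 - u ^ (-κ) * tail κ g u = u ^ (-κ) * φ u := fun u hu => by
    have := rpow_neg_mul_rpow κ (by linarith : 0 < u)
    simp only [hφ]; linarith [mul_sub (u ^ (-κ)) (u ^ κ) (tail κ g u)]
  have hf : ∀ u, 2 ≤ u → f u = max 0 (1 - u ^ (-κ) * tail κ g u) := fun u hu => by
    conv_lhs => rw [h.lower_eq]
    simp only [lower, not_lt.2 hu, if_false, hg]
  have hf2 : ∀ u, u < 2 → f u = 0 := fun u hu => by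
    rw [h.lower_eq]; simp [lower, hu]
  have hpos : ∀ u, 2 ≤ u → 0 ≤ φ u → f u = 1 - u ^ (-κ) * tail κ g u := fun u hu h0 => by
    rw [hf u hu, max_eq_right]
    rw [hφe u hu]
    exact mul_nonneg (Real.rpow_nonneg (by linarith) _) h0
  have hneg : ∀ u, 2 ≤ u → φ u ≤ 0 → f u = 0 := fun u hu h0 => by
    rw [hf u hu, max_eq_left]
    rw [hφe u hu]
    exact mul_nonpos_of_nonneg_of_nonpos (Real.rpow_nonneg (by linarith) _) h0
  rcases le_or_gt (φ 2) 0 with h2 | h2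
  · have hlim : Tendsto φ atTop atTop := by
      have := (tendsto_rpow_atTop hκ0).atTop_add (hd.tendsto_tail hκ).neg
      simpa [hφ, sub_eq_add_neg] using this
    obtain ⟨v, hv2, hv0⟩ := ((eventually_ge_atTop 2).and (hlim.eventually_ge_atTop 0)).exists
    obtain ⟨β, hβ, hβ0⟩ := intermediate_value_Icc hv2 (hφc.mono fun x hx => hx.1)
      (show (0 : ℝ) ∈ Icc (φ 2) (φ v) from ⟨h2, hv0⟩)
    have hmono : ∀ u, 2 ≤ u → u < β → φ u < 0 := fun u hu h' => hβ0 ▸ hφm u β hu h'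
    refine ⟨β, h, hβ.1, fun u hu => ?_, fun u hu => hpos u (hβ.1.trans hu) ?_,
      Or.inr (hneg β hβ.1 hβ0.le)⟩
    · rcases lt_or_ge u 2 with h3 | h3
      · exact hf2 u h3
      · exact hneg u h3 (hmono u h3 hu).le
    · rcases hu.eq_or_lt with rfl | hu
      · exact hβ0.ge
      · rw [← hβ0]; exact (hφm β u hβ.1 hu).le
  · refine ⟨2, h, le_rfl, hf2, fun u hu => hpos u hu ?_, Or.inl rfl⟩
    rcases hu.eq_or_lt with rfl | hu
    · exact h2.le
    · exact (h2.trans (hφm 2 u le_rfl hu)).le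

/-- Two continuous pieces glue to a function continuous off the junction, and at the junction if
the values agree there. -/
lemma continuousAt_of_pieces {g p q : ℝ → ℝ} {a : ℝ} (ha : 0 < a)
    (hp : ContinuousOn p (Ioi 0)) (hq : ContinuousOn q (Ici a)) (h1 : ∀ u, u < a → g u = p u)
    (h2 : ∀ u, a ≤ u → g u = q u) {u : ℝ} (hu : 0 < u) (hua : u = a → g a = p a) :
    ContinuousAt g u := by
  rcases lt_trichotomy u a with h | h | h
  · refine (hp.continuousAt (Ioi_mem_nhds hu)).congr ?_
    filter_upwards [Iio_mem_nhds h] with v hv using (h1 v hv).symm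
  · subst h
    have h3 : ContinuousWithinAt g (Iic u) u := by
      refine ((hp.continuousAt (Ioi_mem_nhds hu)).continuousWithinAt (s := Iic u)).congr
        ?_ (hua rfl)
      intro v hv
      rcases (mem_Iic.1 hv).eq_or_lt with rfl | hv
      · exact hua rfl
      · exact h1 v hv
    have h4 : ContinuousWithinAt g (Ici u) u := (hq u self_mem_Ici).congr (fun v hv => h2 v hv)
      (h2 u le_rfl)
    have := h3.union h4
    rwa [Iic_union_Ici, continuousWithinAt_univ] at this
  · refine ((hq.mono Ioi_subset_Ici_self).continuousAt (Ioi_mem_nhds h)).congr ?_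
    filter_upwards [Ioi_mem_nhds h] with v hv using (h2 v (le_of_lt hv)).symm

namespace SieveData

lemma one_le (h : SieveData κ F f α β) {u : ℝ} (hu : 0 < u) : 1 ≤ F u := by
  linarith [h.defect_upper.nonneg u hu]

lemma le_one (h : SieveData κ F f α β) {u : ℝ} (hu : 0 < u) : f u ≤ 1 := by
  linarith [h.defect_lower.nonneg u hu]

lemma nonneg (h : SieveData κ F f α β) (u : ℝ) : 0 ≤ f u := by
  rw [h.lower_eq]; exact lower_nonneg F u

lemma rpow_mul_upper (h : SieveData κ F f α β) {u : ℝ} (hu : α ≤ u) :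
    u ^ κ * F u = u ^ κ + tail κ (fun t => 1 - f t) u := by
  have h2 := h.two_le
  rw [h.eq_tail u hu, mul_add, ← mul_assoc, mul_comm (u ^ κ) (u ^ (-κ)),
    rpow_neg_mul_rpow κ (by linarith), mul_one, one_mul]

lemma rpow_mul_lower (h : SieveData κ F f α β) {u : ℝ} (hu : β ≤ u) :
    u ^ κ * f u = u ^ κ - tail κ (fun t => F t - 1) u := by
  have h2 := h.two_le_beta
  rw [h.lower_eq_tail u hu, mul_sub, ← mul_assoc, mul_comm (u ^ κ) (u ^ (-κ)),
    rpow_neg_mul_rpow κ (by linarith), mul_one, one_mul]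

lemma continuousAt_upper (h : SieveData κ F f α β) (hκ : 1 < κ) {u : ℝ} (hu : 0 < u)
    (hu2 : u = α → F α = 1 / sig κ α) : ContinuousAt F u := by
  have h2 := h.two_le
  refine continuousAt_of_pieces (by linarith) (continuousOn_inv_sig (by linarith : 0 < κ))
    ((continuousOn_const.add (continuousOn_rpow_neg_mul_tail hκ h.defect_lower)).mono
      (Ici_subset_Ici.2 h2)) h.eq_inv_sig h.eq_tail hu hu2

lemma continuousAt_lower (h : SieveData κ F f α β) (hκ : 1 < κ) {u : ℝ} (hu : 0 < u)
    (hu2 : u = β → f β = 0) : ContinuousAt f u := by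
  have h2 := h.two_le_beta
  refine continuousAt_of_pieces (by linarith) (continuousOn_const (c := (0 : ℝ)))
    ((continuousOn_const.sub (continuousOn_rpow_neg_mul_tail hκ h.defect_upper)).mono
      (Ici_subset_Ici.2 h2)) h.eq_zero h.lower_eq_tail hu hu2

lemma hasDerivAt_upper (h : SieveData κ F f α β) (hκ : 1 < κ) {u : ℝ} (hu : α < u)
    (hc : ContinuousAt f (u - 1)) :
    HasDerivAt (fun v => v ^ κ * F v) (κ * u ^ (κ - 1) * f (u - 1)) u := by
  have h2 := h.two_le
  have h3 := (Real.hasDerivAt_rpow_const (p := κ) (Or.inl (by linarith : u ≠ 0))).add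
    (h.defect_lower.hasDerivAt_tail hκ (by linarith) (continuousAt_const.sub hc))
  refine (h3.congr_of_eventuallyEq ?_).congr_deriv (by ring)
  filter_upwards [Ioi_mem_nhds hu] with v hv using h.rpow_mul_upper (le_of_lt hv)

lemma hasDerivAt_lower (h : SieveData κ F f α β) (hκ : 1 < κ) {u : ℝ} (hu : β < u)
    (hc : ContinuousAt F (u - 1)) :
    HasDerivAt (fun v => v ^ κ * f v) (κ * u ^ (κ - 1) * F (u - 1)) u := by
  have h2 := h.two_le_beta
  have h3 := (Real.hasDerivAt_rpow_const (p := κ) (Or.inl (by linarith : u ≠ 0))).sub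
    (h.defect_upper.hasDerivAt_tail hκ (by linarith) (hc.sub continuousAt_const))
  refine (h3.congr_of_eventuallyEq ?_).congr_deriv (by ring)
  filter_upwards [Ioi_mem_nhds hu] with v hv using h.rpow_mul_lower (le_of_lt hv)

end SieveData

end

/-- Integrability on compact subintervals of `(0, ∞)`. -/
def PosIntegrable (g : ℝ → ℝ) : Prop :=
  ∀ p q, 0 < p → 0 < q → IntervalIntegrable g volume p q

section Window

variable {g h : ℝ → ℝ} {u : ℝ}

lemma posIntegrable_of_continuousOn (hg : ContinuousOn g (Ioi 0)) : PosIntegrable g :=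
  fun _ _ hp hq => (hg.mono fun _ hx => mem_Ioi.2 ((lt_min hp hq).trans_le hx.1)).intervalIntegrable

lemma posIntegrable_of_antitoneOn (hg : AntitoneOn g (Ioi 0)) : PosIntegrable g :=
  fun _ _ hp hq => (hg.mono fun _ hx => mem_Ioi.2 ((lt_min hp hq).trans_le hx.1)).intervalIntegrable

lemma PosIntegrable.mul_shift (hg : PosIntegrable g) (hh : ContinuousOn h (Ioi 0)) :
    PosIntegrable (fun x => g x * h (x + 1)) := fun p q hp hq =>
  (hg p q hp hq).mul_continuousOn (hh.comp (by fun_prop) fun x hx => by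
    have := (lt_min hp hq).trans_le hx.1
    exact mem_Ioi.2 (by linarith))

lemma PosIntegrable.hasDerivAt (hg : PosIntegrable g) (hu : 0 < u) (hc : ContinuousAt g u) :
    HasDerivAt (fun v => ∫ x in (1 : ℝ)..v, g x) (g u) u := by
  apply intervalIntegral.integral_hasDerivAt_right (hg 1 u one_pos hu) _ hc
  refine ⟨Ioc (u / 2) (2 * u), Ioc_mem_nhds (by linarith) (by linarith), ?_⟩
  exact (hg (u / 2) (2 * u) (by linarith) (by linarith)).1.aestronglyMeasurable

lemma PosIntegrable.window_eq (hg : PosIntegrable g) (hu : 1 < u) :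
    ∫ x in (u - 1)..u, g x = (∫ x in (1 : ℝ)..u, g x) - ∫ x in (1 : ℝ)..(u - 1), g x :=
  (intervalIntegral.integral_interval_sub_left (hg 1 u one_pos (by linarith))
    (hg 1 (u - 1) one_pos (by linarith))).symm

lemma PosIntegrable.hasDerivAt_window (hg : PosIntegrable g) (hu : 1 < u) (hc : ContinuousAt g u)
    (hc' : ContinuousAt g (u - 1)) :
    HasDerivAt (fun v => ∫ x in (v - 1)..v, g x) (g u - g (u - 1)) u := by
  have h1 := hg.hasDerivAt (by linarith) hc
  have h2 := HasDerivAt.comp_sub_const u 1 (hg.hasDerivAt (by linarith) hc')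
  refine (h1.sub h2).congr_of_eventuallyEq ?_
  filter_upwards [Ioi_mem_nhds hu] with v hv using hg.window_eq hv

lemma PosIntegrable.continuousOn_primitive (hg : PosIntegrable g) :
    ContinuousOn (fun v => ∫ x in (1 : ℝ)..v, g x) (Ioi 0) := by
  intro u hu
  have hu : 0 < u := hu
  have h1 := intervalIntegral.continuousOn_primitive_interval'
    (a := 1) (hg (min (u / 2) 1) (u + 1) (by positivity) (by linarith)) (by
      rw [uIcc_of_le (by linarith [min_le_left (u / 2) 1])]
      exact ⟨min_le_right _ _, by linarith⟩)
  rw [uIcc_of_le (by linarith [min_le_left (u / 2) 1])] at h1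
  exact (h1.continuousAt (Icc_mem_nhds (by linarith [min_le_left (u / 2) 1])
    (by linarith))).continuousWithinAt

lemma PosIntegrable.continuousOn_window (hg : PosIntegrable g) :
    ContinuousOn (fun v => ∫ x in (v - 1)..v, g x) (Ioi 1) := by
  have h1 := hg.continuousOn_primitive
  refine ((h1.mono (Ioi_subset_Ioi zero_le_one)).sub (h1.comp (f := fun v : ℝ => v - 1)
    (by fun_prop) fun x hx => ?_)).congr fun u hu => hg.window_eq hu
  exact mem_Ioi.2 (sub_pos.2 hx)

lemma antitoneOn_Ici_of_hasDerivAt_ne {g g' : ℝ → ℝ} {a c : ℝ} (hc : ContinuousOn g (Ici a))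
    (hd : ∀ x, a < x → x ≠ c → HasDerivAt g (g' x) x) (h : ∀ x, a < x → x ≠ c → g' x ≤ 0) :
    AntitoneOn g (Ici a) := by
  rcases le_or_gt c a with hca | hca
  · exact antitoneOn_Ici_of_hasDerivAt hc (fun x hx => hd x hx (by linarith [hx] : c < x).ne')
      fun x hx => h x hx (by linarith : c < x).ne'
  · have h1 := antitoneOn_Icc_of_hasDerivAt (a := a) (b := c) (hc.mono fun x hx => hx.1)
      (fun x hx hx' => hd x hx hx'.ne) fun x hx hx' => h x hx hx'.ne
    have h2 := antitoneOn_Ici_of_hasDerivAt (a := c) (hc.mono (Ici_subset_Ici.2 hca.le))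
      (fun x hx => hd x (hca.trans hx) hx.ne') fun x hx => h x (hca.trans hx) hx.ne'
    have := h1.union_right h2 (isGreatest_Icc hca.le) isLeast_Ici
    rwa [Icc_union_Ici_eq_Ici hca.le] at this

/-- The derivative of the bilinear form pairing a solution `Q` of a delay equation with a solution
`h` of the adjoint equation. -/
lemma PosIntegrable.hasDerivAt_pairing (hg : PosIntegrable g) (hh : ContinuousOn h (Ioi 0))
    (hu : 1 < u) {g' h' : ℝ} (hgd : HasDerivAt g g' u) (hc : ContinuousAt g (u - 1))
    (hhd : HasDerivAt (fun v => v * h v) h' u) (c : ℝ) :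
    HasDerivAt (fun v => g v * (v * h v) + c * ∫ x in (v - 1)..v, g x * h (x + 1))
      (g' * (u * h u) + g u * h' + c * (g u * h (u + 1) - g (u - 1) * h u)) u := by
  have hs : ∀ v, 0 < v → ContinuousAt (fun x => h (x + 1)) v := fun v hv =>
    ContinuousAt.comp (f := fun x : ℝ => x + 1)
      (hh.continuousAt (Ioi_mem_nhds (by linarith))) (by fun_prop)
  have h1 := (hg.mul_shift hh).hasDerivAt_window hu (hgd.continuousAt.mul (hs u (by linarith)))
    (hc.mul (hs (u - 1) (by linarith)))
  simp only [sub_add_cancel] at h1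
  exact (hgd.mul hhd).add (h1.const_mul c)

lemma PosIntegrable.continuousOn_pairing (hg : PosIntegrable g) (hh : ContinuousOn h (Ioi 0))
    {a : ℝ} (ha : 1 < a) (hc : ContinuousOn g (Ici a)) (c : ℝ) :
    ContinuousOn (fun v => g v * (v * h v) + c * ∫ x in (v - 1)..v, g x * h (x + 1)) (Ici a) := by
  have h1 : Ici a ⊆ Ioi 0 := fun x hx => mem_Ioi.2 (by linarith [mem_Ici.1 hx])
  have h2 : Ici a ⊆ Ioi 1 := fun x hx => mem_Ioi.2 (by linarith [mem_Ici.1 hx])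
  exact (hc.mul (continuousOn_id.mul (hh.mono h1))).add
    (continuousOn_const.mul ((hg.mul_shift hh).continuousOn_window.mono h2))

end Window

lemma hasDerivAt_of_rpow_mul {g : ℝ → ℝ} {κ d u : ℝ} (hu : 0 < u)
    (h : HasDerivAt (fun v => v ^ κ * g v) (κ * u ^ (κ - 1) * d) u) :
    HasDerivAt g (κ / u * (d - g u)) u := by
  have h1 := (Real.hasDerivAt_rpow_const (p := -κ) (Or.inl hu.ne')).mul h
  have h2 := rpow_neg_mul_rpow κ hu
  refine (h1.congr_of_eventuallyEq ?_).congr_deriv ?_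
  · filter_upwards [Ioi_mem_nhds hu] with v hv
    simp only [Pi.mul_apply]
    rw [← mul_assoc, rpow_neg_mul_rpow κ hv, one_mul]
  · rw [Real.rpow_sub_one hu.ne', Real.rpow_sub_one hu.ne']
    field_simp
    linear_combination κ * (d - g u) * h2

lemma IsDefect.exists_abs_le {g : ℝ → ℝ} (hg : IsDefect g) : ∃ C, 0 < C ∧ ∀ u, 1 ≤ u →
    |g u| ≤ C * Real.exp (-u) := by
  obtain ⟨C, hC⟩ := hg.decay
  refine ⟨|C| + 1, by positivity, fun u hu => ?_⟩
  rw [abs_of_nonneg (hg.nonneg u (by linarith))]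
  calc g u ≤ C * Real.exp (-(2 * u)) := hC u hu
    _ ≤ (|C| + 1) * Real.exp (-(2 * u)) :=
      mul_le_mul_of_nonneg_right (by linarith [le_abs_self C]) (Real.exp_pos _).le
    _ ≤ _ := mul_le_mul_of_nonneg_left (Real.exp_le_exp.2 (by linarith)) (by positivity)

lemma IsDefect.tendsto {g : ℝ → ℝ} (hg : IsDefect g) : Tendsto g atTop (𝓝 0) := by
  obtain ⟨C, hC, h⟩ := hg.exists_abs_le
  have h1 : Tendsto (fun u : ℝ => C * Real.exp (-u)) atTop (𝓝 0) := by
    simpa using Real.tendsto_exp_neg_atTop_nhds_zero.const_mul C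
  refine squeeze_zero_norm' ?_ h1
  filter_upwards [eventually_ge_atTop 1] with u hu using h u hu

namespace SieveData

variable {κ α β : ℝ} {F f : ℝ → ℝ}

lemma continuousAt_upper_of_ne (h : SieveData κ F f α β) (hκ : 1 < κ) {u : ℝ} (hu : 0 < u)
    (hu2 : u ≠ 2) : ContinuousAt F u :=
  h.continuousAt_upper hκ hu fun e => h.boundary.resolve_left (e ▸ hu2)

lemma continuousAt_lower_of_ne (h : SieveData κ F f α β) (hκ : 1 < κ) {u : ℝ} (hu : 0 < u)
    (hu2 : u ≠ 2) : ContinuousAt f u :=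
  h.continuousAt_lower hκ hu fun e => h.boundary_lower.resolve_left (e ▸ hu2)

lemma hasDerivAt_upper_of_ne (h : SieveData κ F f α β) (hκ : 1 < κ) {u : ℝ} (hu : α < u)
    (hu3 : u ≠ 3) : HasDerivAt F (κ / u * (f (u - 1) - F u)) u := by
  have h2 := h.two_le
  exact hasDerivAt_of_rpow_mul (by linarith) (h.hasDerivAt_upper hκ hu
    (h.continuousAt_lower_of_ne hκ (by linarith) fun e => hu3 (by linarith)))

lemma hasDerivAt_lower_of_ne (h : SieveData κ F f α β) (hκ : 1 < κ) {u : ℝ} (hu : β < u)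
    (hu3 : u ≠ 3) : HasDerivAt f (κ / u * (F (u - 1) - f u)) u := by
  have h2 := h.two_le_beta
  exact hasDerivAt_of_rpow_mul (by linarith) (h.hasDerivAt_lower hκ hu
    (h.continuousAt_upper_of_ne hκ (by linarith) fun e => hu3 (by linarith)))

lemma continuousOn_upper (h : SieveData κ F f α β) (hκ : 1 < κ) : ContinuousOn F (Ici α) :=
  ((continuousOn_const.add (continuousOn_rpow_neg_mul_tail hκ h.defect_lower)).mono
    (Ici_subset_Ici.2 h.two_le)).congr h.eq_tail

lemma continuousOn_lower (h : SieveData κ F f α β) (hκ : 1 < κ) : ContinuousOn f (Ici β) :=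
  ((continuousOn_const.sub (continuousOn_rpow_neg_mul_tail hκ h.defect_upper)).mono
    (Ici_subset_Ici.2 h.two_le_beta)).congr h.lower_eq_tail

lemma posIntegrable_upper (h : SieveData κ F f α β) : PosIntegrable F :=
  posIntegrable_of_antitoneOn h.antitone

lemma posIntegrable_lower (h : SieveData κ F f α β) : PosIntegrable f :=
  fun _ _ _ _ => h.monotone.intervalIntegrable

lemma tendsto_upper (h : SieveData κ F f α β) : Tendsto F atTop (𝓝 1) := by
  simpa using h.defect_upper.tendsto.add_const 1

lemma tendsto_lower (h : SieveData κ F f α β) : Tendsto f atTop (𝓝 1) := by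
  simpa using h.defect_lower.tendsto.const_sub 1

lemma posIntegrable_add (h : SieveData κ F f α β) : PosIntegrable (fun x => F x + f x) :=
  fun p q hp hq => (h.posIntegrable_upper p q hp hq).add (h.posIntegrable_lower p q hp hq)

lemma continuousOn_pairing_add (h : SieveData κ F f α β) (hκ : 1 < κ) {a : ℝ} (ha2 : 2 ≤ a)
    (ha : α ≤ a) (hb : β ≤ a) :
    ContinuousOn (fun v => (F v + f v) * (v * Lap (-κ) v)
      + κ * ∫ x in (v - 1)..v, (F x + f x) * Lap (-κ) (x + 1)) (Ici a) :=
  h.posIntegrable_add.continuousOn_pairing (continuousOn_Lap (-κ)) (by linarith : 1 < a)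
    (((h.continuousOn_upper hκ).mono (Ici_subset_Ici.2 ha)).add
      ((h.continuousOn_lower hκ).mono (Ici_subset_Ici.2 hb))) κ

/-- The pairing of `F + f` with the adjoint solution `Lap (-κ)` is conserved. -/
lemma hasDerivAt_pairing_add (h : SieveData κ F f α β) (hκ : 1 < κ) {u : ℝ} (ha : α < u)
    (hb : β < u) (hu3 : u ≠ 3) :
    HasDerivAt (fun v => (F v + f v) * (v * Lap (-κ) v)
      + κ * ∫ x in (v - 1)..v, (F x + f x) * Lap (-κ) (x + 1)) 0 u := by
  have h2 := h.two_le
  have hc := (h.continuousAt_upper_of_ne hκ (u := u - 1) (by linarith)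
      fun e => hu3 (by linarith)).add
    (h.continuousAt_lower_of_ne hκ (u := u - 1) (by linarith) fun e => hu3 (by linarith))
  have hd := (h.hasDerivAt_upper_of_ne hκ ha hu3).add (h.hasDerivAt_lower_of_ne hκ hb hu3)
  refine (h.posIntegrable_add.hasDerivAt_pairing (continuousOn_Lap (-κ)) (by linarith) hd hc
    (hasDerivAt_mul_Lap (-κ) (by linarith)) κ).congr_deriv ?_
  have : u ≠ 0 := by linarith
  field_simp
  ring

lemma two_le_pairing (h : SieveData κ F f α β) (hκ : 1 < κ) {a : ℝ} (ha2 : 2 ≤ a) (ha : α ≤ a)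
    (hb : β ≤ a) :
    2 ≤ (F a + f a) * (a * Lap (-κ) a)
      + κ * ∫ x in (a - 1)..a, (F x + f x) * Lap (-κ) (x + 1) := by
  have hanti := antitoneOn_Ici_of_hasDerivAt_ne (c := 3) (g' := fun _ => 0)
    (h.continuousOn_pairing_add hκ ha2 ha hb)
    (fun u hu hu3 => h.hasDerivAt_pairing_add hκ (by linarith) (by linarith) hu3)
    (fun _ _ _ => le_rfl)
  have hlim : Tendsto (fun v => (1 + f v) * (v * Lap (-κ) v)) atTop (𝓝 2) := by
    have := (h.tendsto_lower.const_add 1).mul (tendsto_mul_Lap (-κ))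
    norm_num at this
    exact this
  refine le_of_tendsto hlim ?_
  filter_upwards [eventually_ge_atTop a] with v hv
  refine le_trans ?_ (hanti self_mem_Ici (mem_Ici.2 hv) hv)
  have h1 : 0 ≤ ∫ x in (v - 1)..v, (F x + f x) * Lap (-κ) (x + 1) :=
    intervalIntegral.integral_nonneg (by linarith) fun x hx => by
      have hx0 : 0 < x := by linarith [hx.1]
      have := h.one_le hx0
      have := h.nonneg x
      exact mul_nonneg (by linarith) (Lap_pos _ (by linarith)).le
  have h2 := h.one_le (show 0 < v by linarith)
  have h3 : 0 ≤ v * Lap (-κ) v := mul_nonneg (by linarith) (Lap_pos _ (by linarith)).le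
  have h4 := mul_le_mul_of_nonneg_right (by linarith : 1 + f v ≤ F v + f v) h3
  have h5 := mul_nonneg (by linarith : 0 ≤ κ) h1
  linarith

/-- Pairing `F - f` with a supersolution of the adjoint equation. -/
lemma integral_upper_le (h : SieveData κ F f α β) (hκ : 1 < κ) (hab : α ≤ β) {H H' : ℝ → ℝ}
    {K : ℝ} (hH : ContinuousOn H (Ioi 0)) (hd : ∀ u, β < u → HasDerivAt H (H' u) u)
    (h0 : ∀ u, β ≤ u → 0 ≤ H u) (hK : ∀ u, β ≤ u → H u ≤ K * u ^ 3)
    (hL : ∀ u, β < u → 0 ≤ (κ - 1) * H u + κ * H (u + 1) - u * H' u) :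
    κ * ∫ x in (β - 1)..β, F x * H (x + 1) ≤ F β * (β * H β) := by
  have hb2 := h.two_le_beta
  have hg : PosIntegrable (fun x => F x - f x) :=
    fun p q hp hq => (h.posIntegrable_upper p q hp hq).sub (h.posIntegrable_lower p q hp hq)
  have hanti := antitoneOn_Ici_of_hasDerivAt_ne (c := 3)
    (g' := fun u => -((F u - f u) * ((κ - 1) * H u + κ * H (u + 1) - u * H' u)))
    (hg.continuousOn_pairing hH (by linarith : 1 < β)
      (((h.continuousOn_upper hκ).mono (Ici_subset_Ici.2 hab)).sub
        (h.continuousOn_lower hκ)) (-κ)) (fun u hu hu3 => by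
    have hc := (h.continuousAt_upper_of_ne hκ (u := u - 1) (by linarith)
        fun e => hu3 (by linarith)).sub
      (h.continuousAt_lower_of_ne hκ (u := u - 1) (by linarith) fun e => hu3 (by linarith))
    have hdd := (h.hasDerivAt_upper_of_ne hκ (by linarith) hu3).sub
      (h.hasDerivAt_lower_of_ne hκ (by linarith) hu3)
    refine (hg.hasDerivAt_pairing hH (by linarith) hdd hc
      ((hasDerivAt_id u).mul (hd u hu)) (-κ)).congr_deriv ?_
    have : u ≠ 0 := by linarith
    simp only [id]
    field_simp
    ring) (fun u hu _ => by
      have h1 := h.one_le (show 0 < u by linarith)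
      have h2 := h.le_one (show 0 < u by linarith)
      have := mul_nonneg (by linarith : 0 ≤ F u - f u) (hL u hu)
      linarith)
  obtain ⟨C, hC⟩ := h.defect_upper.decay
  obtain ⟨C', hC'⟩ := h.defect_lower.decay
  have hlim : Tendsto (fun v : ℝ => -κ * (((C + C') * (8 * K) * Real.exp 2)
      * (v ^ 3 * Real.exp (-v)))) atTop (𝓝 0) := by
    have := ((Real.tendsto_pow_mul_exp_neg_atTop_nhds_zero 3).const_mul
      ((C + C') * (8 * K) * Real.exp 2)).const_mul (-κ)
    simpa using this
  have hN : 0 ≤ (F β - f β) * (β * H β)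
      + -κ * ∫ x in (β - 1)..β, (F x - f x) * H (x + 1) := by
    refine le_of_tendsto hlim ?_
    filter_upwards [eventually_ge_atTop (β + 1)] with v hv
    refine le_trans ?_ (hanti self_mem_Ici (mem_Ici.2 (by linarith : β ≤ v)) (by linarith))
    have h1 : ∫ x in (v - 1)..v, (F x - f x) * H (x + 1)
        ≤ (C + C') * (8 * K) * Real.exp 2 * (v ^ 3 * Real.exp (-v)) := by
      have h2 : ∫ x in (v - 1)..v, (F x - f x) * H (x + 1)
          ≤ ∫ x in (v - 1)..v, (C + C') * (8 * K) * Real.exp 2 * (v ^ 3 * Real.exp (-v)) := by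
        refine intervalIntegral.integral_mono_on (by linarith)
          (hg.mul_shift hH _ _ (by linarith) (by linarith)) (by simp) fun x hx => ?_
        have hx1 := hx.1
        have hx0 : 0 < x := by linarith
        have e1 := hC x (by linarith)
        have e2 := hC' x (by linarith)
        have e3 := hK (x + 1) (by linarith)
        have e4 := h0 (x + 1) (by linarith)
        have e5 : (F x - f x) ≤ (C + C') * Real.exp (-(2 * x)) := by linarith
        have e6 := h.one_le hx0
        have e7 := h.le_one hx0
        have hK0 : 0 ≤ K := by
          have := e4.trans e3
          exact nonneg_of_mul_nonneg_left this (by positivity)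
        have hC0 : 0 ≤ C + C' := by
          have : 0 ≤ (C + C') * Real.exp (-(2 * x)) := by linarith
          exact nonneg_of_mul_nonneg_left this (Real.exp_pos _)
        have e8 : (x + 1) ^ 3 ≤ (2 * v) ^ 3 := by
          gcongr; linarith [hx.2]
        have e9 : Real.exp (-(2 * x)) ≤ Real.exp 2 * Real.exp (-v) := by
          rw [← Real.exp_add]; apply Real.exp_le_exp.2; linarith
        calc (F x - f x) * H (x + 1)
            ≤ ((C + C') * (Real.exp 2 * Real.exp (-v))) * (K * (2 * v) ^ 3) := by
              apply mul_le_mul (e5.trans (by gcongr)) (e3.trans (by gcongr)) e4 (by positivity)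
          _ = _ := by ring
      refine h2.trans_eq ?_
      rw [intervalIntegral.integral_const]
      simp
    have h3 : 0 ≤ (F v - f v) * (v * H v) := by
      have h4 := h.one_le (show 0 < v by linarith)
      have h5 := h.le_one (show 0 < v by linarith)
      exact mul_nonneg (by linarith) (mul_nonneg (by linarith) (h0 v (by linarith)))
    have := mul_le_mul_of_nonneg_left h1 (by linarith : 0 ≤ κ)
    linarith
  have hI : ∫ x in (β - 1)..β, (F x - f x) * H (x + 1) = ∫ x in (β - 1)..β, F x * H (x + 1) := by
    apply intervalIntegral.integral_congr_ae
    have : ∀ᵐ x : ℝ, x ≠ β := by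
      simp [ae_iff]
    filter_upwards [this] with x hx hx'
    rw [uIoc_of_le (by linarith)] at hx'
    rw [h.eq_zero x (lt_of_le_of_ne hx'.2 hx), sub_zero]
  rw [hI] at hN
  have h4 := mul_le_mul_of_nonneg_right (by linarith [h.nonneg β] : F β - f β ≤ F β)
    (mul_nonneg (by linarith) (h0 β le_rfl) : 0 ≤ β * H β)
  linarith

end SieveData

section Sigma

variable {κ : ℝ}

lemma antitoneOn_rpow_neg_mul_sig (hκ : 0 < κ) :
    AntitoneOn (fun v => v ^ (-κ) * sig κ v) (Ioi 0) := by
  intro x hx y hy hxy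
  have hx : 0 < x := hx
  refine antitoneOn_Icc_of_hasDerivAt (a := x) (b := y) (fun u hu =>
    (hasDerivAt_rpow_neg_mul_sig hκ (hx.trans_le hu.1)).continuousAt.continuousWithinAt)
    (fun u hu _ => hasDerivAt_rpow_neg_mul_sig hκ (hx.trans hu)) (fun u hu _ => ?_)
    (left_mem_Icc.2 hxy) (right_mem_Icc.2 hxy) hxy
  have h1 := Real.rpow_nonneg (hx.trans hu).le (-κ - 1)
  have h2 := sig_nonneg hκ (u - 2)
  have := mul_nonneg (mul_nonneg hκ.le h1) h2
  linarith

lemma dhConst_mul_sig_le (hκ : 0 < κ) {u : ℝ} (hu : 0 < u) : dhConst κ * sig κ u ≤ u ^ κ := by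
  have hA := dhConst_pos hκ
  have h2 : u ^ (-κ) * sig κ u ≤ 1 / dhConst κ := by
    rcases le_total u 2 with h | h
    · rw [sig_of_le_two hκ hu.le h, ← mul_div_assoc, rpow_neg_mul_rpow κ hu]
    · refine (antitoneOn_rpow_neg_mul_sig hκ (mem_Ioi.2 two_pos) (mem_Ioi.2 hu) h).trans_eq ?_
      simp only
      rw [sig_of_le_two hκ two_pos.le le_rfl, ← mul_div_assoc, rpow_neg_mul_rpow κ two_pos]
  have h3 := rpow_neg_mul_rpow κ hu
  rw [le_div_iff₀ hA] at h2
  calc dhConst κ * sig κ u = (u ^ (-κ) * sig κ u * dhConst κ) * u ^ κ := by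
        linear_combination (-(dhConst κ * sig κ u)) * h3
    _ ≤ 1 * u ^ κ := mul_le_mul_of_nonneg_right h2 (Real.rpow_nonneg hu.le _)
    _ = _ := one_mul _

/-- Lower bound for `σ_κ` obtained by one step of the defining delay equation. -/
lemma one_sub_le_dhConst_mul_sig (hκ : 0 < κ) {G G' : ℝ → ℝ} (hG0 : G 0 = 0)
    (hd : ∀ z, 0 ≤ z → z < 1 → HasDerivAt G (G' z) z)
    (hb : ∀ z, 0 < z → z < 1 → z ^ κ ≤ (1 - z) * G' z) {w : ℝ} (hw : 2 ≤ w) :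
    1 - κ * G (1 - 2 / w) ≤ dhConst κ * (w ^ (-κ) * sig κ w) := by
  have hA := dhConst_pos hκ
  have hdv : ∀ u, 2 ≤ u → HasDerivAt
      (fun u => dhConst κ * (u ^ (-κ) * sig κ u) + κ * G (1 - 2 / u))
      (dhConst κ * (-(κ * u ^ (-κ - 1) * sig κ (u - 2)))
          + κ * (G' (1 - 2 / u) * (2 / u ^ 2))) u := by
    intro u hu
    have h1 : HasDerivAt (fun u : ℝ => 1 - 2 / u) (2 / u ^ 2) u := by
      have := ((hasDerivAt_inv (by linarith : u ≠ 0)).const_mul 2).const_sub 1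
      refine (this.congr_of_eventuallyEq (.of_forall fun v => ?_)).congr_deriv ?_
      · rw [div_eq_mul_inv]
      · ring
    have hu' : 2 / u ≤ 1 := (div_le_one (by linarith)).2 hu
    have hu'' : 0 < 2 / u := by positivity
    have h2 := HasDerivAt.comp u (hd (1 - 2 / u) (by linarith) (by linarith)) h1
    exact ((hasDerivAt_rpow_neg_mul_sig hκ (by linarith)).const_mul _).add (h2.const_mul κ)
  have hm := monotoneOn_Icc_of_hasDerivAt (a := 2) (b := w)
    (fun u hu => (hdv u hu.1).continuousAt.continuousWithinAt) (fun u hu _ => hdv u hu.le)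
    (fun u hu _ => by
      have hu0 : 0 < u := by linarith
      have hu' : 2 / u < 1 := (div_lt_one hu0).2 hu
      have h1 := hb (1 - 2 / u) (by linarith) (by linarith [show 0 < 2 / u by positivity])
      have h2 := dhConst_mul_sig_le hκ (show 0 < u - 2 by linarith)
      have h3 : (u - 2) ^ κ = (1 - 2 / u) ^ κ * u ^ κ := by
        rw [← Real.mul_rpow (by linarith) hu0.le]; congr 1; field_simp
      have h4 : u ^ (-κ - 1) * u ^ κ = u⁻¹ := by
        rw [← Real.rpow_add hu0, ← Real.rpow_neg_one]; congr 1; ring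
      have h5 : dhConst κ * (u ^ (-κ - 1) * sig κ (u - 2)) ≤ G' (1 - 2 / u) * (2 / u ^ 2) := by
        calc _ = u ^ (-κ - 1) * (dhConst κ * sig κ (u - 2)) := by ring
          _ ≤ u ^ (-κ - 1) * ((1 - 2 / u) ^ κ * u ^ κ) :=
            mul_le_mul_of_nonneg_left (h2.trans_eq h3) (Real.rpow_nonneg hu0.le _)
          _ = u⁻¹ * (1 - 2 / u) ^ κ := by rw [← h4]; ring
          _ ≤ u⁻¹ * ((1 - (1 - 2 / u)) * G' (1 - 2 / u)) :=
            mul_le_mul_of_nonneg_left h1 (by positivity)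
          _ = _ := by field_simp; ring
      have := mul_le_mul_of_nonneg_left h5 hκ.le
      linarith)
    (left_mem_Icc.2 hw) (right_mem_Icc.2 hw) hw
  simp only at hm
  rw [sig_of_le_two hκ two_pos.le le_rfl] at hm
  have h2 : dhConst κ * ((2 : ℝ) ^ (-κ) * (2 ^ κ / dhConst κ)) = 1 := by
    rw [← mul_div_assoc, rpow_neg_mul_rpow κ two_pos]; field_simp
  rw [h2, show (1 : ℝ) - 2 / 2 = 0 by norm_num, hG0] at hm
  linarith

lemma hasDerivAt_rpow_mul_of_mul {g : ℝ → ℝ} {g' κ u : ℝ} (hu : 0 < u)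
    (h : HasDerivAt (fun v => v * g v) g' u) :
    HasDerivAt (fun v => v ^ (1 - κ) * g v) (u ^ (-κ) * (g' - κ * g u)) u := by
  refine (((Real.hasDerivAt_rpow_const (p := -κ) (Or.inl hu.ne')).mul h).congr_of_eventuallyEq
    ?_).congr_deriv ?_
  · filter_upwards [Ioi_mem_nhds hu] with v hv
    have hv : 0 < v := hv
    simp only [Pi.mul_apply]
    rw [show 1 - κ = -κ + 1 by ring, Real.rpow_add_one hv.ne']
    ring
  · rw [Real.rpow_sub_one hu.ne']
    field_simp
    ring

lemma hasDerivAt_rpow_mul_Lap {u : ℝ} (κ : ℝ) (hu : 0 < u) :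
    HasDerivAt (fun v => v ^ (1 - κ) * Lap (-κ) v) (-(κ * (u ^ (-κ) * Lap (-κ) (u + 1)))) u :=
  (hasDerivAt_rpow_mul_of_mul hu (hasDerivAt_mul_Lap (-κ) hu)).congr_deriv (by ring)

lemma posIntegrable_rpow_mul_Lap (κ : ℝ) :
    PosIntegrable (fun x : ℝ => x ^ (-κ) * Lap (-κ) (x + 1)) :=
  (posIntegrable_of_continuousOn (g := fun x : ℝ => x ^ (-κ))
    (fun x hx => (Real.continuousAt_rpow_const x _ (Or.inl
      (ne_of_gt hx))).continuousWithinAt)).mul_shift (continuousOn_Lap _)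

lemma integral_rpow_mul_Lap (κ : ℝ) {w : ℝ} (hw : 1 < w) :
    κ * ∫ x in (w - 1)..w, x ^ (-κ) * Lap (-κ) (x + 1)
      = (w - 1) ^ (1 - κ) * Lap (-κ) (w - 1) - w ^ (1 - κ) * Lap (-κ) w := by
  have := intervalIntegral.integral_eq_sub_of_hasDerivAt
    (a := w - 1) (b := w) (fun x hx => hasDerivAt_rpow_mul_Lap κ (u := x) (by
      rw [uIcc_of_le (by linarith)] at hx
      linarith [hx.1])) (((posIntegrable_rpow_mul_Lap κ _ _ (by linarith)
        (by linarith)).const_mul κ).neg)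
  rw [intervalIntegral.integral_neg, intervalIntegral.integral_const_mul] at this
  linarith

lemma posIntegrable_inv_sig (hκ : 0 < κ) : PosIntegrable (fun x => 1 / sig κ x) :=
  posIntegrable_of_continuousOn (continuousOn_inv_sig hκ)

/-- The pairing of `2 / σ_κ` with the adjoint solution is antitone past `2`. -/
lemma antitoneOn_inv_sig_pairing (hκ : 0 < κ) :
    AntitoneOn (fun v => 1 / sig κ v * (v * Lap (-κ) v)
      + κ * ∫ x in (v - 1)..v, 1 / sig κ x * Lap (-κ) (x + 1)) (Ici 2) := by
  have hg := posIntegrable_inv_sig hκ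
  have hh := continuousOn_Lap (-κ)
  refine antitoneOn_Ici_of_hasDerivAt (hg.continuousOn_pairing hh (by norm_num : (1 : ℝ) < 2)
    ((continuousOn_inv_sig hκ).mono fun x hx => mem_Ioi.2 (by linarith [mem_Ici.1 hx])) κ)
    (fun u hu => ?_) (g' := fun u => κ * Lap (-κ) u * (sig κ (u - 2) / sig κ u ^ 2
      - 1 / sig κ (u - 1))) fun u hu => ?_
  · have hs := sig_pos hκ (show 0 < u by linarith)
    have hd : HasDerivAt (fun v => 1 / sig κ v)
        (-(κ / u * (sig κ u - sig κ (u - 2))) / sig κ u ^ 2) u := by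
      simpa using (hasDerivAt_sig hκ (show 0 < u by linarith)).fun_inv hs.ne'
    have hc := (continuousOn_inv_sig hκ).continuousAt (Ioi_mem_nhds (show 0 < u - 1 by linarith))
    refine (hg.hasDerivAt_pairing hh (by linarith) hd hc
      (hasDerivAt_mul_Lap (-κ) (by linarith)) κ).congr_deriv ?_
    have hu0 : u ≠ 0 := by linarith
    have hs' := sig_pos hκ (show 0 < u - 1 by linarith)
    field_simp
    ring
  · have hs := sig_pos hκ (show 0 < u by linarith)
    have hs' := sig_pos hκ (show 0 < u - 1 by linarith)
    have h1 := monotone_sig hκ (show u - 2 ≤ u by linarith)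
    have h2 := monotone_sig hκ (show u - 1 ≤ u by linarith)
    have h3 : sig κ (u - 2) / sig κ u ^ 2 ≤ 1 / sig κ (u - 1) := by
      rw [div_le_div_iff₀ (by positivity) hs', one_mul, pow_two]
      exact mul_le_mul h1 h2 hs'.le hs.le
    exact mul_nonpos_of_nonneg_of_nonpos (mul_nonneg hκ.le (Lap_pos _ (by linarith)).le)
      (by linarith)

end Sigma

namespace SieveData

variable {κ α β w : ℝ} {F f : ℝ → ℝ}

lemma two_le_inv_sig_pairing (h : SieveData κ F f α β) (hκ : 1 < κ) (hab : α ≤ β) (hw : 2 ≤ w)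
    (hwb : w < β) :
    2 ≤ 1 / sig κ w * (w * Lap (-κ) w)
      + κ * ∫ x in (w - 1)..w, 1 / sig κ x * Lap (-κ) (x + 1) := by
  have hκ0 : 0 < κ := by linarith
  have hfb : f β = 0 := h.boundary_lower.resolve_left (by linarith)
  refine le_trans ?_ (antitoneOn_inv_sig_pairing hκ0 (mem_Ici.2 hw)
    (mem_Ici.2 (hw.trans hwb.le)) hwb.le)
  refine (h.two_le_pairing hκ h.two_le_beta hab le_rfl).trans (add_le_add ?_ ?_)
  · rw [hfb, add_zero]
    exact mul_le_mul_of_nonneg_right (h.le_inv_sig β)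
      (mul_nonneg (by linarith) (Lap_pos _ (by linarith)).le)
  · refine mul_le_mul_of_nonneg_left (intervalIntegral.integral_mono_on (by linarith) ?_
      ((posIntegrable_inv_sig hκ0).mul_shift (continuousOn_Lap _) _ _ (by linarith)
        (by linarith)) fun x hx => ?_) hκ0.le
    · have hg : PosIntegrable (fun x => F x + f x) :=
        fun p q hp hq => (h.posIntegrable_upper p q hp hq).add (h.posIntegrable_lower p q hp hq)
      exact hg.mul_shift (continuousOn_Lap _) _ _ (by linarith) (by linarith)
    · have hf : f x = 0 := by
        rcases hx.2.eq_or_lt with e | e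
        · rw [e, hfb]
        · exact h.eq_zero x e
      rw [hf, add_zero]
      exact mul_le_mul_of_nonneg_right (h.le_inv_sig x) (Lap_pos _ (by linarith [hx.1])).le

lemma beta_le_of_half_le_sig (h : SieveData κ F f α β) (hκ : 1 < κ) (hab : α ≤ β) (hw : 2 ≤ w)
    (hs : 1 / 2 ≤ sig κ (w - 1)) : β ≤ w := by
  by_contra! hwb
  have hκ0 : 0 < κ := by linarith
  have h1 := h.two_le_inv_sig_pairing hκ hab hw hwb
  have h2 : ∫ x in (w - 1)..w, 1 / sig κ x * Lap (-κ) (x + 1)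
      ≤ ∫ x in (w - 1)..w, 2 * Lap (-κ) (x + 1) := by
    refine intervalIntegral.integral_mono_on (by linarith)
      ((posIntegrable_inv_sig hκ0).mul_shift (continuousOn_Lap _) _ _ (by linarith)
        (by linarith)) ((posIntegrable_of_continuousOn (g := fun _ => (2 : ℝ))
        continuousOn_const).mul_shift (continuousOn_Lap _) _ _ (by linarith)
        (by linarith)) fun x hx => ?_
    have h3 := monotone_sig hκ0 hx.1
    refine mul_le_mul_of_nonneg_right ?_ (Lap_pos _ (by linarith [hx.1])).le
    rw [div_le_iff₀ (by linarith)]; linarith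
  rw [intervalIntegral.integral_const_mul, intervalIntegral.integral_comp_add_right
    (fun x => Lap (-κ) x), sub_add_cancel] at h2
  have h4 := mul_Lap_sub_integral (-κ) (show 0 < w by linarith)
  have h5 : 1 / sig κ w < 2 := by
    have := strictMonoOn_sig hκ0 (mem_Ici.2 (by linarith : 0 ≤ w - 1))
      (mem_Ici.2 (by linarith : 0 ≤ w)) (by linarith)
    rw [div_lt_iff₀ (by linarith)]; linarith
  have h6 := mul_lt_mul_of_pos_right h5 (mul_pos (by linarith : 0 < w)
    (Lap_pos (-κ) (by linarith : 0 < w)))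
  have h7 := mul_le_mul_of_nonneg_left h2 hκ0.le
  linarith

lemma beta_le_of_Lap_lt (h : SieveData κ F f α β) (hκ : 1 < κ) (hab : α ≤ β) (hw : 2 ≤ w) {R : ℝ}
    (hR : 1 ≤ R * (dhConst κ * (w ^ (-κ) * sig κ w)))
    (hL : dhConst κ * R * ((w - 1) ^ (1 - κ) * Lap (-κ) (w - 1)) < 2) : β ≤ w := by
  by_contra! hwb
  have hκ0 : 0 < κ := by linarith
  have hA := dhConst_pos hκ0
  have h1 := h.two_le_inv_sig_pairing hκ hab hw hwb
  have hsw := sig_pos hκ0 (show 0 < w by linarith)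
  have key : ∀ x, 0 < x → x ≤ w → 1 / sig κ x ≤ dhConst κ * R * x ^ (-κ) := fun x hx hxw => by
    have hs := sig_pos hκ0 hx
    have h3 := antitoneOn_rpow_neg_mul_sig hκ0 (mem_Ioi.2 hx)
      (mem_Ioi.2 (by linarith : 0 < w)) hxw
    simp only at h3
    have hR0 : 0 ≤ R := by
      have h4 : 0 < dhConst κ * (w ^ (-κ) * sig κ w) :=
        mul_pos hA (mul_pos (Real.rpow_pos_of_pos (by linarith) _) hsw)
      by_contra! h5
      linarith [mul_neg_of_neg_of_pos h5 h4]
    rw [div_le_iff₀ hs]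
    calc 1 ≤ R * (dhConst κ * (w ^ (-κ) * sig κ w)) := hR
      _ ≤ R * (dhConst κ * (x ^ (-κ) * sig κ x)) := by gcongr
      _ = _ := by ring
  have h2 : ∫ x in (w - 1)..w, 1 / sig κ x * Lap (-κ) (x + 1)
      ≤ ∫ x in (w - 1)..w, dhConst κ * R * (x ^ (-κ) * Lap (-κ) (x + 1)) := by
    refine intervalIntegral.integral_mono_on (by linarith)
      ((posIntegrable_inv_sig hκ0).mul_shift (continuousOn_Lap _) _ _ (by linarith)
        (by linarith)) ((posIntegrable_rpow_mul_Lap κ _ _ (by linarith) (by linarith)).const_mul _)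
          fun x hx => ?_
    rw [← mul_assoc]
    exact mul_le_mul_of_nonneg_right (key x (by linarith [hx.1]) hx.2)
      (Lap_pos _ (by linarith [hx.1])).le
  rw [intervalIntegral.integral_const_mul] at h2
  have h3 := integral_rpow_mul_Lap κ (show 1 < w by linarith)
  have h4 := key w (by linarith) le_rfl
  have h5 := mul_le_mul_of_nonneg_right h4 (mul_nonneg (by linarith : 0 ≤ w)
    (Lap_pos (-κ) (by linarith : 0 < w)).le)
  have h6 : dhConst κ * R * w ^ (-κ) * (w * Lap (-κ) w)
      = dhConst κ * R * (w ^ (1 - κ) * Lap (-κ) w) := by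
    rw [show 1 - κ = -κ + 1 by ring, Real.rpow_add_one (by linarith)]; ring
  have h7 := mul_le_mul_of_nonneg_left h2 hκ0.le
  rw [h6] at h5
  have h8 := congrArg (fun t => dhConst κ * R * t) h3
  linarith

/-- Contradiction from a supersolution `H (u - β)` of the adjoint equation. -/
lemma false_of_supersolution (h : SieveData κ F f α β) (hκ : 1 < κ) (hab : α ≤ β) (hβw : β ≤ w)
    {H H' : ℝ → ℝ} {K : ℝ} (hH : Continuous H) (hd : ∀ s, 0 < s → HasDerivAt H (H' s) s)
    (h0 : ∀ s, 0 ≤ s → 0 ≤ H s) (h0' : ∀ s, 0 < s → 0 ≤ H' s)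
    (hK : ∀ s, 0 ≤ s → H s ≤ K * (s + 2) ^ 3)
    (hL : ∀ s, 0 < s → (w + s) * H' s ≤ (κ - 1) * H s + κ * H (s + 1))
    (hI : w * H 0 < κ * ∫ s in (0 : ℝ)..1, H s) : False := by
  have hb2 := h.two_le_beta
  have h1 := h.integral_upper_le hκ hab (H := fun u => H (u - β)) (H' := fun u => H' (u - β))
    (K := K) (by fun_prop) (fun u hu => HasDerivAt.comp_sub_const u β (hd _ (by linarith)))
    (fun u hu => h0 _ (by linarith)) (fun u hu => (hK _ (by linarith)).trans (by
      have hK0 : 0 ≤ K := by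
        have := (h0 0 le_rfl).trans (hK 0 le_rfl)
        norm_num at this; linarith
      have : 0 ≤ u - β + 2 := by linarith
      gcongr; linarith)) (fun u hu => by
        have h2 := hL (u - β) (by linarith)
        have h3 := mul_le_mul_of_nonneg_right (by linarith : u ≤ w + (u - β))
          (h0' (u - β) (by linarith))
        rw [show u - β + 1 = u + 1 - β by ring] at h2
        linarith)
  simp only [sub_self] at h1
  have hF := h.one_le (show 0 < β by linarith)
  have h2 : ∫ x in (β - 1)..β, F β * H (x + (1 - β)) ≤ ∫ x in (β - 1)..β, F x * H (x + 1 - β) := by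
    refine intervalIntegral.integral_mono_on (by linarith)
      (Continuous.intervalIntegrable (by fun_prop) _ _)
      (h.posIntegrable_upper.mul_shift (h := fun x => H (x - β)) (by fun_prop) _ _ (by linarith)
        (by linarith)) fun x hx => ?_
    rw [← add_sub_assoc]
    exact mul_le_mul_of_nonneg_right (h.antitone (mem_Ioi.2 (by linarith [hx.1]))
      (mem_Ioi.2 (by linarith)) hx.2) (h0 _ (by linarith [hx.1]))
  rw [intervalIntegral.integral_const_mul, intervalIntegral.integral_comp_add_right,
    show β - 1 + (1 - β) = 0 by ring, show β + (1 - β) = 1 by ring] at h2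
  have h3 := mul_le_mul_of_nonneg_left h2 (by linarith : 0 ≤ κ)
  have h4 := mul_lt_mul_of_pos_left hI (by linarith : 0 < F β)
  have h5 := mul_le_mul_of_nonneg_left (mul_le_mul_of_nonneg_right hβw (h0 0 le_rfl))
    (by linarith : 0 ≤ F β)
  linarith

lemma rpow_mul_upper_ge (h : SieveData κ F f α β) (hκ : 1 < κ) (hab : α ≤ β) {x : ℝ} (hx : 0 < x)
    (hxb : x ≤ β) : F β * (dhConst κ * sig κ β) ≤ x ^ κ * F x := by
  have hκ0 : 0 < κ := by linarith
  have ha2 := h.two_le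
  have hF := h.one_le (show 0 < β by linarith)
  rcases lt_or_ge x α with hxa | hxa
  · rw [h.eq_inv_sig x hxa]
    have h1 := h.le_inv_sig β
    have h2 := sig_pos hκ0 (show 0 < β by linarith)
    rw [le_div_iff₀ h2] at h1
    have h3 := dhConst_mul_sig_le hκ0 hx
    have h4 := sig_pos hκ0 hx
    have h5 := dhConst_pos hκ0
    calc F β * (dhConst κ * sig κ β) = dhConst κ * (F β * sig κ β) := by ring
      _ ≤ dhConst κ * 1 := by gcongr
      _ ≤ _ := by rw [mul_one, mul_one_div, le_div_iff₀ h4]; exact h3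
  · have h1 := antitoneOn_Icc_of_hasDerivAt (a := α) (b := β) (g := fun v => v ^ κ * F v)
      (g' := fun u => κ * u ^ (κ - 1) * f (u - 1))
      ((Real.continuous_rpow_const hκ0.le).continuousOn.mul
        ((h.continuousOn_upper hκ).mono fun x hx => hx.1))
      (fun u hu hub => h.hasDerivAt_upper hκ hu (h.continuousAt_lower hκ (by linarith)
        fun e => by linarith))
      (fun u hu hub => by rw [h.eq_zero (u - 1) (by linarith), mul_zero])
      ⟨hxa, hxb⟩ (right_mem_Icc.2 hab) hxb
    refine le_trans ?_ h1
    simp only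
    rw [mul_comm]
    exact mul_le_mul_of_nonneg_right (dhConst_mul_sig_le hκ0 (by linarith)) (by linarith)

/-- Contradiction from a supersolution `H (u - (β - 1))` of the adjoint equation which changes
sign before `β`. -/
lemma false_of_supersolution_of_neg (h : SieveData κ F f α β) (hκ : 1 < κ) (hab : α ≤ β)
    (hβw : β ≤ w) {R : ℝ} (hR : 1 ≤ R * (dhConst κ * (w ^ (-κ) * sig κ w)))
    {H H' : ℝ → ℝ} {K : ℝ} (hH : Continuous H) (hd : ∀ s, 0 < s → HasDerivAt H (H' s) s)
    (h0 : ∀ s, 1 ≤ s → 0 ≤ H s) (h0' : ∀ s, 0 < s → 0 ≤ H' s)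
    (hK : ∀ s, 1 ≤ s → H s ≤ K * (s + 1) ^ 3)
    (hL : ∀ s, 0 < s → (w - 1 + s) * H' s ≤ (κ - 1) * H s + κ * H (s + 1))
    (hN : H 0 + (R - 1) * H 1 < 0) : False := by
  have hκ0 : 0 < κ := by linarith
  have hb2 := h.two_le_beta
  have hA := dhConst_pos hκ0
  set b := β - 1 with hb
  have hL' : ∀ u, b < u → u * H' (u - b) ≤ (κ - 1) * H (u - b) + κ * H (u + 1 - b) :=
    fun u hu => by
      have h2 := hL (u - b) (by linarith)
      have h3 := mul_le_mul_of_nonneg_right (by linarith : u ≤ w - 1 + (u - b))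
          (h0' (u - b) (by linarith))
      rw [show u - b + 1 = u + 1 - b by ring] at h2
      linarith
  have hd' : ∀ u, b < u → HasDerivAt (fun u => H (u - b)) (H' (u - b)) u :=
    fun u hu => HasDerivAt.comp_sub_const u b (hd _ (by linarith))
  have h1 := h.integral_upper_le hκ hab (H := fun u => H (u - b)) (H' := fun u => H' (u - b))
    (K := K) (by fun_prop) (fun u hu => hd' u (by linarith))
    (fun u hu => h0 _ (by linarith)) (fun u hu => (hK _ (by linarith)).trans (by
      have hK0 : 0 ≤ K := by
        have := (h0 1 le_rfl).trans (hK 1 le_rfl)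
        norm_num at this; linarith
      have : 0 ≤ u - b + 1 := by linarith
      gcongr; linarith)) (fun u hu => by linarith [hL' u (by linarith)])
  simp only [show β - b = 1 by rw [hb]; ring] at h1
  have hF := h.one_le (show 0 < β by linarith)
  set m := F β * (dhConst κ * sig κ β) with hm
  have hsb := sig_pos hκ0 (show 0 < β by linarith)
  have hLi : PosIntegrable (fun x : ℝ => x ^ (-κ) * H (x + 1 - b)) :=
    (posIntegrable_of_continuousOn (g := fun x : ℝ => x ^ (-κ))
      (fun x hx => (Real.continuousAt_rpow_const x _ (Or.inl
        (ne_of_gt hx))).continuousWithinAt)).mul_shift (h := fun x => H (x - b)) (by fun_prop)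
  have h2 : ∫ x in b..β, m * (x ^ (-κ) * H (x + 1 - b)) ≤ ∫ x in b..β, F x * H (x + 1 - b) := by
    refine intervalIntegral.integral_mono_on (by linarith)
      ((hLi _ _ (by linarith) (by linarith)).const_mul m)
      (h.posIntegrable_upper.mul_shift (h := fun x => H (x - b)) (by fun_prop) _ _ (by linarith)
        (by linarith)) fun x hx => ?_
    have hx0 : 0 < x := by linarith [hx.1]
    rw [← mul_assoc]
    refine mul_le_mul_of_nonneg_right ?_ (h0 _ (by linarith [hx.1]))
    have h3 := h.rpow_mul_upper_ge hκ hab hx0 hx.2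
    have h4 := rpow_neg_mul_rpow κ hx0
    calc m * x ^ (-κ) ≤ (x ^ κ * F x) * x ^ (-κ) :=
          mul_le_mul_of_nonneg_right h3 (Real.rpow_nonneg hx0.le _)
      _ = F x := by linear_combination F x * h4
  rw [intervalIntegral.integral_const_mul] at h2
  have h3 : β ^ (1 - κ) * H 1 - b ^ (1 - κ) * H 0 ≤ κ * ∫ x in b..β, x ^ (-κ) * H (x + 1 - b) := by
    have hcd : ∀ u, b < u → HasDerivAt (fun u => u ^ (1 - κ) * H (u - b))
        (u ^ (-κ) * ((1 - κ) * H (u - b) + u * H' (u - b))) u := fun u hu => by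
      have := hasDerivAt_rpow_mul_of_mul (κ := κ) (show 0 < u by linarith)
        ((hasDerivAt_id u).mul (hd' u hu))
      exact this.congr_deriv (by simp only [id]; ring)
    have h5 : ContinuousOn (fun u => u ^ (1 - κ) * H (u - b)) (Icc b β) := by
      refine ContinuousOn.mul (fun x hx => (Real.continuousAt_rpow_const x _ (Or.inl
        (by linarith [hx.1] : x ≠ 0))).continuousWithinAt) (by fun_prop)
    have h7 : ContinuousOn (fun x : ℝ => x ^ (-κ) * H (x + 1 - b)) (Ioi 0) :=
      ContinuousOn.mul (fun x hx => (Real.continuousAt_rpow_const x _ (Or.inl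
        (ne_of_gt hx))).continuousWithinAt) (by fun_prop)
    have h8 := antitoneOn_Icc_of_hasDerivAt (a := b) (b := β)
      (g := fun u => u ^ (1 - κ) * H (u - b) - κ * ∫ x in (1 : ℝ)..u, x ^ (-κ) * H (x + 1 - b))
      (h5.sub (continuousOn_const.mul (hLi.continuousOn_primitive.mono
        fun x hx => mem_Ioi.2 (by linarith [hx.1]))))
      (fun u hu _ => (hcd u hu).sub ((hLi.hasDerivAt (by linarith)
        (h7.continuousAt (Ioi_mem_nhds (by linarith)))).const_mul κ))
      (fun u hu _ => by
        have h9 := mul_le_mul_of_nonneg_left (hL' u hu)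
          (Real.rpow_nonneg (by linarith : 0 ≤ u) (-κ))
        linarith) (left_mem_Icc.2 (by linarith)) (right_mem_Icc.2 (by linarith))
        (by linarith : b ≤ β)
    simp only [sub_self, show β - b = 1 by rw [hb]; ring] at h8
    rw [← intervalIntegral.integral_interval_sub_left (hLi 1 β one_pos (by linarith))
      (hLi 1 b one_pos (by linarith))]
    linarith
  have h4 : m * (β ^ (1 - κ) * H 1 - b ^ (1 - κ) * H 0) ≤ F β * (β * H 1) := by
    have hm0 : 0 ≤ m := by positivity
    have h5 := mul_le_mul_of_nonneg_left h3 hm0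
    have h6 := mul_le_mul_of_nonneg_left h2 hκ0.le
    linarith
  have hRb : 1 ≤ R * (dhConst κ * (β ^ (-κ) * sig κ β)) := by
    have h3 := antitoneOn_rpow_neg_mul_sig hκ0 (mem_Ioi.2 (show 0 < β by linarith))
      (mem_Ioi.2 (by linarith : 0 < w)) hβw
    have hR0 : 0 ≤ R := by
      have h4 : 0 < dhConst κ * (w ^ (-κ) * sig κ w) :=
        mul_pos hA (mul_pos (Real.rpow_pos_of_pos (by linarith) _) (sig_pos hκ0 (by linarith)))
      by_contra! h5
      linarith [mul_neg_of_neg_of_pos h5 h4]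
    exact hR.trans (by gcongr)
  set q := dhConst κ * (β ^ (-κ) * sig κ β) with hq
  have hq0 : 0 < q := by positivity
  have hH1 := h0 1 le_rfl
  have hH0 : H 0 < 0 := by
    have h5 : q ≤ 1 := by
      have h6 := dhConst_mul_sig_le hκ0 (show 0 < β by linarith)
      have h7 := mul_le_mul_of_nonneg_left h6 (Real.rpow_nonneg (by linarith : 0 ≤ β) (-κ))
      rw [rpow_neg_mul_rpow κ (by linarith)] at h7
      rw [hq]; linarith
    have h6 : 1 ≤ R := by
      by_contra! h7
      have h8 : R * q ≤ R * 1 ∨ R ≤ 0 := by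
        rcases le_or_gt R 0 with h9 | h9
        · exact Or.inr h9
        · exact Or.inl (by gcongr)
      rcases h8 with h8 | h8
      · linarith
      · linarith [mul_nonpos_of_nonpos_of_nonneg h8 hq0.le]
    linarith [mul_nonneg (by linarith : 0 ≤ R - 1) hH1]
  have h5 : b ^ (1 - κ) * β ^ (κ - 1) ≥ 1 := by
    have h6 := rpow_neg_mul_rpow (κ - 1) (show 0 < b by linarith)
    rw [neg_sub] at h6
    have h7 := Real.rpow_le_rpow (by linarith : 0 ≤ b) (by linarith : b ≤ β)
      (by linarith : 0 ≤ κ - 1)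
    have h8 := mul_le_mul_of_nonneg_left h7 (Real.rpow_nonneg (by linarith : 0 ≤ b) (1 - κ))
    linarith
  have e1 : β ^ (1 - κ) = β * β ^ (-κ) := by
    rw [show 1 - κ = -κ + 1 by ring, Real.rpow_add_one (by linarith)]; ring
  have e2 : b ^ (1 - κ) ≥ β * β ^ (-κ) := by
    rw [← e1]
    exact Real.rpow_le_rpow_of_nonpos (by linarith) (by linarith) (by linarith)
  have h6 : q * (H 1 - H 0) ≤ H 1 := by
    have h7 : β ^ (1 - κ) * H 1 - b ^ (1 - κ) * H 0 ≥ β * β ^ (-κ) * (H 1 - H 0) := by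
      rw [e1]
      have := mul_le_mul_of_nonneg_right e2 (by linarith : 0 ≤ -H 0)
      linarith
    have hm0 : 0 ≤ m := by positivity
    have h8 := (mul_le_mul_of_nonneg_left h7 hm0).trans h4
    have h9 : F β * β * (q * (H 1 - H 0)) ≤ F β * β * H 1 := by
      rw [hq]; rw [hm] at h8; linarith
    exact le_of_mul_le_mul_left h9 (by positivity)
  have hR0 : 0 < R := by
    by_contra! h7
    linarith [mul_nonpos_of_nonpos_of_nonneg h7 hq0.le]
  have h7 := mul_le_mul_of_nonneg_left h6 hR0.le
  have h8 := mul_le_mul_of_nonneg_right hRb (by linarith : 0 ≤ H 1 - H 0)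
  linarith

end SieveData

/-- Comparison principle: supersolutions of the equation satisfied by `Lap (-κ)` dominate it. -/
lemma Lap_le_of_supersolution {κ a C B : ℝ} (hκ : 1 < κ) (ha : 0 < a) {U U' : ℝ → ℝ}
    (hd : ∀ u, a ≤ u → HasDerivAt U (U' u) u)
    (hL : ∀ u, a ≤ u → U u + u * U' u ≤ κ * U u - κ * U (u + 1))
    (hlow : ∀ u, a ≤ u → 1 / u - C / u ^ 2 ≤ U u) (hbd : ∀ u, a ≤ u → U u ≤ B) :
    Lap (-κ) a ≤ U a := by
  have hκ0 : 0 < κ := by linarith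
  set p := Lap (-κ) with hp
  set q := κ / (κ + 1) with hq
  have hq0 : 0 ≤ q := by positivity
  have hq1 : q < 1 := (div_lt_one (by linarith)).2 (by linarith)
  have hqκ : q * (κ + 1) = κ := div_mul_cancel₀ _ (by linarith)
  have hpd : ∀ u, 0 < u → HasDerivAt (fun v => v ^ (1 - κ) * p v)
      (-(κ * (u ^ (-κ) * p (u + 1)))) u := fun u hu => hasDerivAt_rpow_mul_Lap κ hu
  have step : ∀ c, 0 ≤ c → (∀ u, a ≤ u → -(c / u ^ 2) ≤ U u - p u) →
      ∀ u, a ≤ u → -(c * q / u ^ 2) ≤ U u - p u := by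
    intro c hc h u hu
    have hpow : ∀ u : ℝ, 0 < u → u ^ (-κ - 2) = u ^ (-κ) / u ^ 2 := fun u hu => by
      rw [Real.rpow_sub hu]; norm_num
    have hpow1 : ∀ u : ℝ, 0 < u → u ^ (-κ - 1) = u ^ (-κ) / u := fun u hu => by
      rw [Real.rpow_sub hu]; norm_num
    have hpow2 : ∀ u : ℝ, 0 < u → u ^ (1 - κ) = u ^ (-κ) * u := fun u hu => by
      rw [← Real.rpow_add_one hu.ne']; ring_nf
    set g := fun v : ℝ => v ^ (1 - κ) * U v - v ^ (1 - κ) * p v + c * q * v ^ (-κ - 1) with hg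
    have hgd : ∀ u, a ≤ u → HasDerivAt g (((1 - κ) * u ^ (-κ) * U u + u ^ (1 - κ) * U' u)
        - -(κ * (u ^ (-κ) * p (u + 1))) + c * q * ((-κ - 1) * u ^ (-κ - 2))) u := by
      intro u hu
      have hu0 : 0 < u := by linarith
      have h1 := Real.hasDerivAt_rpow_const (p := 1 - κ) (Or.inl hu0.ne')
      have h2 := Real.hasDerivAt_rpow_const (p := -κ - 1) (Or.inl hu0.ne')
      rw [show 1 - κ - 1 = -κ by ring] at h1
      rw [show -κ - 1 - 1 = -κ - 2 by ring] at h2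
      exact ((h1.mul (hd u hu)).sub (hpd u hu0)).add (h2.const_mul _)
    have hanti : AntitoneOn g (Ici a) := by
      refine antitoneOn_Ici_of_hasDerivAt
        (fun u hu => (hgd u hu).continuousAt.continuousWithinAt) (fun u hu => hgd u hu.le)
        fun u hu => ?_
      have hu0 : 0 < u := by linarith
      have h1 := hL u hu.le
      have h2 := h (u + 1) (by linarith)
      have hr : 0 < u ^ (-κ) := Real.rpow_pos_of_pos hu0 _
      have h3 : c / (u + 1) ^ 2 ≤ c / u ^ 2 :=
        div_le_div_of_nonneg_left hc (by positivity) (by gcongr; linarith)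
      have h4 : (1 - κ) * u ^ (-κ) * U u + u ^ (1 - κ) * U' u
          - -(κ * (u ^ (-κ) * p (u + 1))) + c * q * ((-κ - 1) * u ^ (-κ - 2))
          = u ^ (-κ) * ((U u + u * U' u - κ * U u) + κ * p (u + 1)
            - q * (κ + 1) * (c / u ^ 2)) := by
        rw [hpow2 u hu0, hpow u hu0]; ring
      rw [h4, hqκ]
      refine mul_nonpos_of_nonneg_of_nonpos hr.le ?_
      have h5 := mul_le_mul_of_nonneg_left h2 hκ0.le
      have h6 := mul_le_mul_of_nonneg_left h3 hκ0.le
      linarith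
    have hlim : Tendsto g atTop (𝓝 0) := by
      have e1 : Tendsto (fun v : ℝ => v ^ (1 - κ)) atTop (𝓝 0) := by
        rw [show 1 - κ = -(κ - 1) by ring]
        exact tendsto_rpow_neg_atTop (by linarith)
      have e2 : Tendsto (fun v : ℝ => v ^ (-κ - 1)) atTop (𝓝 0) := by
        rw [show -κ - 1 = -(κ + 1) by ring]
        exact tendsto_rpow_neg_atTop (by linarith)
      have e3 : Tendsto (fun v : ℝ => v ^ (1 - κ) * U v) atTop (𝓝 0) := by
        have : Tendsto (fun v : ℝ => v ^ (1 - κ) * (|C| / a ^ 2 + |B|)) atTop (𝓝 0) := by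
          simpa using e1.mul_const (|C| / a ^ 2 + |B|)
        refine squeeze_zero_norm' ?_ this
        filter_upwards [eventually_ge_atTop a] with v hv
        have hv0 : 0 < v := by linarith
        rw [Real.norm_eq_abs, abs_mul, abs_of_pos (Real.rpow_pos_of_pos hv0 _)]
        refine mul_le_mul_of_nonneg_left ?_ (Real.rpow_pos_of_pos hv0 _).le
        have k1 := hlow v hv
        have k2 := hbd v hv
        have k3 : C / v ^ 2 ≤ |C| / a ^ 2 := by gcongr; exact le_abs_self C
        have k4 : 0 < 1 / v := by positivity
        have k5 : 0 ≤ |C| / a ^ 2 := by positivity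
        rw [abs_le]
        constructor <;> linarith [le_abs_self B, abs_nonneg B]
      have e4 := (e3.sub (e1.mul (tendsto_Lap (-κ)))).add (e2.const_mul (c * q))
      simpa using e4
    have hge : 0 ≤ g u := by
      refine le_of_tendsto hlim ?_
      filter_upwards [eventually_ge_atTop u] with v hv
      exact hanti hu (hu.trans hv) hv
    have hu0 : 0 < u := by linarith
    have hr : 0 < u ^ (-κ) * u := mul_pos (Real.rpow_pos_of_pos hu0 _) hu0
    have h4 : g u = u ^ (-κ) * u * (U u - p u + c * q / u ^ 2) := by
      simp only [hg]
      rw [hpow2 u hu0, hpow1 u hu0]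
      field_simp
    rw [h4] at hge
    linarith [nonneg_of_mul_nonneg_right hge hr]
  have hall : ∀ n : ℕ, ∀ u, a ≤ u → -(|C| * q ^ n / u ^ 2) ≤ U u - p u := by
    intro n
    induction n with
    | zero =>
      intro u hu
      have hu0 : 0 < u := by linarith
      have h1 := hlow u hu
      have h2 : u * p u ≤ 1 := mul_Lap_le_one (by linarith) hu0
      have h3 : p u ≤ 1 / u := by rw [le_div_iff₀ hu0]; linarith
      have h4 : C / u ^ 2 ≤ |C| / u ^ 2 := by gcongr; exact le_abs_self C
      simp only [pow_zero, mul_one]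
      linarith
    | succ n ih =>
      have := step (|C| * q ^ n) (by positivity) ih
      simpa only [pow_succ, mul_assoc] using this
  have hlim : Tendsto (fun n : ℕ => -(|C| * q ^ n / a ^ 2)) atTop (𝓝 0) := by
    simpa using (((tendsto_pow_atTop_nhds_zero_of_lt_one hq0 hq1).const_mul |C|).div_const
      (a ^ 2)).neg
  have h0 : 0 ≤ U a - p a := le_of_tendsto' hlim fun n => hall n a le_rfl
  linarith

lemma Lap_le_of_partialFractions {κ a d c₀ c₁ c₂ : ℝ} (hκ : 1 < κ) (ha : 0 < a) (hd : 0 ≤ d)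
    (hc : c₀ + c₁ + c₂ = 1)
    (hG : ∀ u, a ≤ u → 0 ≤ c₀ * ((κ - 1) / (u + d) - κ / (u + (d + 1)) + u / (u + d) ^ 2)
      + c₁ * ((κ - 1) / (u + (d + 1)) - κ / (u + (d + 2)) + u / (u + (d + 1)) ^ 2)
      + c₂ * ((κ - 1) / (u + (d + 2)) - κ / (u + (d + 3)) + u / (u + (d + 2)) ^ 2)) :
    Lap (-κ) a ≤ c₀ / (a + d) + c₁ / (a + (d + 1)) + c₂ / (a + (d + 2)) := by
  have hone : ∀ c e u : ℝ, 0 ≤ e → 0 < u → HasDerivAt (fun v => c / (v + e))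
      (-(c / (u + e) ^ 2)) u := fun c e u he hu => by
    have h1 : HasDerivAt (fun v : ℝ => v + e) 1 u := (hasDerivAt_id u).add_const e
    exact ((hasDerivAt_const u c).div h1 (by positivity)).congr_deriv (by ring)
  have hlo : ∀ c e u : ℝ, 0 ≤ e → 0 < u → c / u - |c| * e / u ^ 2 ≤ c / (u + e) := by
    intro c e u he hu
    have h1 : c / u - c / (u + e) = c * (e / (u * (u + e))) := by field_simp; ring
    have h2 : e / (u * (u + e)) ≤ e / u ^ 2 := by
      rw [sq]; gcongr; linarith
    have h3 : c * (e / (u * (u + e))) ≤ |c| * (e / u ^ 2) :=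
      (mul_le_mul_of_nonneg_right (le_abs_self c) (by positivity)).trans
        (mul_le_mul_of_nonneg_left h2 (abs_nonneg c))
    rw [mul_div_assoc]
    linarith
  have hup : ∀ c e u : ℝ, 0 ≤ e → a ≤ u → c / (u + e) ≤ |c| / a := fun c e u he hu =>
    div_le_div₀ (abs_nonneg c) (le_abs_self c) ha (by linarith)
  refine Lap_le_of_supersolution (C := |c₀| * d + |c₁| * (d + 1) + |c₂| * (d + 2))
    (B := |c₀| / a + |c₁| / a + |c₂| / a)
    (U := fun u => c₀ / (u + d) + c₁ / (u + (d + 1)) + c₂ / (u + (d + 2))) hκ ha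
    (fun u hu => ((hone _ _ u hd (by linarith)).add (hone _ _ u (by linarith) (by linarith))).add
      (hone _ _ u (by linarith) (by linarith))) (fun u hu => ?_) (fun u hu => ?_)
    fun u hu => add_le_add (add_le_add (hup _ _ u hd hu) (hup _ _ u (by linarith) hu))
      (hup _ _ u (by linarith) hu)
  · have h := hG u hu
    have e1 : u + 1 + d = u + (d + 1) := by ring
    have e2 : u + 1 + (d + 1) = u + (d + 2) := by ring
    have e3 : u + 1 + (d + 2) = u + (d + 3) := by ring
    simp only [e1, e2, e3]
    rw [← sub_nonneg]
    convert h using 1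
    ring
  · have hu0 : 0 < u := by linarith
    have h0 := hlo c₀ d u hd hu0
    have h1 := hlo c₁ (d + 1) u (by linarith) hu0
    have h2 := hlo c₂ (d + 2) u (by linarith) hu0
    have h3 : 1 / u = c₀ / u + c₁ / u + c₂ / u := by rw [← hc]; ring
    have h4 : (|c₀| * d + |c₁| * (d + 1) + |c₂| * (d + 2)) / u ^ 2 = |c₀| * d / u ^ 2
      + |c₁| * (d + 1) / u ^ 2 + |c₂| * (d + 2) / u ^ 2 := by ring
    linarith

lemma log_Lap_le {a b : ℝ} (ha : 0 ≤ a) (hb : 0 ≤ b) (hab : a + b = 1) (c₀ c₁ : ℝ) {y₀ y₁ : ℝ}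
    (h₀ : 0 < y₀) (h₁ : 0 < y₁) (h : 0 < a * y₀ + b * y₁) :
    Real.log (Lap (a * c₀ + b * c₁) (a * y₀ + b * y₁))
      ≤ a * Real.log (Lap c₀ y₀) + b * Real.log (Lap c₁ y₁) := by
  set L₀ := Real.log (Lap c₀ y₀) with hL₀
  set L₁ := Real.log (Lap c₁ y₁) with hL₁
  have e₀ : Real.exp (-L₀) * Lap c₀ y₀ = 1 := by
    rw [hL₀, Real.exp_neg, Real.exp_log (Lap_pos _ h₀), inv_mul_cancel₀ (Lap_pos _ h₀).ne']
  have e₁ : Real.exp (-L₁) * Lap c₁ y₁ = 1 := by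
    rw [hL₁, Real.exp_neg, Real.exp_log (Lap_pos _ h₁), inv_mul_cancel₀ (Lap_pos _ h₁).ne']
  have key : Real.exp (-(a * L₀ + b * L₁)) * Lap (a * c₀ + b * c₁) (a * y₀ + b * y₁)
      ≤ a * (Real.exp (-L₀) * Lap c₀ y₀) + b * (Real.exp (-L₁) * Lap c₁ y₁) := by
    have i₀ := integrableOn_lap c₀ h₀
    have i₁ := integrableOn_lap c₁ h₁
    simp only [Lap]
    rw [← integral_const_mul, ← integral_const_mul, ← integral_const_mul, ← integral_const_mul,
      ← integral_const_mul, ← integral_add ((i₀.const_mul _).const_mul _)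
        ((i₁.const_mul _).const_mul _)]
    refine integral_mono ((integrableOn_lap _ h).const_mul _)
      (((i₀.const_mul _).const_mul _).add ((i₁.const_mul _).const_mul _)) fun x => ?_
    have := convexOn_exp.2 (mem_univ (-L₀ + (-y₀ * x + c₀ * Ein x)))
      (mem_univ (-L₁ + (-y₁ * x + c₁ * Ein x))) ha hb hab
    simp only [smul_eq_mul] at this
    calc _ = Real.exp (a * (-L₀ + (-y₀ * x + c₀ * Ein x))
          + b * (-L₁ + (-y₁ * x + c₁ * Ein x))) := by rw [← Real.exp_add]; congr 1; ring
      _ ≤ _ := this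
      _ = _ := by rw [Real.exp_add (-L₀), Real.exp_add (-L₁)]
  rw [e₀, e₁, mul_one, mul_one, hab, ← Real.log_le_log_iff (mul_pos (Real.exp_pos _)
    (Lap_pos _ h)) one_pos, Real.log_mul (Real.exp_pos _).ne' (Lap_pos _ h).ne', Real.log_exp,
    Real.log_one] at key
  linarith

lemma log_dhConst {κ : ℝ} (hκ : 0 < κ) : Real.log (dhConst κ)
    = κ * (Real.log 2 + Real.eulerMascheroniConstant) + Real.log (Real.Gamma (κ + 1)) := by
  rw [dhConst, Real.log_mul (by positivity) (Real.Gamma_pos_of_pos (by linarith)).ne',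
    Real.log_rpow (by positivity), Real.log_mul two_ne_zero (Real.exp_pos _).ne', Real.log_exp]

/-- The logarithm of `dhConst (1 + x) * Lap (-(1 + x)) (1 + 23 / 10 * x)`. -/
noncomputable def logWeight (x : ℝ) : ℝ :=
  Real.log (dhConst (1 + x)) + Real.log (Lap (-(1 + x)) (1 + 23 / 10 * x))

lemma convexOn_logWeight : ConvexOn ℝ (Ici 0) logWeight := by
  refine ⟨convex_Ici 0, fun x hx y hy a b ha hb hab => ?_⟩
  have hx0 : 0 ≤ x := hx
  have hy0 : 0 ≤ y := hy
  have hxy : 0 ≤ a * x + b * y := by positivity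
  have hΓ := Real.convexOn_log_Gamma.2 (x := 1 + x + 1) (mem_Ioi.2 (by linarith)) (y := 1 + y + 1)
    (mem_Ioi.2 (by linarith)) ha hb hab
  have hp := log_Lap_le ha hb hab (-(1 + x)) (-(1 + y)) (y₀ := 1 + 23 / 10 * x)
    (y₁ := 1 + 23 / 10 * y) (by linarith) (by linarith) (by nlinarith)
  simp only [smul_eq_mul, Function.comp_apply] at hΓ ⊢
  have e : a * (1 + x + 1) + b * (1 + y + 1) = 1 + (a * x + b * y) + 1 := by
    linear_combination 2 * hab
  have e' : a * -(1 + x) + b * -(1 + y) = -(1 + (a * x + b * y)) := by linear_combination -hab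
  have e'' : a * (1 + 23 / 10 * x) + b * (1 + 23 / 10 * y) = 1 + 23 / 10 * (a * x + b * y) := by
    linear_combination hab
  rw [e] at hΓ
  rw [e', e''] at hp
  simp only [logWeight]
  rw [log_dhConst (by linarith), log_dhConst (by linarith), log_dhConst (by linarith)]
  linear_combination hΓ + hp - (Real.log 2 + Real.eulerMascheroniConstant) * hab

lemma logWeight_zero : logWeight 0 = Real.log 2 := by
  have h1 : Real.Gamma (1 + 1) = 1 := by
    have := Real.Gamma_nat_eq_factorial 1
    norm_num at this ⊢
  rw [logWeight, mul_zero, add_zero, Lap_neg_one_one, log_dhConst one_pos, h1]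
  simp

lemma log_le_of_pow_le {q : ℝ} {M K N : ℕ} (hq : 0 < q) (hN : 0 < N)
    (h : q ^ N * 2 ^ K ≤ 2 ^ M) : Real.log q ≤ ((M : ℝ) - K) / N * Real.log 2 := by
  have hN' : (0 : ℝ) < N := by exact_mod_cast hN
  have h1 := Real.log_le_log (by positivity) h
  rw [Real.log_mul (by positivity) (by positivity), Real.log_pow, Real.log_pow, Real.log_pow] at h1
  rw [div_mul_eq_mul_div, le_div_iff₀ hN']
  linarith

lemma le_log_of_le_pow {q : ℝ} {M K N : ℕ} (hq : 0 < q) (hN : 0 < N)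
    (h : 2 ^ M ≤ q ^ N * 2 ^ K) : ((M : ℝ) - K) / N * Real.log 2 ≤ Real.log q := by
  have hN' : (0 : ℝ) < N := by exact_mod_cast hN
  have h1 := Real.log_le_log (by positivity) h
  rw [Real.log_mul (by positivity) (by positivity), Real.log_pow, Real.log_pow, Real.log_pow] at h1
  rw [div_mul_eq_mul_div, div_le_iff₀ hN']
  linarith

lemma le_log_of_nonneg {y : ℝ} (hy : 1 ≤ y) : 2 * (y - 1) / (y + 1) ≤ Real.log y := by
  have h := Real.sum_range_le_log_div (x := (y - 1) / (y + 1))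
    (div_nonneg (by linarith) (by linarith)) ((div_lt_one (by linarith)).2 (by linarith)) 1
  have e : (1 + (y - 1) / (y + 1)) / (1 - (y - 1) / (y + 1)) = y := by
    have : y + 1 ≠ 0 := by linarith
    field_simp; ring
  rw [e] at h
  simp only [Finset.sum_range_one] at h
  norm_num at h
  rw [mul_div_assoc]
  linarith

lemma log_le_of_one_le {y : ℝ} (hy : 1 ≤ y) : Real.log y ≤ (y - 1 / y) / 2 := by
  have h := Real.log_div_le_sum_range_add (x := (y - 1) / (y + 1))
    (div_nonneg (by linarith) (by linarith)) ((div_lt_one (by linarith)).2 (by linarith)) 0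
  have e : (1 + (y - 1) / (y + 1)) / (1 - (y - 1) / (y + 1)) = y := by
    have : y + 1 ≠ 0 := by linarith
    field_simp; ring
  have e' : ((y - 1) / (y + 1)) / (1 - ((y - 1) / (y + 1)) ^ 2) = (y - 1 / y) / 4 := by
    have : y + 1 ≠ 0 := by linarith
    have hy0 : y ≠ 0 := by linarith
    have h2 : (y + 1) ^ 2 - (y - 1) ^ 2 = 4 * y := by ring
    have h3 : 1 - ((y - 1) / (y + 1)) ^ 2 = 4 * y / (y + 1) ^ 2 := by
      rw [← h2]; field_simp
    rw [h3]; field_simp; ring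
  rw [e] at h
  norm_num [e'] at h
  norm_num [e'] at h ⊢
  linarith

lemma eulerMascheroniConstant_le (n : ℕ) : Real.eulerMascheroniConstant
    ≤ harmonic n - Real.log (n + 1 / 2) := by
  have hanti : Antitone fun n : ℕ => (harmonic n : ℝ) - Real.log (n + 1 / 2) := by
    refine antitone_nat_of_succ_le fun n => ?_
    have hn : (0 : ℝ) ≤ n := n.cast_nonneg
    have h := le_log_of_nonneg (y := ((n + 1 : ℕ) + 1 / 2 : ℝ) / (n + 1 / 2))
      ((one_le_div (by positivity)).2 (by push_cast; linarith))
    rw [Real.log_div (by positivity) (by positivity)] at h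
    have e : 2 * (((n + 1 : ℕ) + 1 / 2 : ℝ) / (n + 1 / 2) - 1)
        / (((n + 1 : ℕ) + 1 / 2 : ℝ) / (n + 1 / 2) + 1) = (((n : ℝ) + 1))⁻¹ := by
      push_cast; field_simp; ring
    rw [e] at h
    rw [harmonic_succ]
    push_cast at h ⊢
    linarith
  refine hanti.le_of_tendsto ?_ n
  have h1 := Real.tendsto_harmonic_sub_log
  have h2 : Tendsto (fun n : ℕ => Real.log ((n + 1 / 2 : ℝ) / n)) atTop (𝓝 0) := by
    have h3 : Tendsto (fun n : ℕ => 1 + (1 / 2 : ℝ) / n) atTop (𝓝 1) := by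
      simpa using (tendsto_const_div_atTop_nhds_zero_nat (1 / 2 : ℝ)).const_add 1
    have h4 := (Real.continuousAt_log one_ne_zero).tendsto.comp h3
    rw [Real.log_one] at h4
    refine h4.congr' ?_
    filter_upwards [eventually_gt_atTop 0] with n hn
    have : (n : ℝ) ≠ 0 := by positivity
    simp only [Function.comp_apply]
    congr 1
    field_simp
  have h5 := h1.sub h2
  rw [sub_zero] at h5
  refine h5.congr' ?_
  filter_upwards [eventually_gt_atTop 0] with n hn
  have : (0 : ℝ) < n := by exact_mod_cast hn
  rw [Real.log_div (by positivity) (by positivity)]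
  ring

lemma le_eulerMascheroniConstant {n : ℕ} (hn : 0 < n) : harmonic n - Real.log n - 1 / (2 * n)
    ≤ Real.eulerMascheroniConstant := by
  have hmono : Monotone fun n : ℕ => (harmonic (n + 1) : ℝ) - Real.log (n + 1 : ℕ)
      - 1 / (2 * (n + 1 : ℕ)) := by
    refine monotone_nat_of_le_succ fun n => ?_
    have hn : (0 : ℝ) ≤ n := n.cast_nonneg
    have h := log_le_of_one_le (y := ((n + 1 + 1 : ℕ) : ℝ) / (n + 1 : ℕ))
      ((one_le_div (by positivity)).2 (by push_cast; linarith))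
    rw [Real.log_div (by positivity) (by positivity)] at h
    have e : (((n + 1 + 1 : ℕ) : ℝ) / (n + 1 : ℕ) - 1 / (((n + 1 + 1 : ℕ) : ℝ) / (n + 1 : ℕ))) / 2
        = (((n + 1 + 1 : ℕ) : ℝ))⁻¹ - 1 / (2 * (n + 1 + 1 : ℕ)) + 1 / (2 * (n + 1 : ℕ)) := by
      push_cast; field_simp; ring
    rw [e] at h
    rw [harmonic_succ (n + 1)]
    push_cast at h ⊢
    linarith
  obtain ⟨m, rfl⟩ : ∃ m, n = m + 1 := ⟨n - 1, by omega⟩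
  refine hmono.ge_of_tendsto ?_ m
  have h2 : Tendsto (fun n : ℕ => 1 / (2 * (n : ℝ))) atTop (𝓝 0) := by
    refine (tendsto_const_div_atTop_nhds_zero_nat (1 / 2 : ℝ)).congr fun n => ?_
    ring
  have h5 := Real.tendsto_harmonic_sub_log.sub h2
  rw [sub_zero] at h5
  exact h5.comp (tendsto_add_atTop_nat 1)

set_option exponentiation.threshold 2000 in
lemma eulerMascheroniConstant_lt : Real.eulerMascheroniConstant < 57733 / 100000 := by
  have h := eulerMascheroniConstant_le 20
  have e : (harmonic 20 : ℝ) = 55835135 / 15519504 := by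
    norm_num [harmonic, Finset.sum_range_succ]
  have h2 := le_log_of_le_pow (q := 41 / 2) (M := 780) (K := 0) (N := 179) (by norm_num)
    (by norm_num) (by norm_num)
  have h3 := Real.log_two_gt_d9
  rw [e] at h
  norm_num at h h2 ⊢
  linarith

lemma lt_eulerMascheroniConstant : 576 / 1000 < Real.eulerMascheroniConstant := by
  have h := le_eulerMascheroniConstant (n := 20) (by norm_num)
  have e : (harmonic 20 : ℝ) = 55835135 / 15519504 := by
    norm_num [harmonic, Finset.sum_range_succ]
  have h2 := log_le_of_pow_le (q := 20) (M := 255) (K := 0) (N := 59) (by norm_num)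
    (by norm_num) (by norm_num)
  have h3 := Real.log_two_lt_d9
  rw [e] at h
  norm_num at h h2 ⊢
  linarith

lemma Gamma_add_natCast {x : ℝ} (hx : 0 < x) (n : ℕ) :
    Real.Gamma (x + n) = Real.Gamma x * ∏ i ∈ Finset.range n, (x + i) := by
  induction n with
  | zero => simp
  | succ n ih =>
    rw [Nat.cast_succ, ← add_assoc, Real.Gamma_add_one (by positivity), ih,
      Finset.prod_range_succ]
    ring

lemma log_Gamma_le {m n : ℕ} {θ : ℝ} (hm : 0 < m) (h0 : 0 ≤ θ) (h1 : θ ≤ 1) :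
    Real.log (Real.Gamma (m + θ)) ≤ θ * Real.log (m + n)
      + Real.log ((m + n - 1).factorial / ∏ i ∈ Finset.range n, ((m : ℝ) + θ + i)) := by
  have hm0 : (0 : ℝ) < m := by exact_mod_cast hm
  have hs : (0 : ℝ) < m + n := by positivity
  have hP : 0 < ∏ i ∈ Finset.range n, ((m : ℝ) + θ + i) :=
    Finset.prod_pos fun i _ => by positivity
  have hf : Real.Gamma ((m : ℝ) + n) = (m + n - 1).factorial := by
    have := Real.Gamma_nat_eq_factorial (m + n - 1)
    rw [← this]
    congr 1
    rw [Nat.cast_sub (by omega)]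
    push_cast
    ring
  have hf0 : (0 : ℝ) < (m + n - 1).factorial := by positivity
  have hg := Real.convexOn_log_Gamma.2 (mem_Ioi.2 hs) (y := (m + n + 1 : ℝ))
    (mem_Ioi.2 (by linarith)) (sub_nonneg.2 h1) h0 (sub_add_cancel 1 θ)
  simp only [smul_eq_mul, Function.comp_apply] at hg
  rw [show (1 - θ) * ((m : ℝ) + n) + θ * (m + n + 1) = m + θ + n by ring,
    Gamma_add_natCast (by positivity), Real.Gamma_add_one hs.ne', hf,
    Real.log_mul hs.ne' hf0.ne', Real.log_mul (Real.Gamma_pos_of_pos (by positivity)).ne'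
      hP.ne'] at hg
  rw [Real.log_div hf0.ne' hP.ne']
  linarith

lemma logWeight_le {x θ q r : ℝ} {m n : ℕ} (hm : 0 < m) (h0 : 0 ≤ θ) (h1 : θ ≤ 1) (hx : 0 ≤ x)
    (hmx : 2 + x = m + θ) (hq : Lap (-(1 + x)) (1 + 23 / 10 * x) ≤ q)
    (hr : (m + n - 1).factorial / (∏ i ∈ Finset.range n, ((m : ℝ) + θ + i)) * q ≤ r) :
    logWeight x ≤ (1 + x) * (Real.log 2 + 57733 / 100000) + θ * Real.log (m + n)
      + Real.log r := by
  have hm0 : (0 : ℝ) < m := by exact_mod_cast hm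
  have hP : 0 < ∏ i ∈ Finset.range n, ((m : ℝ) + θ + i) :=
    Finset.prod_pos fun i _ => by positivity
  have hL := Lap_pos (-(1 + x)) (y := 1 + 23 / 10 * x) (by positivity)
  have hg := log_Gamma_le (n := n) hm h0 h1
  have hl := Real.log_le_log hL hq
  have hq0 := hL.trans_le hq
  have hr' := Real.log_le_log (by positivity) hr
  rw [Real.log_mul (by positivity) hq0.ne'] at hr'
  rw [logWeight, log_dhConst (by linarith),
    show 1 + x + 1 = m + θ by rw [← hmx]; ring]
  have := mul_le_mul_of_nonneg_left eulerMascheroniConstant_lt.le (by linarith : 0 ≤ 1 + x)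
  linarith

set_option exponentiation.threshold 2000 in
lemma logWeight_one_twelfth_le : logWeight (1 / 12) ≤ Real.log 2 := by
  have hp : Lap (-(1 + 1 / 12)) (1 + 23 / 10 * (1 / 12)) ≤ _ :=
    Lap_le_of_partialFractions (d := 19 / 60) (c₀ := 79 / 200) (c₁ := 9 / 20) (c₂ := 31 / 200)
      (by norm_num) (by norm_num) (by norm_num) (by norm_num) fun u hu => by
      obtain ⟨v, hv, rfl⟩ : ∃ v, 0 ≤ v ∧ u = 143 / 120 + v := ⟨u - 143 / 120, by
        norm_num at hu; linarith, by ring⟩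
      have h0 : 0 < 181 / 120 + v := by linarith
      have h1 : 0 < 301 / 120 + v := by linarith
      have h2 : 0 < 421 / 120 + v := by linarith
      have h3 : 0 < 541 / 120 + v := by linarith
      rw [show 143 / 120 + v + 19 / 60 = 181 / 120 + v by ring,
        show 143 / 120 + v + (19 / 60 + 1) = 301 / 120 + v by ring,
        show 143 / 120 + v + (19 / 60 + 2) = 421 / 120 + v by ring,
        show 143 / 120 + v + (19 / 60 + 3) = 541 / 120 + v by ring]
      field_simp
      ring_nf
      positivity
  have h := logWeight_le (n := 38) (m := 2) (θ := 1 / 12) (r := 371 / 1000) (by norm_num)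
    (by norm_num) (by norm_num) (by norm_num) (by norm_num) hp
    (by norm_num [Finset.prod_range_succ, Nat.factorial])
  have h2 := Real.log_two_lt_d9
  have h2' := Real.log_two_gt_d9
  have h3 := log_le_of_pow_le (q := 40) (M := 1091) (K := 0) (N := 205) (by norm_num)
    (by norm_num) (by norm_num)
  have h4 := log_le_of_pow_le (q := 371 / 1000) (M := 0) (K := 113) (N := 79) (by norm_num)
    (by norm_num) (by norm_num)
  norm_num at h h3 h4 ⊢
  linarith

set_option exponentiation.threshold 2000 in
lemma logWeight_one_quarter_le : logWeight (1 / 4) ≤ Real.log 2 + 3 / 50 := by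
  have hp : Lap (-(1 + 1 / 4)) (1 + 23 / 10 * (1 / 4)) ≤ _ :=
    Lap_le_of_partialFractions (d := 17 / 40) (c₀ := 2 / 5) (c₁ := 19 / 50) (c₂ := 11 / 50)
      (by norm_num) (by norm_num) (by norm_num) (by norm_num) fun u hu => by
      obtain ⟨v, hv, rfl⟩ : ∃ v, 0 ≤ v ∧ u = 63 / 40 + v := ⟨u - 63 / 40, by
        norm_num at hu; linarith, by ring⟩
      have h0 : 0 < 2 + v := by linarith
      have h1 : 0 < 3 + v := by linarith
      have h2 : 0 < 4 + v := by linarith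
      have h3 : 0 < 5 + v := by linarith
      rw [show 63 / 40 + v + 17 / 40 = 2 + v by ring,
        show 63 / 40 + v + (17 / 40 + 1) = 3 + v by ring,
        show 63 / 40 + v + (17 / 40 + 2) = 4 + v by ring,
        show 63 / 40 + v + (17 / 40 + 3) = 5 + v by ring]
      field_simp
      ring_nf
      positivity
  have h := logWeight_le (n := 38) (m := 2) (θ := 1 / 4) (r := 431 / 2500) (by norm_num)
    (by norm_num) (by norm_num) (by norm_num) (by norm_num) hp
    (by norm_num [Finset.prod_range_succ, Nat.factorial])
  have h2 := Real.log_two_lt_d9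
  have h2' := Real.log_two_gt_d9
  have h3 := log_le_of_pow_le (q := 40) (M := 1091) (K := 0) (N := 205) (by norm_num)
    (by norm_num) (by norm_num)
  have h4 := log_le_of_pow_le (q := 431 / 2500) (M := 0) (K := 246) (N := 97) (by norm_num)
    (by norm_num) (by norm_num)
  norm_num at h h3 h4 ⊢
  linarith

set_option exponentiation.threshold 2000 in
lemma logWeight_one_half_le : logWeight (1 / 2) ≤ Real.log 2 + 21 / 80 := by
  have hp : Lap (-(1 + 1 / 2)) (1 + 23 / 10 * (1 / 2)) ≤ _ :=
    Lap_le_of_partialFractions (d := 1 / 2) (c₀ := 8 / 25) (c₁ := 19 / 50) (c₂ := 3 / 10)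
      (by norm_num) (by norm_num) (by norm_num) (by norm_num) fun u hu => by
      obtain ⟨v, hv, rfl⟩ : ∃ v, 0 ≤ v ∧ u = 43 / 20 + v := ⟨u - 43 / 20, by
        norm_num at hu; linarith, by ring⟩
      have h0 : 0 < 53 / 20 + v := by linarith
      have h1 : 0 < 73 / 20 + v := by linarith
      have h2 : 0 < 93 / 20 + v := by linarith
      have h3 : 0 < 113 / 20 + v := by linarith
      rw [show 43 / 20 + v + 1 / 2 = 53 / 20 + v by ring,
        show 43 / 20 + v + (1 / 2 + 1) = 73 / 20 + v by ring,
        show 43 / 20 + v + (1 / 2 + 2) = 93 / 20 + v by ring,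
        show 43 / 20 + v + (1 / 2 + 3) = 113 / 20 + v by ring]
      field_simp
      ring_nf
      positivity
  have h := logWeight_le (n := 38) (m := 2) (θ := 1 / 2) (r := 611 / 10000) (by norm_num)
    (by norm_num) (by norm_num) (by norm_num) (by norm_num) hp
    (by norm_num [Finset.prod_range_succ, Nat.factorial])
  have h2 := Real.log_two_lt_d9
  have h2' := Real.log_two_gt_d9
  have h3 := log_le_of_pow_le (q := 40) (M := 1091) (K := 0) (N := 205) (by norm_num)
    (by norm_num) (by norm_num)
  have h4 := log_le_of_pow_le (q := 611 / 10000) (M := 0) (K := 371) (N := 92) (by norm_num)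
    (by norm_num) (by norm_num)
  norm_num at h h3 h4 ⊢
  linarith

set_option exponentiation.threshold 2000 in
lemma logWeight_one_le : logWeight 1 ≤ Real.log 2 + 91 / 100 := by
  have hp : Lap (-(1 + 1)) (1 + 23 / 10 * 1) ≤ _ :=
    Lap_le_of_partialFractions (d := 1) (c₀ := 1 / 2) (c₁ := 0) (c₂ := 1 / 2)
      (by norm_num) (by norm_num) (by norm_num) (by norm_num) fun u hu => by
      obtain ⟨v, hv, rfl⟩ : ∃ v, 0 ≤ v ∧ u = 33 / 10 + v := ⟨u - 33 / 10, by
        norm_num at hu; linarith, by ring⟩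
      have h0 : 0 < 43 / 10 + v := by linarith
      have h1 : 0 < 53 / 10 + v := by linarith
      have h2 : 0 < 63 / 10 + v := by linarith
      have h3 : 0 < 73 / 10 + v := by linarith
      rw [show 33 / 10 + v + 1 = 43 / 10 + v by ring,
        show 33 / 10 + v + (1 + 1) = 53 / 10 + v by ring,
        show 33 / 10 + v + (1 + 2) = 63 / 10 + v by ring,
        show 33 / 10 + v + (1 + 3) = 73 / 10 + v by ring]
      field_simp
      ring_nf
      positivity
  have h := logWeight_le (n := 0) (m := 3) (θ := 0) (r := 3913 / 10000) (by norm_num)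
    (by norm_num) (by norm_num) (by norm_num) (by norm_num) hp
    (by norm_num [Finset.prod_range_succ, Nat.factorial])
  have h2 := Real.log_two_lt_d9
  have h2' := Real.log_two_gt_d9
  have h4 := log_le_of_pow_le (q := 3913 / 10000) (M := 0) (K := 134) (N := 99) (by norm_num)
    (by norm_num) (by norm_num)
  norm_num at h h4 ⊢
  linarith

set_option exponentiation.threshold 2000 in
lemma logWeight_two_le : logWeight 2 ≤ Real.log 2 + 2781 / 1000 := by
  have hp : Lap (-(1 + 2)) (1 + 23 / 10 * 2) ≤ _ :=
    Lap_le_of_partialFractions (d := 2) (c₀ := 4 / 5) (c₁ := -3 / 5) (c₂ := 4 / 5)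
      (by norm_num) (by norm_num) (by norm_num) (by norm_num) fun u hu => by
      obtain ⟨v, hv, rfl⟩ : ∃ v, 0 ≤ v ∧ u = 28 / 5 + v := ⟨u - 28 / 5, by
        norm_num at hu; linarith, by ring⟩
      have h0 : 0 < 38 / 5 + v := by linarith
      have h1 : 0 < 43 / 5 + v := by linarith
      have h2 : 0 < 48 / 5 + v := by linarith
      have h3 : 0 < 53 / 5 + v := by linarith
      rw [show 28 / 5 + v + 2 = 38 / 5 + v by ring,
        show 28 / 5 + v + (2 + 1) = 43 / 5 + v by ring,
        show 28 / 5 + v + (2 + 2) = 48 / 5 + v by ring,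
        show 28 / 5 + v + (2 + 3) = 53 / 5 + v by ring]
      field_simp
      ring_nf
      positivity
  have h := logWeight_le (n := 0) (m := 4) (θ := 0) (r := 713 / 1000) (by norm_num)
    (by norm_num) (by norm_num) (by norm_num) (by norm_num) hp
    (by norm_num [Finset.prod_range_succ, Nat.factorial])
  have h2 := Real.log_two_lt_d9
  have h2' := Real.log_two_gt_d9
  have h4 := log_le_of_pow_le (q := 713 / 1000) (M := 0) (K := 20) (N := 41) (by norm_num)
    (by norm_num) (by norm_num)
  norm_num at h h4 ⊢
  linarith

set_option exponentiation.threshold 2000 in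
lemma logWeight_thirteen_fifths_le : logWeight (13 / 5) ≤ Real.log 2 + 517 / 125 := by
  have hp : Lap (-(1 + 13 / 5)) (1 + 23 / 10 * (13 / 5)) ≤ _ :=
    Lap_le_of_partialFractions (d := 13 / 5) (c₀ := 9 / 10) (c₁ := -4 / 5) (c₂ := 9 / 10)
      (by norm_num) (by norm_num) (by norm_num) (by norm_num) fun u hu => by
      obtain ⟨v, hv, rfl⟩ : ∃ v, 0 ≤ v ∧ u = 349 / 50 + v := ⟨u - 349 / 50, by
        norm_num at hu; linarith, by ring⟩
      have h0 : 0 < 479 / 50 + v := by linarith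
      have h1 : 0 < 529 / 50 + v := by linarith
      have h2 : 0 < 579 / 50 + v := by linarith
      have h3 : 0 < 629 / 50 + v := by linarith
      rw [show 349 / 50 + v + 13 / 5 = 479 / 50 + v by ring,
        show 349 / 50 + v + (13 / 5 + 1) = 529 / 50 + v by ring,
        show 349 / 50 + v + (13 / 5 + 2) = 579 / 50 + v by ring,
        show 349 / 50 + v + (13 / 5 + 3) = 629 / 50 + v by ring]
      field_simp
      ring_nf
      positivity
  have h := logWeight_le (n := 36) (m := 4) (θ := 3 / 5) (r := 141 / 1000) (by norm_num)
    (by norm_num) (by norm_num) (by norm_num) (by norm_num) hp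
    (by norm_num [Finset.prod_range_succ, Nat.factorial])
  have h2 := Real.log_two_lt_d9
  have h2' := Real.log_two_gt_d9
  have h3 := log_le_of_pow_le (q := 40) (M := 1091) (K := 0) (N := 205) (by norm_num)
    (by norm_num) (by norm_num)
  have h4 := log_le_of_pow_le (q := 141 / 1000) (M := 0) (K := 65) (N := 23) (by norm_num)
    (by norm_num) (by norm_num)
  norm_num at h h3 h4 ⊢
  linarith

lemma rpow_le_tangent {z ρ c : ℝ} {p d : ℕ} (hz : 0 ≤ z) (hρ : 0 < ρ) (hd : 0 < d)
    (hpd : p ≤ d) (hc : 0 ≤ c) (h : ρ ^ p ≤ c ^ d) :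
    z ^ ((p : ℝ) / d) ≤ c * (1 - (p : ℝ) / d + (p : ℝ) / d / ρ * z) := by
  have hd0 : (0 : ℝ) < d := by exact_mod_cast hd
  have hρc : ρ ^ ((p : ℝ) / d) ≤ c := by
    have h1 := Real.rpow_le_rpow (by positivity) h (by positivity : (0 : ℝ) ≤ 1 / d)
    rwa [← Real.rpow_natCast, ← Real.rpow_natCast, ← Real.rpow_mul hρ.le, ← Real.rpow_mul hc,
      mul_one_div_cancel hd0.ne', Real.rpow_one, mul_one_div] at h1
  have hpd' : (p : ℝ) / d ≤ 1 := div_le_one_of_le₀ (by exact_mod_cast hpd) hd0.le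
  have hb := rpow_one_add_le_one_add_mul_self (s := z / ρ - 1) (p := (p : ℝ) / d)
    (by linarith [div_nonneg hz hρ.le]) (by positivity) hpd'
  rw [add_sub_cancel, Real.div_rpow hz hρ.le, div_le_iff₀ (by positivity)] at hb
  refine hb.trans ?_
  rw [mul_comm]
  refine (mul_le_mul_of_nonneg_right hρc ?_).trans_eq (by ring)
  have : 0 ≤ (p : ℝ) / d * (z / ρ) := by positivity
  linarith

noncomputable def logTail (n : ℕ) (z : ℝ) : ℝ :=
  -Real.log (1 - z) - ∑ i ∈ Finset.range n, z ^ (i + 1) / (i + 1)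

@[simp] lemma logTail_zero (n : ℕ) : logTail n 0 = 0 := by simp [logTail]

lemma hasDerivAt_logTail (n : ℕ) {z : ℝ} (hz : z < 1) :
    HasDerivAt (logTail n) (z ^ n / (1 - z)) z := by
  have h1 : (1 : ℝ) - z ≠ 0 := by linarith
  have hs : HasDerivAt (fun z : ℝ => ∑ i ∈ Finset.range n, z ^ (i + 1) / ((i : ℝ) + 1))
      (∑ i ∈ Finset.range n, z ^ i) z := by
    refine HasDerivAt.fun_sum fun i _ => ?_
    refine ((hasDerivAt_pow (i + 1) z).div_const _).congr_deriv ?_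
    have : (i : ℝ) + 1 ≠ 0 := by positivity
    push_cast
    field_simp
  refine ((((hasDerivAt_id z).const_sub 1).log h1).neg.sub hs).congr_deriv ?_
  have h2 : ∑ i ∈ Finset.range n, z ^ i = (1 - z ^ n) / (1 - z) := by
    rw [eq_div_iff h1, geom_sum_mul_neg]
  rw [h2, id]
  field_simp
  ring

lemma monotoneOn_logTail (n : ℕ) : MonotoneOn (logTail n) (Ico 0 1) := fun x hx y hy hxy => by
  have hd : ∀ z, z ≤ y → HasDerivAt (logTail n) (z ^ n / (1 - z)) z := fun z hz =>
    hasDerivAt_logTail n (hz.trans_lt hy.2)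
  refine monotoneOn_Icc_of_hasDerivAt (a := 0) (b := y)
    (fun z hz => (hd z hz.2).continuousAt.continuousWithinAt) (fun z _ hz => hd z hz.le)
    (fun z hz hzy => ?_) ⟨hx.1, hxy⟩ ⟨hy.1, le_rfl⟩ hxy
  have : 0 ≤ 1 - z := by linarith [hy.2]
  positivity

lemma one_sub_le_dhConst_mul_sig_of_tangent {κ y : ℝ} (hκ : 0 < κ) {n : ℕ} {c₀ c₁ : ℝ}
    (hc₀ : 0 ≤ c₀) (hc₁ : 0 ≤ c₁) (hy : n + y ≤ κ)
    (h : ∀ z, 0 < z → z < 1 → z ^ y ≤ c₀ + c₁ * z) {w Z : ℝ} (hw : 2 ≤ w) (hZ : 1 - 2 / w ≤ Z)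
    (hZ1 : Z < 1) :
    1 - κ * (c₀ * logTail n Z + c₁ * logTail (n + 1) Z) ≤
      dhConst κ * (w ^ (-κ) * sig κ w) := by
  have h2 : 2 / w ≤ 1 := (div_le_one (by linarith)).2 hw
  have h3 : 0 < 2 / w := by positivity
  refine le_trans ?_ (one_sub_le_dhConst_mul_sig hκ
    (G := fun z => c₀ * logTail n z + c₁ * logTail (n + 1) z)
    (G' := fun z => c₀ * (z ^ n / (1 - z)) + c₁ * (z ^ (n + 1) / (1 - z))) (by simp)
    (fun z _ hz => ((hasDerivAt_logTail n hz).const_mul c₀).add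
      ((hasDerivAt_logTail (n + 1) hz).const_mul c₁)) (fun z h0 h1 => ?_) hw)
  · have hm : ∀ m, logTail m (1 - 2 / w) ≤ logTail m Z := fun m =>
      monotoneOn_logTail m ⟨by linarith, by linarith⟩ ⟨by linarith, hZ1⟩ hZ
    have := hm n
    have := hm (n + 1)
    gcongr
  · have h4 : (1 : ℝ) - z ≠ 0 := by linarith
    calc z ^ κ ≤ z ^ ((n : ℝ) + y) := Real.rpow_le_rpow_of_exponent_ge h0 h1.le hy
      _ = z ^ n * z ^ y := by rw [Real.rpow_add h0, Real.rpow_natCast]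
      _ ≤ z ^ n * (c₀ + c₁ * z) := by
        have := h z h0 h1
        gcongr
      _ = _ := by
        field_simp
        ring

/-- A tangent line of `x ↦ x log (1 + s x)` lies below the graph. -/
lemma mul_log_tangent_le {s m x : ℝ} (hs : 0 ≤ s) (hm : 0 ≤ m) (hx : 0 ≤ x) :
    x * Real.log (1 + s * m) + s * m / (1 + s * m) * (x - m) ≤ x * Real.log (1 + s * x) := by
  have h1 : 0 < 1 + s * m := by positivity
  have h2 : 0 < 1 + s * x := by positivity
  have h3 := Real.log_le_sub_one_of_pos (div_pos h1 h2)
  rw [Real.log_div h1.ne' h2.ne'] at h3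
  have h4 := mul_le_mul_of_nonneg_left h3 hx
  have h5 : x * ((1 + s * m) / (1 + s * x) - 1) + s * m / (1 + s * m) * (x - m) =
      -(s * (x - m) ^ 2 / ((1 + s * x) * (1 + s * m))) := by
    field_simp
    ring
  have h6 : 0 ≤ s * (x - m) ^ 2 / ((1 + s * x) * (1 + s * m)) := by positivity
  linarith

lemma one_sub_le_of_mem_Icc {κ x a b : ℝ} (hκ : κ = 1 + x) (hax : a ≤ x) (hxb : x ≤ b)
    (c ρ k : ℝ) (n p d M₁ N₁ : ℕ)
    (H : 0 < a ∧ 0 < ρ ∧ 0 < d ∧ p ≤ d ∧ 0 < c ∧ ρ ^ p ≤ c ^ d ∧ n + (p : ℝ) / d ≤ 1 + a ∧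
      0 < N₁ ∧ (1 + 23 / 20 * b) ^ N₁ ≤ 2 ^ M₁ ∧
      (1 + b) * (c * (1 - (p : ℝ) / d) * (M₁ / N₁ * (693148 / 1000000) -
          ∑ i ∈ Finset.range n, (1 - 20 / (20 + 23 * b)) ^ (i + 1) / ((i : ℝ) + 1)) +
        c * ((p : ℝ) / d / ρ) * (M₁ / N₁ * (693148 / 1000000) -
          ∑ i ∈ Finset.range (n + 1), (1 - 20 / (20 + 23 * b)) ^ (i + 1) / ((i : ℝ) + 1))) ≤ k) :
    1 - k ≤ dhConst κ * ((2 + 23 / 10 * x) ^ (-κ) * sig κ (2 + 23 / 10 * x)) := by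
  obtain ⟨ha, hρ, hd, hpd, hc, hρc, hy, hN₁, hL, hk⟩ := H
  have hx : 0 < x := ha.trans_le hax
  have hb : 0 < b := hx.trans_le hxb
  have hl2 := Real.log_two_lt_d9
  have hpd' : (p : ℝ) / d ≤ 1 :=
    div_le_one_of_le₀ (by exact_mod_cast hpd) (Nat.cast_nonneg d)
  have hup : ∀ q : ℝ, 0 ≤ q → q * Real.log 2 ≤ q * (693148 / 1000000) := fun q hq =>
    mul_le_mul_of_nonneg_left (by linarith) hq
  set Z := 1 - 20 / (20 + 23 * b) with hZ
  have hZ' : 1 - Z = (1 + 23 / 20 * b)⁻¹ := by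
    rw [hZ]
    field_simp
    ring
  have hZ1 : Z < 1 := by
    have : 0 < 1 - Z := by rw [hZ']; positivity
    linarith
  have hlog : -Real.log (1 - Z) ≤ M₁ / N₁ * (693148 / 1000000) := by
    rw [hZ', Real.log_inv, neg_neg]
    have := log_le_of_pow_le (q := 1 + 23 / 20 * b) (M := M₁) (K := 0) (by positivity) hN₁
      (by simpa using hL)
    simp only [Nat.cast_zero, sub_zero] at this
    exact this.trans (hup _ (by positivity))
  have hw0 : 0 < 2 + 23 / 10 * x := by positivity
  have hs := one_sub_le_dhConst_mul_sig_of_tangent (κ := κ) (y := (p : ℝ) / d) (n := n)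
    (c₀ := c * (1 - (p : ℝ) / d)) (c₁ := c * ((p : ℝ) / d / ρ)) (by linarith)
    (mul_nonneg hc.le (by linarith)) (by positivity) (by linarith)
    (fun z hz _ => (rpow_le_tangent hz.le hρ hd hpd hc.le hρc).trans_eq (by ring))
    (w := 2 + 23 / 10 * x) (by linarith) (Z := Z) (by
      rw [hZ]
      have : 20 / (20 + 23 * b) ≤ 2 / (2 + 23 / 10 * x) := by
        rw [div_le_div_iff₀ (by positivity) hw0]
        linarith
      linarith) hZ1
  refine le_trans ?_ hs
  have hZ0 : 0 ≤ Z := by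
    have : 20 / (20 + 23 * b) ≤ 1 := div_le_one_of_le₀ (by linarith) (by positivity)
    linarith
  have hT : ∀ j, 0 ≤ logTail j Z := fun j => by
    simpa using monotoneOn_logTail j ⟨le_rfl, one_pos⟩ ⟨hZ0, hZ1⟩ hZ0
  have hT' : ∀ j, logTail j Z ≤ M₁ / N₁ * (693148 / 1000000) -
      ∑ i ∈ Finset.range j, Z ^ (i + 1) / (i + 1) := fun j => by
    rw [logTail]
    linarith
  have hp0 : 0 ≤ c * (1 - (p : ℝ) / d) := mul_nonneg hc.le (by linarith)
  have hT0 := hT n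
  have hT1 := hT (n + 1)
  have : κ * (c * (1 - (p : ℝ) / d) * logTail n Z +
      c * ((p : ℝ) / d / ρ) * logTail (n + 1) Z) ≤ k := by
    refine le_trans ?_ hk
    refine mul_le_mul (by linarith) ?_ (by positivity) (by linarith)
    exact add_le_add (mul_le_mul_of_nonneg_left (hT' n) hp0)
      (mul_le_mul_of_nonneg_left (hT' (n + 1)) (by positivity))
  linarith

lemma one_sub_le_of_le_one_twelfth {κ x : ℝ} (hκ : κ = 1 + x) (h0 : 0 < x) (h1 : x ≤ 1 / 12) :
    1 - 3 / 4 * x ^ 2 ≤ dhConst κ * ((2 + 23 / 10 * x) ^ (-κ) * sig κ (2 + 23 / 10 * x)) := by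
  have hs := one_sub_le_dhConst_mul_sig_of_tangent (κ := κ) (y := 0) (n := 1) (c₀ := 1)
    (c₁ := 0) (w := 2 + 23 / 10 * x) (by linarith) one_pos.le le_rfl (by norm_num; linarith)
    (by simp) (by linarith) le_rfl (by linarith [show 0 < 2 / (2 + 23 / 10 * x) by positivity])
  set t := 23 / 20 * x with ht
  have ht0 : 0 < t := by positivity
  have hk : κ * (1 * logTail 1 (1 - 2 / (2 + 23 / 10 * x)) +
      0 * logTail (1 + 1) (1 - 2 / (2 + 23 / 10 * x))) ≤ 3 / 4 * x ^ 2 := by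
    have e : 2 / (2 + 23 / 10 * x) = (1 + t)⁻¹ := by
      rw [ht]
      field_simp
      ring
    have h2 := log_le_of_one_le (y := 1 + t) (by linarith)
    have h3 : logTail 1 (1 - 2 / (2 + 23 / 10 * x)) ≤ t ^ 2 / 2 := by
      rw [logTail, e, sub_sub_cancel, Real.log_inv]
      simp only [Finset.sum_range_one]
      have h4 : (1 + t - 1 / (1 + t)) / 2 - (1 - (1 + t)⁻¹) = t ^ 2 / (2 * (1 + t)) := by
        field_simp
        ring
      have h5 : t ^ 2 / (2 * (1 + t)) ≤ t ^ 2 / 2 := by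
        gcongr
        linarith
      norm_num
      linarith
    have h4 := mul_le_mul (show κ ≤ 13 / 12 by linarith) h3 (by
      simpa using monotoneOn_logTail 1 ⟨le_rfl, one_pos⟩ (b := 1 - 2 / (2 + 23 / 10 * x))
        ⟨by rw [e, sub_nonneg]; exact inv_le_one_of_one_le₀ (by linarith), by
          rw [e]; linarith [show 0 < (1 + t)⁻¹ by positivity]⟩
        (by rw [e, sub_nonneg]; exact inv_le_one_of_one_le₀ (by linarith))) (by norm_num)
    rw [one_mul, zero_mul, add_zero]
    refine h4.trans ?_
    rw [ht]
    nlinarith [sq_nonneg x]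
  linarith

lemma logWeight_le_chord {p q x v w : ℝ} (hp : 0 ≤ p) (hpx : p ≤ x) (hxq : x ≤ q) (hpq : p < q)
    (hv : logWeight p ≤ Real.log 2 + v) (hw : logWeight q ≤ Real.log 2 + w) :
    logWeight x ≤ Real.log 2 + (v - (w - v) / (q - p) * p + (w - v) / (q - p) * x) := by
  have hqp : 0 < q - p := by linarith
  have h := convexOn_logWeight.2 (mem_Ici.2 hp) (mem_Ici.2 (hp.trans hpq.le))
    (div_nonneg (by linarith : 0 ≤ q - x) hqp.le)
    (div_nonneg (by linarith : 0 ≤ x - p) hqp.le) (by field_simp; ring)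
  simp only [smul_eq_mul] at h
  rw [show (q - x) / (q - p) * p + (x - p) / (q - p) * q = x by field_simp; ring] at h
  refine h.trans ((add_le_add
    (mul_le_mul_of_nonneg_left hv (div_nonneg (by linarith) hqp.le))
    (mul_le_mul_of_nonneg_left hw (div_nonneg (by linarith) hqp.le))).trans_eq ?_)
  field_simp
  ring

namespace SieveData

variable {κ α β x : ℝ} {F f : ℝ → ℝ}

lemma beta_le_of_logWeight (h : SieveData κ F f α β) (hab : α ≤ β) (hκ : κ = 1 + x) (hx : 0 < x)
    {k : ℝ} (hk : k < 1)
    (hs : 1 - k ≤ dhConst κ * ((2 + 23 / 10 * x) ^ (-κ) * sig κ (2 + 23 / 10 * x)))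
    (hl : logWeight x - x * Real.log (1 + 23 / 10 * x) - Real.log (1 - k) < Real.log 2) :
    β ≤ 2 + 23 / 10 * x := by
  have hk' : 0 < 1 - k := by linarith
  have hA := dhConst_pos (by linarith : 0 < κ)
  have hL := Lap_pos (-κ) (y := 1 + 23 / 10 * x) (by positivity)
  have hb : 0 < 1 + 23 / 10 * x := by positivity
  refine h.beta_le_of_Lap_lt (by linarith) hab (by linarith) (R := (1 - k)⁻¹) ?_ ?_
  · rw [inv_mul_eq_div, one_le_div hk']
    exact hs
  · rw [show 2 + 23 / 10 * x - 1 = 1 + 23 / 10 * x by ring]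
    rw [← Real.log_lt_log_iff (by positivity) two_pos, Real.log_mul (by positivity)
      (by positivity), Real.log_mul hA.ne' (by positivity), Real.log_inv,
      Real.log_mul (by positivity) hL.ne', Real.log_rpow hb]
    rw [logWeight, ← hκ] at hl
    rw [show 1 - κ = -x by linarith]
    linarith

lemma beta_le_of_mem_Icc (h : SieveData κ F f α β) (hab : α ≤ β) (hκ : κ = 1 + x)
    {v e : ℝ} (hv : logWeight x ≤ Real.log 2 + (v + e * x))
    {a b : ℝ} (hax : a ≤ x) (hxb : x ≤ b) {k : ℝ} (m : ℝ) (M₂ N₂ M₃ N₃ : ℕ)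
    (hs : 1 - k ≤ dhConst κ * ((2 + 23 / 10 * x) ^ (-κ) * sig κ (2 + 23 / 10 * x)))
    (H : 0 < a ∧ k < 1 ∧ 0 < N₂ ∧ 1 ≤ (1 - k) ^ N₂ * 2 ^ M₂ ∧
      0 ≤ m ∧ 0 < N₃ ∧ 2 ^ M₃ ≤ (1 + 23 / 10 * m) ^ N₃ ∧
      v + e * a + M₂ / N₂ * (693148 / 1000000) < a * (M₃ / N₃ * (693147 / 1000000)) +
        23 / 10 * m / (1 + 23 / 10 * m) * (a - m) ∧
      v + e * b + M₂ / N₂ * (693148 / 1000000) < b * (M₃ / N₃ * (693147 / 1000000)) +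
        23 / 10 * m / (1 + 23 / 10 * m) * (b - m)) :
    β ≤ 2 + 23 / 10 * x := by
  obtain ⟨ha, hk1, hN₂, hR, hm, hN₃, hm', hea, heb⟩ := H
  have hx : 0 < x := ha.trans_le hax
  have hl2 := Real.log_two_lt_d9
  have hl2' := Real.log_two_gt_d9
  refine h.beta_le_of_logWeight hab hκ hx hk1 hs ?_
  have hl1 := le_log_of_le_pow (q := 1 - k) (M := 0) (K := M₂) (by linarith) hN₂ (by simpa using hR)
  have hl3 := le_log_of_le_pow (q := 1 + 23 / 10 * m) (K := 0) (by positivity) hN₃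
    (by simpa using hm')
  simp only [Nat.cast_zero, sub_zero, zero_sub, neg_div, neg_mul] at hl1 hl3
  have h1 : (M₂ : ℝ) / N₂ * Real.log 2 ≤ M₂ / N₂ * (693148 / 1000000) :=
    mul_le_mul_of_nonneg_left (by linarith) (by positivity)
  have h3 : (M₃ : ℝ) / N₃ * (693147 / 1000000) ≤ Real.log (1 + 23 / 10 * m) :=
    (mul_le_mul_of_nonneg_left (by linarith) (by positivity)).trans hl3
  have h4 := mul_log_tangent_le (s := 23 / 10) (by norm_num) hm hx.le
  have h5 := mul_le_mul_of_nonneg_left h3 hx.le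
  set D := 23 / 10 * m / (1 + 23 / 10 * m)
  set E := (M₃ : ℝ) / N₃ * (693147 / 1000000)
  set Q := (M₂ : ℝ) / N₂ * (693148 / 1000000)
  suffices hfin : v + e * x + Q < x * E + D * (x - m) by linarith
  rcases hax.eq_or_lt with rfl | hax
  · exact hea
  · have hab' : a < b := hax.trans_le hxb
    have e1 : (x - a) * (b * E + D * (b - m) - (v + e * b + Q)) ≥ 0 :=
      mul_nonneg (by linarith) (by linarith)
    rcases hxb.eq_or_lt with rfl | hxb
    · exact heb
    have e2 : (b - x) * (a * E + D * (a - m) - (v + e * a + Q)) > 0 :=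
      mul_pos (by linarith) (by linarith)
    have e3 : (b - a) * (x * E + D * (x - m) - (v + e * x + Q)) > 0 := by
      calc _ < _ := add_pos_of_nonneg_of_pos e1 e2
        _ = _ := by ring
    have := (mul_pos_iff_of_pos_left (by linarith : 0 < b - a)).1 e3
    linarith

lemma beta_le_of_le_one_twelfth (h : SieveData κ F f α β) (hab : α ≤ β) (hκ : κ = 1 + x)
    (h0 : 0 < x) (h1 : x ≤ 1 / 12) : β ≤ 2 + 23 / 10 * x := by
  have hW := logWeight_le_chord le_rfl h0.le h1 (by norm_num) (v := 0) (w := 0)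
    (by rw [logWeight_zero, add_zero]) (by simpa using logWeight_one_twelfth_le)
  refine h.beta_le_of_logWeight hab hκ h0 (k := 3 / 4 * x ^ 2) (by nlinarith)
    (one_sub_le_of_le_one_twelfth hκ h0 h1) ?_
  have h2 := Real.one_sub_inv_le_log_of_pos (show 0 < 1 - 3 / 4 * x ^ 2 by nlinarith)
  have h3 := Real.one_sub_inv_le_log_of_pos (show 0 < 1 + 23 / 10 * x by positivity)
  have h4 : (1 - 3 / 4 * x ^ 2)⁻¹ ≤ 1 + x ^ 2 := by
    rw [inv_le_comm₀ (by nlinarith) (by positivity), inv_le_iff_one_le_mul₀ (by positivity)]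
    nlinarith [sq_nonneg x, mul_nonneg (sq_nonneg x) (show 0 ≤ 1 / 4 - 3 / 4 * x ^ 2 by nlinarith)]
  have h5 : (1 + 23 / 10 * x)⁻¹ ≤ 1 - 19 / 10 * x := by
    rw [inv_le_iff_one_le_mul₀ (by positivity)]
    nlinarith
  have h6 := mul_le_mul_of_nonneg_left h3 h0.le
  nlinarith

lemma beta_le_of_mem_one_twelfth_one_quarter (h : SieveData κ F f α β) (hab : α ≤ β)
    (hκ : κ = 1 + x) (h0 : 1 / 12 ≤ x) (h1 : x ≤ 1 / 4) : β ≤ 2 + 23 / 10 * x := by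
  have hv := logWeight_le_chord (by norm_num) h0 h1 (by norm_num)
    (v := 0) (by simpa using logWeight_one_twelfth_le) logWeight_one_quarter_le
  rcases le_total x (7 / 50) with g0 | g0
  · exact h.beta_le_of_mem_Icc hab hκ hv h0 g0 (11 / 100) 1 58 12 37 (one_sub_le_of_mem_Icc hκ h0 g0
      (1651 / 2000) (1 / 10) (11 / 1000) 1 1 12 8 37 (by norm_num [Finset.sum_range_succ]))
      (by norm_num)
  rcases le_total x (9 / 50) with g1 | g1
  · exact h.beta_le_of_mem_Icc hab hκ hv g0 g1 (4 / 25) 1 40 14 31 (one_sub_le_of_mem_Icc hκ g0 g1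
      (2943 / 4000) (1 / 10) (33 / 2000) 1 2 15 3 11 (by norm_num [Finset.sum_range_succ]))
      (by norm_num)
  rcases le_total x (6 / 25) with g2 | g2
  · exact h.beta_le_of_mem_Icc hab hκ hv g1 g2 (21 / 100) 2 55 25 44 (one_sub_le_of_mem_Icc hκ g1 g2
      (1431 / 2000) (3 / 20) (99 / 4000) 1 3 17 19 54 (by norm_num [Finset.sum_range_succ]))
      (by norm_num)
  exact h.beta_le_of_mem_Icc hab hκ hv g2 h1 (6 / 25) 1 21 12 19 (one_sub_le_of_mem_Icc hκ g2 h1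
    (16 / 25) (3 / 20) (23 / 800) 1 4 17 7 19 (by norm_num [Finset.sum_range_succ])) (by norm_num)

lemma beta_le_of_mem_one_quarter_one_half (h : SieveData κ F f α β) (hab : α ≤ β)
    (hκ : κ = 1 + x) (h0 : 1 / 4 ≤ x) (h1 : x ≤ 1 / 2) : β ≤ 2 + 23 / 10 * x := by
  have hv := logWeight_le_chord (by norm_num) h0 h1 (by norm_num)
    logWeight_one_quarter_le logWeight_one_half_le
  rcases le_total x (7 / 20) with g0 | g0
  · exact h.beta_le_of_mem_Icc hab hκ hv h0 g0 (3 / 10) 1 14 28 37 (one_sub_le_of_mem_Icc hκ h0 g0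
      (107 / 160) (1 / 5) (187 / 4000) 1 1 4 21 43 (by norm_num [Finset.sum_range_succ]))
      (by norm_num)
  rcases le_total x (43 / 100) with g1 | g1
  · exact h.beta_le_of_mem_Icc hab hκ hv g0 g1 (39 / 100) 1 11 12 13 (one_sub_le_of_mem_Icc hκ g0 g1
      (2463 / 4000) (1 / 4) (61 / 1000) 1 7 20 29 50 (by norm_num [Finset.sum_range_succ]))
      (by norm_num)
  exact h.beta_le_of_mem_Icc hab hκ hv g1 h1 (23 / 50) 2 17 26 25 (one_sub_le_of_mem_Icc hκ g1 h1
    (2209 / 4000) (1 / 4) (151 / 2000) 1 3 7 21 32 (by norm_num [Finset.sum_range_succ]))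
    (by norm_num)

lemma beta_le_of_mem_one_half_one (h : SieveData κ F f α β) (hab : α ≤ β)
    (hκ : κ = 1 + x) (h0 : 1 / 2 ≤ x) (h1 : x ≤ 1) : β ≤ 2 + 23 / 10 * x := by
  have hv := logWeight_le_chord (by norm_num) h0 h1 (by norm_num)
    logWeight_one_half_le logWeight_one_le
  rcases le_total x (31 / 50) with g0 | g0
  · exact h.beta_le_of_mem_Icc hab hκ hv h0 g0 (14 / 25) 1 6 25 21 (one_sub_le_of_mem_Icc hκ h0 g0
      (2191 / 4000) (3 / 10) (433 / 4000) 1 1 2 7 9 (by norm_num [Finset.sum_range_succ]))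
      (by norm_num)
  rcases le_total x (7 / 10) with g1 | g1
  · exact h.beta_le_of_mem_Icc hab hκ hv g0 g1 (33 / 50) 8 43 253 190
      (one_sub_le_of_mem_Icc hκ g0 g1
      (1907 / 4000) (3 / 10) (483 / 4000) 1 8 13 52 61 (by norm_num [Finset.sum_range_succ]))
      (by norm_num)
  rcases le_total x (77 / 100) with g2 | g2
  · exact h.beta_le_of_mem_Icc hab hκ hv g1 g2 (37 / 50) 3 14 43 30 (one_sub_le_of_mem_Icc hκ g1 g2
      (1919 / 4000) (7 / 20) (273 / 2000) 1 7 10 11 12 (by norm_num [Finset.sum_range_succ]))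
      (by norm_num)
  rcases le_total x (17 / 20) with g3 | g3
  · exact h.beta_le_of_mem_Icc hab hκ hv g2 g3 (81 / 100) 8 33 44 29 (one_sub_le_of_mem_Icc hκ g2 g3
      (223 / 500) (7 / 20) (309 / 2000) 1 10 13 61 62 (by norm_num [Finset.sum_range_succ]))
      (by norm_num)
  rcases le_total x (19 / 20) with g4 | g4
  · exact h.beta_le_of_mem_Icc hab hκ hv g3 g4 (9 / 10) 12 41 55 34 (one_sub_le_of_mem_Icc hκ g3 g4
      (1639 / 4000) (7 / 20) (733 / 4000) 1 17 20 16 15 (by norm_num [Finset.sum_range_succ]))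
      (by norm_num)
  exact h.beta_le_of_mem_Icc hab hκ hv g4 h1 (49 / 50) 3 10 17 10 (one_sub_le_of_mem_Icc hκ g4 h1
    (419 / 1000) (2 / 5) (741 / 4000) 1 19 20 21 19 (by norm_num [Finset.sum_range_succ]))
    (by norm_num)

lemma beta_le_of_mem_one_two (h : SieveData κ F f α β) (hab : α ≤ β)
    (hκ : κ = 1 + x) (h0 : 1 ≤ x) (h1 : x ≤ 2) : β ≤ 2 + 23 / 10 * x := by
  have hv := logWeight_le_chord (by norm_num) h0 h1 (by norm_num)
    logWeight_one_le logWeight_two_le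
  rcases le_total x (23 / 20) with g0 | g0
  · exact h.beta_le_of_mem_Icc hab hκ hv h0 g0 (27 / 25) 2 5 9 5 (one_sub_le_of_mem_Icc hκ h0 g0
      1 1 (483 / 2000) 2 0 1 28 23 (by norm_num [Finset.sum_range_succ])) (by norm_num)
  rcases le_total x (31 / 25) with g1 | g1
  · exact h.beta_le_of_mem_Icc hab hκ hv g0 g1 (6 / 5) 11 26 21 11 (one_sub_le_of_mem_Icc hκ g0 g1
      (3549 / 4000) (9 / 20) (1013 / 4000) 2 3 20 32 25 (by norm_num [Finset.sum_range_succ]))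
      (by norm_num)
  rcases le_total x (131 / 100) with g2 | g2
  · exact h.beta_le_of_mem_Icc hab hκ hv g1 g2 (32 / 25) 13 29 91 46 (one_sub_le_of_mem_Icc hκ g1 g2
      (663 / 800) (9 / 20) (1067 / 4000) 2 4 17 61 46 (by norm_num [Finset.sum_range_succ]))
      (by norm_num)
  rcases le_total x (137 / 100) with g3 | g3
  · exact h.beta_le_of_mem_Icc hab hκ hv g2 g3 (67 / 50) 9 19 71 35 (one_sub_le_of_mem_Icc hκ g2 g3
      (101 / 125) (1 / 2) (1119 / 4000) 2 4 13 71 52 (by norm_num [Finset.sum_range_succ]))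
      (by norm_num)
  rcases le_total x (71 / 50) with g4 | g4
  · exact h.beta_le_of_mem_Icc hab hκ hv g3 g4 (7 / 5) 39 79 27 13 (one_sub_le_of_mem_Icc hκ g3 g4
      (3099 / 4000) (1 / 2) (1159 / 4000) 2 7 19 88 63 (by norm_num [Finset.sum_range_succ]))
      (by norm_num)
  rcases le_total x (147 / 100) with g5 | g5
  · exact h.beta_le_of_mem_Icc hab hκ hv g4 g5 (36 / 25) 23 44 59 28 (one_sub_le_of_mem_Icc hκ g4 g5
      (2997 / 4000) (1 / 2) (243 / 800) 2 5 12 10 7 (by norm_num [Finset.sum_range_succ]))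
      (by norm_num)
  rcases le_total x (38 / 25) with g6 | g6
  · exact h.beta_le_of_mem_Icc hab hκ hv g5 g6 (3 / 2) 28 51 239 111 (one_sub_le_of_mem_Icc hκ g5 g6
      (579 / 800) (1 / 2) (633 / 2000) 2 7 15 89 61 (by norm_num [Finset.sum_range_succ]))
      (by norm_num)
  rcases le_total x (39 / 25) with g7 | g7
  · exact h.beta_le_of_mem_Icc hab hκ hv g6 g7 (77 / 50) 19 33 24 11 (one_sub_le_of_mem_Icc hκ g6 g7
      (2829 / 4000) (1 / 2) (41 / 125) 2 1 2 43 29 (by norm_num [Finset.sum_range_succ]))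
      (by norm_num)
  rcases le_total x (161 / 100) with g8 | g8
  · exact h.beta_le_of_mem_Icc hab hκ hv g7 g8 (79 / 50) 50 83 73 33 (one_sub_le_of_mem_Icc hκ g7 g8
      (1361 / 2000) (1 / 2) (1363 / 4000) 2 5 9 59 39 (by norm_num [Finset.sum_range_succ]))
      (by norm_num)
  rcases le_total x (83 / 50) with g9 | g9
  · exact h.beta_le_of_mem_Icc hab hκ hv g8 g9 (41 / 25) 19 30 124 55
      (one_sub_le_of_mem_Icc hκ g8 g9
      (33 / 50) (1 / 2) (1421 / 4000) 2 3 5 37 24 (by norm_num [Finset.sum_range_succ]))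
      (by norm_num)
  rcases le_total x (43 / 25) with g10 | g10
  · exact h.beta_le_of_mem_Icc hab hκ hv g9 g10 (169 / 100) 117 175 103 45
      (one_sub_le_of_mem_Icc hκ g9 g10
      (2713 / 4000) (11 / 20) (1483 / 4000) 2 13 20 74 47 (by norm_num [Finset.sum_range_succ]))
      (by norm_num)
  rcases le_total x (89 / 50) with g11 | g11
  · exact h.beta_le_of_mem_Icc hab hκ hv g10 g11 (7 / 4) 17 24 114 49
      (one_sub_le_of_mem_Icc hκ g10 g11
      (261 / 400) (11 / 20) (31 / 80) 2 5 7 37 23 (by norm_num [Finset.sum_range_succ]))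
      (by norm_num)
  rcases le_total x (37 / 20) with g12 | g12
  · exact h.beta_le_of_mem_Icc hab hκ hv g11 g12 (91 / 50) 89 119 178 75
      (one_sub_le_of_mem_Icc hκ g11 g12
      (2513 / 4000) (11 / 20) (809 / 2000) 2 7 9 51 31 (by norm_num [Finset.sum_range_succ]))
      (by norm_num)
  rcases le_total x (97 / 50) with g13 | g13
  · exact h.beta_le_of_mem_Icc hab hκ hv g12 g13 (19 / 10) 58 71 80 33
      (one_sub_le_of_mem_Icc hκ g12 g13
      (2407 / 4000) (11 / 20) (1729 / 4000) 2 17 20 22 13 (by norm_num [Finset.sum_range_succ]))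
      (by norm_num)
  exact h.beta_le_of_mem_Icc hab hκ hv g13 h1 (197 / 100) 13 15 37 15
    (one_sub_le_of_mem_Icc hκ g13 h1
    (571 / 1000) (11 / 20) (1799 / 4000) 2 15 16 19 11 (by norm_num [Finset.sum_range_succ]))
    (by norm_num)

set_option exponentiation.threshold 1000 in
lemma beta_le_of_mem_two_thirteen_fifths (h : SieveData κ F f α β) (hab : α ≤ β)
    (hκ : κ = 1 + x) (h0 : 2 ≤ x) (h1 : x ≤ 13 / 5) : β ≤ 2 + 23 / 10 * x := by
  have hv := logWeight_le_chord (by norm_num) h0 h1 (by norm_num)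
    logWeight_two_le logWeight_thirteen_fifths_le
  rcases le_total x (211 / 100) with g0 | g0
  · exact h.beta_le_of_mem_Icc hab hκ hv h0 g0 (103 / 50) 19 20 63 25
      (one_sub_le_of_mem_Icc hκ h0 g0
      1 1 (1929 / 4000) 3 0 1 16 9 (by norm_num [Finset.sum_range_succ])) (by norm_num)
  rcases le_total x (11 / 5) with g1 | g1
  · exact h.beta_le_of_mem_Icc hab hκ hv g0 g1 (54 / 25) 199 198 67 26
      (one_sub_le_of_mem_Icc hκ g0 g1
      (3791 / 4000) (3 / 5) (1003 / 2000) 3 2 19 91 50 (by norm_num [Finset.sum_range_succ]))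
      (by norm_num)
  rcases le_total x (227 / 100) with g2 | g2
  · exact h.beta_le_of_mem_Icc hab hκ hv g1 g2 (56 / 25) 23 22 55 21 (one_sub_le_of_mem_Icc hκ g1 g2
      (903 / 1000) (3 / 5) (103 / 200) 3 1 5 63 34 (by norm_num [Finset.sum_range_succ]))
      (by norm_num)
  rcases le_total x (233 / 100) with g3 | g3
  · exact h.beta_le_of_mem_Icc hab hκ hv g2 g3 (23 / 10) 25 23 61 23 (one_sub_le_of_mem_Icc hκ g2 g3
      (3491 / 4000) (3 / 5) (529 / 1000) 3 4 15 47 25 (by norm_num [Finset.sum_range_succ]))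
      (by norm_num)
  rcases le_total x (119 / 50) with g4 | g4
  · exact h.beta_le_of_mem_Icc hab hκ hv g3 g4 (59 / 25) 35 31 51 19 (one_sub_le_of_mem_Icc hκ g3 g4
      (681 / 800) (3 / 5) (2171 / 4000) 3 6 19 78 41 (by norm_num [Finset.sum_range_succ]))
      (by norm_num)
  rcases le_total x (243 / 100) with g5 | g5
  · exact h.beta_le_of_mem_Icc hab hκ hv g4 g5 (12 / 5) 101 87 284 105
      (one_sub_le_of_mem_Icc hκ g4 g5
      (3303 / 4000) (3 / 5) (2211 / 4000) 3 3 8 152 79 (by norm_num [Finset.sum_range_succ]))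
      (by norm_num)
  rcases le_total x (247 / 100) with g6 | g6
  · exact h.beta_le_of_mem_Icc hab hκ hv g5 g6 (49 / 20) 31 26 101 37
      (one_sub_le_of_mem_Icc hκ g5 g6
      (1607 / 2000) (3 / 5) (281 / 500) 3 3 7 101 52 (by norm_num [Finset.sum_range_succ]))
      (by norm_num)
  rcases le_total x (5 / 2) with g7 | g7
  · exact h.beta_le_of_mem_Icc hab hκ hv g6 g7 (62 / 25) 23 19 74 27 (one_sub_le_of_mem_Icc hκ g6 g7
      (197 / 250) (3 / 5) (453 / 800) 3 7 15 43 22 (by norm_num [Finset.sum_range_succ]))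
      (by norm_num)
  rcases le_total x (253 / 100) with g8 | g8
  · exact h.beta_le_of_mem_Icc hab hκ hv g7 g8 (63 / 25) 21 17 58 21 (one_sub_le_of_mem_Icc hκ g7 g8
      (129 / 160) (13 / 20) (2297 / 4000) 3 1 2 61 31 (by norm_num [Finset.sum_range_succ]))
      (by norm_num)
  rcases le_total x (64 / 25) with g9 | g9
  · exact h.beta_le_of_mem_Icc hab hκ hv g8 g9 (127 / 50) 39 31 61 22
      (one_sub_le_of_mem_Icc hκ g8 g9
      (637 / 800) (13 / 20) (93 / 160) 3 9 17 99 50 (by norm_num [Finset.sum_range_succ]))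
      (by norm_num)
  rcases le_total x (259 / 100) with g10 | g10
  · exact h.beta_le_of_mem_Icc hab hκ hv g9 g10 (129 / 50) 9 7 81 29
      (one_sub_le_of_mem_Icc hκ g9 g10
      (3149 / 4000) (13 / 20) (1179 / 2000) 3 5 9 257 129 (by norm_num [Finset.sum_range_succ]))
      (by norm_num)
  exact h.beta_le_of_mem_Icc hab hκ hv g10 h1 (13 / 5) 14 11 185 66 (one_sub_le_of_mem_Icc hκ g10 h1
    (621 / 800) (13 / 20) (2343 / 4000) 3 10 17 553 277 (by norm_num [Finset.sum_range_succ]))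
    (by norm_num)

end SieveData

namespace SieveData

variable {κ α β x : ℝ} {F f : ℝ → ℝ}

lemma hR_of_one_sub_le {k B : ℝ} (hk : k < 1) (hs : 1 - k ≤ B) : 1 ≤ (1 - k)⁻¹ * B := by
  rwa [inv_mul_eq_div, one_le_div (by linarith)]

lemma false_of_rational (h : SieveData κ F f α β) (hab : α ≤ β) (hκ : κ = 1 + x) (hx : 0 < x)
    (hβ : β ≤ 2 + 23 / 10 * x) {k A E K : ℝ} (hk : k < 1)
    (hs : 1 - k ≤ dhConst κ * ((2 + 23 / 10 * x) ^ (-κ) * sig κ (2 + 23 / 10 * x)))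
    (hE : 0 ≤ E) (hK : 0 < K) (hEK : E ≤ K ^ 2) (hH : 0 ≤ 1 - A + E / (K + 1))
    (hN : (1 - k) * (-A + E / K) + k * (1 - A + E / (K + 1)) < 0)
    (hL : ∀ s, 0 ≤ s → 0 ≤ 2 * x * s - 13 / 10 * x - (1 + 2 * x) * A +
      E * (x / (s + K) + (1 + x) / (s + K + 1) + (1 + 23 / 10 * x + s) / (s + K) ^ 2)) :
    False := by
  have hmono : ∀ s, 1 ≤ s → 0 ≤ s - A + E / (s + K) := fun s hs => by
    have e : s - A + E / (s + K) - (1 - A + E / (K + 1)) =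
        (s - 1) * (1 - E / ((s + K) * (K + 1))) := by
      field_simp
      ring
    have : E / ((s + K) * (K + 1)) ≤ 1 := div_le_one_of_le₀ (by nlinarith) (by positivity)
    nlinarith
  refine h.false_of_supersolution_of_neg (by linarith) hab (w := 2 + 23 / 10 * x)
    (R := (1 - k)⁻¹) (H := fun s => s - A + E / (max s 0 + K))
    (H' := fun s => 1 - E / (s + K) ^ 2) (K := 1 + |A| + E / K) hβ
    (hR_of_one_sub_le hk hs) ?_ (fun s hs => ?_) (fun s hs => ?_) (fun s hs => ?_)
    (fun s hs => ?_) (fun s hs => ?_) ?_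
  · refine (continuous_id.sub continuous_const).add
      (continuous_const.div ((continuous_id.max continuous_const).add continuous_const) fun s => ?_)
    have := le_max_right s 0
    change max s 0 + K ≠ 0
    linarith
  · have h0 : s + K ≠ 0 := by positivity
    refine ((((hasDerivAt_id s).sub_const A).add ((hasDerivAt_const s E).div
      ((hasDerivAt_id s).add_const K) h0)).congr_of_eventuallyEq ?_).congr_deriv ?_
    · filter_upwards [eventually_gt_nhds hs] with v hv
      simp [max_eq_left hv.le]
    · simp only [id]
      ring
  · rw [max_eq_left (by linarith)]
    exact hmono s hs
  · have : E / (s + K) ^ 2 ≤ 1 := div_le_one_of_le₀ (by nlinarith) (by positivity)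
    linarith
  · rw [max_eq_left (by linarith)]
    have h1 : E / (s + K) ≤ E / K := by
      gcongr
      linarith
    have h2 := neg_abs_le A
    have h3 : 0 ≤ E / K := by positivity
    have h4 : s + 1 ≤ (s + 1) ^ 3 := by nlinarith [sq_nonneg (s + 1)]
    have h5 := abs_nonneg A
    calc s - A + E / (s + K) ≤ (1 + |A| + E / K) * (s + 1) := by nlinarith
      _ ≤ _ := mul_le_mul_of_nonneg_left h4 (by positivity)
  · rw [max_eq_left hs.le, max_eq_left (by linarith)]
    have := hL s hs.le
    have e : (κ - 1) * (s - A + E / (s + K)) + κ * (s + 1 - A + E / (s + 1 + K)) -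
        (2 + 23 / 10 * x - 1 + s) * (1 - E / (s + K) ^ 2) =
        2 * x * s - 13 / 10 * x - (1 + 2 * x) * A +
      E * (x / (s + K) + (1 + x) / (s + K + 1) + (1 + 23 / 10 * x + s) / (s + K) ^ 2) := by
      rw [hκ, show s + 1 + K = s + K + 1 by ring]
      ring
    linarith
  · simp only [max_self, max_eq_left zero_le_one]
    have h1 : 0 < 1 - k := by linarith
    rw [show 0 - A + E / (0 + K) + ((1 - k)⁻¹ - 1) * (1 - A + E / (1 + K)) =
      ((1 - k) * (-A + E / K) + k * (1 - A + E / (K + 1))) / (1 - k) by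
        rw [add_comm 1 K]
        field_simp
        ring]
    exact div_neg_of_neg_of_pos hN h1

lemma false_of_quadratic (h : SieveData κ F f α β) (hab : α ≤ β) (hκ : κ = 1 + x)
    (hx : 1 / 2 ≤ x) (hβ : β ≤ 2 + 23 / 10 * x) {k : ℝ} (hk : k < 1)
    (hs : 1 - k ≤ dhConst κ * ((2 + 23 / 10 * x) ^ (-κ) * sig κ (2 + 23 / 10 * x)))
    {q : ℝ} (hq : 0 ≤ 23 / 10 + q) (hN : q + 23 / 10 * k < 0)
    (hL : 169 / 100 * x ≤ (1 + 2 * x) * q + 1 + x) : False := by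
  refine h.false_of_supersolution_of_neg (by linarith) hab (w := 2 + 23 / 10 * x)
    (R := (1 - k)⁻¹) (H := fun s => s ^ 2 + 13 / 10 * s + q)
    (H' := fun s => 2 * s + 13 / 10) (K := 1 + |q|) hβ
    (hR_of_one_sub_le hk hs) (by fun_prop) (fun s hs => ?_) (fun s hs => ?_) (fun s hs => ?_)
    (fun s hs => ?_) (fun s hs => ?_) ?_
  · refine (((hasDerivAt_pow 2 s).add ((hasDerivAt_id s).const_mul (13 / 10))).add_const
      q).congr_deriv ?_
    simp
  · nlinarith
  · linarith
  · have h1 := le_abs_self q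
    have h2 := abs_nonneg q
    have h3 : s ^ 2 + 13 / 10 * s ≤ (s + 1) ^ 3 := by nlinarith [sq_nonneg s]
    have h4 : 1 ≤ (s + 1) ^ 3 := one_le_pow₀ (by linarith)
    nlinarith
  · have h1 : 0 ≤ (2 * x - 1) * s ^ 2 := mul_nonneg (by linarith) (sq_nonneg s)
    rw [hκ]
    nlinarith
  · have h1 : 0 < 1 - k := by linarith
    norm_num
    rw [show q + ((1 - k)⁻¹ - 1) * (23 / 10 + q) = (q + 23 / 10 * k) / (1 - k) by
      field_simp
      ring]
    exact div_neg_of_neg_of_pos hN h1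

lemma false_of_square (h : SieveData κ F f α β) (hab : α ≤ β) (hκ : κ = 1 + x)
    (hx : 13 / 20 ≤ x) (hx1 : x ≤ 13 / 5) (hβ : β ≤ 2 + 23 / 10 * x) : False := by
  set t := 32 / 25 - x / 5 with ht
  have ht0 : 0 < t := by linarith
  refine h.false_of_supersolution (by linarith) hab (w := 2 + 23 / 10 * x)
    (H := fun s => (s + t) ^ 2) (H' := fun s => 2 * (s + t)) (K := 1) hβ
    (by fun_prop) (fun s hs => ?_) (fun s hs => sq_nonneg _) (fun s hs => by positivity)
    (fun s hs => ?_) (fun s hs => ?_) ?_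
  · refine (((hasDerivAt_id s).add_const t).pow 2).congr_deriv ?_
    simp
  · have : (s + t) ^ 2 ≤ (s + 2) ^ 2 := by
      have : t ≤ 2 := by linarith
      gcongr
    nlinarith [sq_nonneg (s + 2)]
  · have h1 : 0 < 2 * x - 1 := by linarith
    have h2 : ((2 * x - 1) * (s + t) - (3 / 2 * x - 7 / 25)) ^ 2 ≥ 0 := sq_nonneg _
    have h3 : (3 / 2 * x - 7 / 25) ^ 2 ≤ (1 + x) * (2 * x - 1) := by nlinarith
    have h4 : 0 ≤ (2 * x - 1) * ((κ - 1) * (s + t) ^ 2 + κ * (s + 1 + t) ^ 2 -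
        (2 + 23 / 10 * x + s) * (2 * (s + t))) := by
      rw [hκ]
      have e : (2 * x - 1) * ((1 + x - 1) * (s + t) ^ 2 + (1 + x) * (s + 1 + t) ^ 2 -
        (2 + 23 / 10 * x + s) * (2 * (s + t))) =
        ((2 * x - 1) * (s + t) - (3 / 2 * x - 7 / 25)) ^ 2 +
          ((1 + x) * (2 * x - 1) - (3 / 2 * x - 7 / 25) ^ 2) := by
        rw [ht]
        ring
      rw [e]
      linarith
    have := nonneg_of_mul_nonneg_right h4 h1
    linarith
  · have e : ∫ s in (0 : ℝ)..1, (s + t) ^ 2 = t ^ 2 + t + 1 / 3 := by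
      rw [intervalIntegral.integral_comp_add_right (fun s => s ^ 2) t, integral_pow]
      norm_num
      ring
    rw [e, hκ]
    simp only [zero_add]
    have h1 : 0 ≤ x - 13 / 20 := by linarith
    have h2 : 0 ≤ 13 / 5 - x := by linarith
    have h3 := mul_nonneg (mul_nonneg h1 h1) h2
    rw [ht]
    nlinarith

end SieveData

lemma nonneg_of_affine {a b x p q : ℝ} (hax : a ≤ x) (hxb : x ≤ b) (ha : 0 ≤ p + q * a)
    (hb : 0 ≤ p + q * b) : 0 ≤ p + q * x := by
  rcases le_total 0 q with hq | hq
  · nlinarith [mul_le_mul_of_nonneg_left hax hq]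
  · nlinarith [mul_le_mul_of_nonpos_left hxb hq]

namespace SieveData

variable {κ α β x : ℝ} {F f : ℝ → ℝ}

lemma false_of_quartic (h : SieveData κ F f α β) (hab : α ≤ β) (hκ : κ = 1 + x) (hx : 0 < x)
    {a b : ℝ} (hax : a ≤ x) (hxb : x ≤ b) (hβ : β ≤ 2 + 23 / 10 * x) {k A E K : ℝ} (hk : k < 1)
    (hs : 1 - k ≤ dhConst κ * ((2 + 23 / 10 * x) ^ (-κ) * sig κ (2 + 23 / 10 * x)))
    (hE : 0 ≤ E) (hK : 0 < K) (hEK : E ≤ K ^ 2) (hH : 0 ≤ 1 - A + E / (K + 1))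
    (hN : (1 - k) * (-A + E / K) + k * (1 - A + E / (K + 1)) < 0)
    (hLa : ∀ s, 0 ≤ s → 0 ≤ (2 * a * s - 13 / 10 * a - (1 + 2 * a) * A) *
      ((s + K) ^ 2 * (s + K + 1)) + E * (a * ((s + K) * (s + K + 1)) + (1 + a) * (s + K) ^ 2 +
        (1 + 23 / 10 * a + s) * (s + K + 1)))
    (hLb : ∀ s, 0 ≤ s → 0 ≤ (2 * b * s - 13 / 10 * b - (1 + 2 * b) * A) *
      ((s + K) ^ 2 * (s + K + 1)) + E * (b * ((s + K) * (s + K + 1)) + (1 + b) * (s + K) ^ 2 +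
        (1 + 23 / 10 * b + s) * (s + K + 1))) : False := by
  refine h.false_of_rational hab hκ hx hβ hk hs hE hK hEK hH hN fun s hs => ?_
  have hD : 0 < (s + K) ^ 2 * (s + K + 1) := by positivity
  have := nonneg_of_affine hax hxb
    (p := -A * ((s + K) ^ 2 * (s + K + 1)) + E * ((s + K) ^ 2 + (1 + s) * (s + K + 1)))
    (q := (2 * s - 13 / 10 - 2 * A) * ((s + K) ^ 2 * (s + K + 1)) +
      E * ((s + K) * (s + K + 1) + (s + K) ^ 2 + 23 / 10 * (s + K + 1)))
    (by linarith [hLa s hs]) (by linarith [hLb s hs])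
  refine (div_nonneg this hD.le).trans_eq ?_
  have h1 : s + K ≠ 0 := by positivity
  have h2 : s + K + 1 ≠ 0 := by positivity
  field_simp
  ring

lemma false_of_quartic_of_mul (h : SieveData κ F f α β) (hab : α ≤ β) (hκ : κ = 1 + x)
    (hx : 0 < x) {a b : ℝ} (hax : a ≤ x) (hxb : x ≤ b) (hβ : β ≤ 2 + 23 / 10 * x) {k A E K : ℝ}
    (hk : k < 1)
    (hs : 1 - k ≤ dhConst κ * ((2 + 23 / 10 * x) ^ (-κ) * sig κ (2 + 23 / 10 * x)))
    (hE : 0 ≤ E) (hK : 0 < K) (hEK : x * E ≤ K ^ 2) (hH : 0 ≤ 1 - x * (A - E / (K + 1)))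
    (hN : (1 - k) * (x * (-A + E / K)) + k * (1 - x * (A - E / (K + 1))) < 0)
    (hLa : ∀ s, 0 ≤ s → 0 ≤ (2 * s - 13 / 10 - (1 + 2 * a) * A) *
      ((s + K) ^ 2 * (s + K + 1)) + E * (a * ((s + K) * (s + K + 1)) + (1 + a) * (s + K) ^ 2 +
        (1 + 23 / 10 * a + s) * (s + K + 1)))
    (hLb : ∀ s, 0 ≤ s → 0 ≤ (2 * s - 13 / 10 - (1 + 2 * b) * A) *
      ((s + K) ^ 2 * (s + K + 1)) + E * (b * ((s + K) * (s + K + 1)) + (1 + b) * (s + K) ^ 2 +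
        (1 + 23 / 10 * b + s) * (s + K + 1))) : False := by
  have e : 1 - x * A + x * E / (K + 1) = 1 - x * (A - E / (K + 1)) := by ring
  refine h.false_of_rational hab hκ hx hβ hk hs (A := x * A) (mul_nonneg hx.le hE) hK hEK
    (by rwa [e]) (by rw [e]; convert hN using 3; ring) fun s hs => ?_
  have hD : 0 < (s + K) ^ 2 * (s + K + 1) := by positivity
  have := nonneg_of_affine hax hxb
    (p := (2 * s - 13 / 10 - A) * ((s + K) ^ 2 * (s + K + 1)) +
      E * ((s + K) ^ 2 + (1 + s) * (s + K + 1)))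
    (q := -2 * A * ((s + K) ^ 2 * (s + K + 1)) +
      E * ((s + K) * (s + K + 1) + (s + K) ^ 2 + 23 / 10 * (s + K + 1)))
    (by linarith [hLa s hs]) (by linarith [hLb s hs])
  refine (mul_nonneg hx.le (div_nonneg this hD.le)).trans_eq ?_
  have h1 : s + K ≠ 0 := by positivity
  have h2 : s + K + 1 ≠ 0 := by positivity
  field_simp
  ring

lemma false_of_mem_zero_three_twentyfifths (h : SieveData κ F f α β) (hab : α ≤ β) (hκ : κ = 1 + x)
    (h0 : 0 < x) (h1 : x ≤ 3 / 25) (hβ : β ≤ 2 + 23 / 10 * x) : False := by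
  rcases le_total x (3 / 100) with g0 | g0
  · exact h.false_of_quartic_of_mul hab hκ (by linarith) h0.le g0 hβ
      (A := 2119 / 200) (E := 2359 / 100) (K := 9 / 4)
      (by nlinarith) (one_sub_le_of_le_one_twelfth hκ (by linarith) (by linarith))
      (by norm_num) (by norm_num) (by nlinarith) (by nlinarith) (by nlinarith)
      (fun s hs => by
        nlinarith [mul_nonneg hs (sq_nonneg (s - 17 / 20)), sq_nonneg (s * (s - 17 / 20)),
          sq_nonneg (s - 17 / 20)])
      (fun s hs => by
        nlinarith [mul_nonneg hs (sq_nonneg (s - 11 / 10)), sq_nonneg (s * (s - 11 / 10)),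
          sq_nonneg (s - 11 / 10)])
  rcases le_total x (2 / 25) with g1 | g1
  · exact h.false_of_quartic_of_mul hab hκ (by linarith) g0 g1 hβ
      (A := 1777 / 200) (E := 496 / 25) (K := 9 / 4)
      (by nlinarith) (one_sub_le_of_le_one_twelfth hκ (by linarith) (by linarith))
      (by norm_num) (by norm_num) (by nlinarith) (by nlinarith) (by nlinarith)
      (fun s hs => by
        nlinarith [mul_nonneg hs (sq_nonneg (s - 11 / 20)), sq_nonneg (s * (s - 11 / 20)),
          sq_nonneg (s - 11 / 20)])
      (fun s hs => by
        nlinarith [mul_nonneg hs (sq_nonneg (s - 1)), sq_nonneg (s * (s - 1)),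
          sq_nonneg (s - 1)])
  exact h.false_of_quartic_of_mul hab hκ (by linarith) g1 h1 hβ
    (A := 999 / 100) (E := 109 / 4) (K := 11 / 4)
    (by norm_num)
    (one_sub_le_of_mem_Icc hκ g1 h1
      (8377 / 10000) (1 / 10) (19 / 2500) 1 1 13 14 75
      (by norm_num [Finset.sum_range_succ]))
    (by norm_num) (by norm_num) (by nlinarith) (by nlinarith) (by nlinarith)
    (fun s hs => by
      nlinarith [mul_nonneg hs (sq_nonneg (s - 13 / 20)), sq_nonneg (s * (s - 13 / 20)),
        sq_nonneg (s - 13 / 20)])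
    (fun s hs => by
      nlinarith [mul_nonneg hs (sq_nonneg (s - 21 / 20)), sq_nonneg (s * (s - 21 / 20)),
        sq_nonneg (s - 21 / 20)])

lemma false_of_mem_three_twentyfifths_one_half (h : SieveData κ F f α β) (hab : α ≤ β)
    (hκ : κ = 1 + x)
    (h0 : 3 / 25 ≤ x) (h1 : x ≤ 1 / 2) (hβ : β ≤ 2 + 23 / 10 * x) : False := by
  rcases le_total x (17 / 100) with g0 | g0
  · exact h.false_of_quartic hab hκ (by linarith) h0 g0 hβ
      (A := 6917 / 5000) (E := 20601 / 5000) (K := 3)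
      (by norm_num)
      (one_sub_le_of_mem_Icc hκ h0 g0
        (7627 / 10000) (1 / 10) (71 / 5000) 1 2 17 8 31
        (by norm_num [Finset.sum_range_succ]))
      (by norm_num) (by norm_num) (by norm_num) (by norm_num) (by norm_num)
      (fun s hs => by
        nlinarith [mul_nonneg hs (sq_nonneg (s - 6 / 5)), sq_nonneg (s * (s - 6 / 5)),
          sq_nonneg (s - 6 / 5)])
      (fun s hs => by
        nlinarith [mul_nonneg hs (sq_nonneg (s - 1 / 5)), sq_nonneg (s * (s - 1 / 5)),
          sq_nonneg (s - 1 / 5)])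
  rcases le_total x (23 / 100) with g1 | g1
  · exact h.false_of_quartic hab hκ (by linarith) g0 g1 hβ
      (A := 1183 / 500) (E := 18811 / 2000) (K := 4)
      (by norm_num)
      (one_sub_le_of_mem_Icc hκ g0 g1
        (14579 / 20000) (3 / 20) (471 / 20000) 1 1 6 19 56
        (by norm_num [Finset.sum_range_succ]))
      (by norm_num) (by norm_num) (by norm_num) (by norm_num) (by norm_num)
      (fun s hs => by
        nlinarith [mul_nonneg hs (sq_nonneg (s - 13 / 10)), sq_nonneg (s * (s - 13 / 10)),
          sq_nonneg (s - 13 / 10)])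
      (fun s hs => by
        nlinarith [mul_nonneg hs (sq_nonneg s), sq_nonneg (s ^ 2), sq_nonneg s])
  rcases le_total x (31 / 100) with g2 | g2
  · exact h.false_of_quartic hab hκ (by linarith) g1 g2 hβ
      (A := 7423 / 2000) (E := 38793 / 2000) (K := 21 / 4)
      (by norm_num)
      (one_sub_le_of_mem_Icc hκ g1 g2
        (13987 / 20000) (1 / 5) (757 / 20000) 1 2 9 11 25
        (by norm_num [Finset.sum_range_succ]))
      (by norm_num) (by norm_num) (by norm_num) (by norm_num) (by norm_num)
      (fun s hs => by
        nlinarith [mul_nonneg hs (sq_nonneg (s - 27 / 20)), sq_nonneg (s * (s - 27 / 20)),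
          sq_nonneg (s - 27 / 20)])
      (fun s hs => by
        nlinarith [mul_nonneg hs (sq_nonneg (s - 1 / 5)), sq_nonneg (s * (s - 1 / 5)),
          sq_nonneg (s - 1 / 5)])
  rcases le_total x (41 / 100) with g3 | g3
  · exact h.false_of_quartic hab hκ (by linarith) g2 g3 hβ
      (A := 14093 / 2000) (E := 59757 / 1000) (K := 17 / 2)
      (by norm_num)
      (one_sub_le_of_mem_Icc hκ g2 g3
        (12189 / 20000) (1 / 5) (1179 / 20000) 1 4 13 29 52
        (by norm_num [Finset.sum_range_succ]))
      (by norm_num) (by norm_num) (by norm_num) (by norm_num) (by norm_num)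
      (fun s hs => by
        nlinarith [mul_nonneg hs (sq_nonneg (s - 3 / 2)), sq_nonneg (s * (s - 3 / 2)),
          sq_nonneg (s - 3 / 2)])
      (fun s hs => by
        nlinarith [mul_nonneg hs (sq_nonneg (s - 1 / 4)), sq_nonneg (s * (s - 1 / 4)),
          sq_nonneg (s - 1 / 4)])
  rcases le_total x (49 / 100) with g4 | g4
  · exact h.false_of_quartic hab hκ (by linarith) g3 g4 hβ
      (A := 6731 / 500) (E := 99181 / 500) (K := 59 / 4)
      (by norm_num)
      (one_sub_le_of_mem_Icc hκ g3 g4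
        (11487 / 20000) (1 / 4) (149 / 2000) 1 2 5 20 31
        (by norm_num [Finset.sum_range_succ]))
      (by norm_num) (by norm_num) (by norm_num) (by norm_num) (by norm_num)
      (fun s hs => by
        nlinarith [mul_nonneg hs (sq_nonneg (s - 13 / 10)), sq_nonneg (s * (s - 13 / 10)),
          sq_nonneg (s - 13 / 10)])
      (fun s hs => by
        nlinarith [mul_nonneg hs (sq_nonneg (s - 1 / 2)), sq_nonneg (s * (s - 1 / 2)),
          sq_nonneg (s - 1 / 2)])
  exact h.false_of_quartic hab hκ (by linarith) g4 h1 hβ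
    (A := 681 / 50) (E := 25086 / 125) (K := 59 / 4)
    (by norm_num)
    (one_sub_le_of_mem_Icc hκ g4 h1
      (2593 / 5000) (1 / 4) (281 / 4000) 1 9 19 40 61
      (by norm_num [Finset.sum_range_succ]))
    (by norm_num) (by norm_num) (by norm_num) (by norm_num) (by norm_num)
    (fun s hs => by
      nlinarith [mul_nonneg hs (sq_nonneg (s - 17 / 20)), sq_nonneg (s * (s - 17 / 20)),
        sq_nonneg (s - 17 / 20)])
    (fun s hs => by
      nlinarith [mul_nonneg hs (sq_nonneg (s - 4 / 5)), sq_nonneg (s * (s - 4 / 5)),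
        sq_nonneg (s - 4 / 5)])

lemma false_of_mem_one_half_thirteen_twentieths (h : SieveData κ F f α β) (hab : α ≤ β)
    (hκ : κ = 1 + x) (h0 : 1 / 2 ≤ x) (h1 : x ≤ 13 / 20) (hβ : β ≤ 2 + 23 / 10 * x) : False := by
  rcases le_total x (29 / 50) with g0 | g0
  · exact h.false_of_quadratic hab hκ h0 hβ (by norm_num)
      (one_sub_le_of_mem_Icc hκ h0 g0 (2191 / 4000) (3 / 10) (117 / 1250) 1 1 2 31 42
        (by norm_num [Finset.sum_range_succ]))
      (q := -1 / 4) (by norm_num) (by norm_num) (by linarith)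
  rcases le_total x (31 / 50) with g1 | g1
  · exact h.false_of_quadratic hab hκ h0 hβ (by norm_num)
      (one_sub_le_of_mem_Icc hκ g0 g1 (4981 / 10000) (3 / 10) (393 / 4000) 1 11 19 7 9
        (by norm_num [Finset.sum_range_succ]))
      (q := -6 / 25) (by norm_num) (by norm_num) (by linarith)
  exact h.false_of_quadratic hab hκ h0 hβ (by norm_num)
    (one_sub_le_of_mem_Icc hκ g1 h1 (4767 / 10000) (3 / 10) (2053 / 20000) 1 8 13 29 36
      (by norm_num [Finset.sum_range_succ]))
    (q := -119 / 500) (by norm_num) (by norm_num) (by linarith)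

lemma lt_of_le_thirteen_fifths (h : SieveData κ F f α β) (hκ : κ = 1 + x) (h0 : 0 < x)
    (h1 : x ≤ 13 / 5) : β < α := by
  by_contra! hab
  have hβ : β ≤ 2 + 23 / 10 * x := by
    rcases le_total x (1 / 12) with g0 | g0
    · exact h.beta_le_of_le_one_twelfth hab hκ h0 g0
    rcases le_total x (1 / 4) with g1 | g1
    · exact h.beta_le_of_mem_one_twelfth_one_quarter hab hκ g0 g1
    rcases le_total x (1 / 2) with g2 | g2
    · exact h.beta_le_of_mem_one_quarter_one_half hab hκ g1 g2
    rcases le_total x 1 with g3 | g3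
    · exact h.beta_le_of_mem_one_half_one hab hκ g2 g3
    rcases le_total x 2 with g4 | g4
    · exact h.beta_le_of_mem_one_two hab hκ g3 g4
    exact h.beta_le_of_mem_two_thirteen_fifths hab hκ g4 h1
  rcases le_total x (3 / 25) with g0 | g0
  · exact h.false_of_mem_zero_three_twentyfifths hab hκ h0 g0 hβ
  rcases le_total x (1 / 2) with g1 | g1
  · exact h.false_of_mem_three_twentyfifths_one_half hab hκ g0 g1 hβ
  rcases le_total x (13 / 20) with g2 | g2
  · exact h.false_of_mem_one_half_thirteen_twentieths hab hκ g1 g2 hβ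
  exact h.false_of_square hab hκ g2 h1 hβ

end SieveData

noncomputable def gammaDensity (ν t : ℝ) : ℝ := max t 0 ^ ν * Real.exp (-t)

/-- The unnormalised lower incomplete Gamma function of shape `ν + 1`. -/
noncomputable def lowerGamma (ν u : ℝ) : ℝ := ∫ t in (0 : ℝ)..u, gammaDensity ν t

section

variable {ν : ℝ}

lemma continuous_gammaDensity (hν : 0 < ν) : Continuous (gammaDensity ν) :=
  (Continuous.rpow_const (by fun_prop) fun _ => Or.inr hν.le).mul (by fun_prop)

lemma hasDerivAt_lowerGamma (hν : 0 < ν) (u : ℝ) :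
    HasDerivAt (lowerGamma ν) (gammaDensity ν u) u :=
  intervalIntegral.integral_hasDerivAt_right
    ((continuous_gammaDensity hν).intervalIntegrable _ _)
    (continuous_gammaDensity hν).stronglyMeasurable.stronglyMeasurableAtFilter
    (continuous_gammaDensity hν).continuousAt

lemma lowerGamma_of_nonpos (hν : 0 < ν) {u : ℝ} (hu : u ≤ 0) : lowerGamma ν u = 0 := by
  refine (intervalIntegral.integral_congr (g := fun _ => (0 : ℝ)) fun t ht => ?_).trans (by simp)
  rw [uIcc_of_ge hu] at ht
  simp [gammaDensity, max_eq_right ht.2, Real.zero_rpow hν.ne']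

lemma tendsto_lowerGamma (hν : 0 < ν) :
    Tendsto (lowerGamma ν) atTop (𝓝 (Real.Gamma (ν + 1))) := by
  have e : ∀ t ∈ Ioi (0 : ℝ), Real.exp (-t) * t ^ (ν + 1 - 1) = gammaDensity ν t := fun t ht => by
    rw [gammaDensity, max_eq_left (mem_Ioi.1 ht).le, mul_comm, add_sub_cancel_right]
  have hi : IntegrableOn (gammaDensity ν) (Ioi 0) :=
    (Real.GammaIntegral_convergent (s := ν + 1) (by linarith)).congr_fun e measurableSet_Ioi
  have := intervalIntegral_tendsto_integral_Ioi 0 hi tendsto_id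
  rwa [← setIntegral_congr_fun measurableSet_Ioi e,
    ← Real.Gamma_eq_integral (by linarith)] at this

lemma gammaDensity_sub_le (hν : 0 < ν) {u s : ℝ} (hu : 0 < u) :
    gammaDensity ν (u - s) ≤ gammaDensity ν u * Real.exp (-((ν / u - 1) * s)) := by
  have h1 : max (u - s) 0 ≤ u * Real.exp (-(s / u)) := by
    refine max_le ?_ (by positivity)
    have h2 := Real.add_one_le_exp (-(s / u))
    calc u - s = u * (-(s / u) + 1) := by field_simp; ring
      _ ≤ _ := by gcongr
  have h3 : max (u - s) 0 ^ ν ≤ u ^ ν * Real.exp (-(s / u) * ν) := by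
    calc max (u - s) 0 ^ ν ≤ (u * Real.exp (-(s / u))) ^ ν := by
          gcongr
      _ = _ := by rw [Real.mul_rpow hu.le (Real.exp_pos _).le, ← Real.exp_mul]
  rw [gammaDensity, gammaDensity, max_eq_left hu.le]
  calc max (u - s) 0 ^ ν * Real.exp (-(u - s))
      ≤ u ^ ν * Real.exp (-(s / u) * ν) * Real.exp (-(u - s)) := by gcongr
    _ = _ := by
      rw [mul_assoc, mul_assoc, ← Real.exp_add, ← Real.exp_add]
      congr 2
      field_simp
      ring

lemma exp_neg_mul_le_chord (c : ℝ) {s : ℝ} (h0 : 0 ≤ s) (h2 : s ≤ 2) :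
    Real.exp (-(c * s)) ≤ 1 - s / 2 + s / 2 * Real.exp (-(c * 2)) := by
  have := convexOn_exp.2 (mem_univ 0) (mem_univ (-(c * 2)))
    (by linarith : 0 ≤ 1 - s / 2) (by linarith : 0 ≤ s / 2) (by ring)
  simp only [smul_eq_mul, mul_zero, zero_add, Real.exp_zero, mul_one] at this
  rwa [show s / 2 * -(c * 2) = -(c * s) by ring] at this

lemma mul_lowerGamma_sub_le (hν : 0 < ν) {u : ℝ} (hu : 0 < u) :
    ν / 2 * (lowerGamma ν u - lowerGamma ν (u - 2)) ≤ u * gammaDensity ν u := by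
  set c := ν / u - 1 with hc
  set T := gammaDensity ν u with hT
  have hT0 : 0 ≤ T := mul_nonneg (by positivity) (Real.exp_pos _).le
  have hcu : u * (1 + c) = ν := by rw [hc]; field_simp; ring
  have key := antitoneOn_Icc_of_hasDerivAt (a := 0) (b := 2)
    (g := fun s => (1 + c) * -lowerGamma ν (u - s) -
      T * (-Real.exp (-(c * s)) + s - s ^ 2 / 4 + s ^ 2 / 4 * Real.exp (-(c * 2))))
    (g' := fun s => (1 + c) * gammaDensity ν (u - s) -
      T * (c * Real.exp (-(c * s)) + 1 - s / 2 + s / 2 * Real.exp (-(c * 2)))) ?_ ?_ ?_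
  · have h1 := key (left_mem_Icc.2 zero_le_two) (right_mem_Icc.2 zero_le_two) zero_le_two
    norm_num at h1
    have h2 : (1 + c) * (lowerGamma ν u - lowerGamma ν (u - 2)) ≤ 2 * T := by linarith
    have h3 := mul_le_mul_of_nonneg_left h2 hu.le
    rw [← mul_assoc, hcu] at h3
    linarith
  · have h1 : Continuous (lowerGamma ν) :=
      continuous_iff_continuousAt.2 fun v => (hasDerivAt_lowerGamma hν v).continuousAt
    fun_prop
  · intro s _ _
    have h1 := ((hasDerivAt_lowerGamma hν (u - s)).comp_const_sub u s).neg.const_mul (1 + c)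
    have h2 := ((hasDerivAt_id s).const_mul c).neg.exp.neg
    have h3 := ((hasDerivAt_pow 2 s).div_const 4)
    refine (h1.sub ((((h2.add (hasDerivAt_id s)).sub h3).add
      (h3.mul_const (Real.exp (-(c * 2))))).const_mul T)).congr_deriv ?_
    simp only [id, Pi.neg_apply]
    ring
  · intro s hs0 hs2
    have h1 := gammaDensity_sub_le hν hu (s := s)
    have h2 := exp_neg_mul_le_chord c hs0.le hs2.le
    have h3 : 0 ≤ 1 + c := by
      rw [hc]
      have : 0 < ν / u := by positivity
      linarith
    have h4 := mul_le_mul_of_nonneg_left h1 h3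
    have h5 := mul_le_mul_of_nonneg_left h2 hT0
    linarith

lemma Gamma_le_two_mul_lowerGamma (hν : 0 < ν) :
    Real.Gamma (ν + 1) ≤ 2 * lowerGamma ν (ν + 1) := by
  set n := ν + 1 with hn
  have hn0 : 0 < n := by linarith
  have hd : ∀ s, HasDerivAt (fun s => lowerGamma ν (n * Real.exp s) +
        lowerGamma ν (n * Real.exp (-s)))
      (gammaDensity ν (n * Real.exp s) * (n * Real.exp s) -
        gammaDensity ν (n * Real.exp (-s)) * (n * Real.exp (-s))) s := fun s => by
    have h1 := (hasDerivAt_lowerGamma hν (n * Real.exp s)).comp s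
      ((Real.hasDerivAt_exp s).const_mul n)
    have h2 := (hasDerivAt_lowerGamma hν (n * Real.exp (-s))).comp s
      ((hasDerivAt_neg s).exp.const_mul n)
    refine (h1.add h2).congr_deriv ?_
    ring
  have hw : ∀ s, gammaDensity ν (n * Real.exp s) * (n * Real.exp s) =
      n ^ n * Real.exp (n * (s - Real.exp s)) := fun s => by
    have h1 : 0 < n * Real.exp s := by positivity
    rw [gammaDensity, max_eq_left h1.le, mul_right_comm, ← Real.rpow_add_one h1.ne', ← hn,
      Real.mul_rpow hn0.le (Real.exp_pos _).le, ← Real.exp_mul, mul_assoc, ← Real.exp_add]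
    congr 2
    ring
  have hanti := antitoneOn_Ici_of_hasDerivAt (a := 0)
    (fun s _ => (hd s).continuousAt.continuousWithinAt) (fun s _ => hd s) (fun s hs => by
      rw [hw, hw]
      have h1 := Real.self_le_sinh_iff.2 hs.le
      rw [Real.sinh_eq] at h1
      have h2 : s - Real.exp s ≤ -s - Real.exp (-s) := by linarith
      have h3 : n ^ n * Real.exp (n * (s - Real.exp s)) ≤
          n ^ n * Real.exp (n * (-s - Real.exp (-s))) := by gcongr
      linarith)
  have hlim : Tendsto (fun s => lowerGamma ν (n * Real.exp s) + lowerGamma ν (n * Real.exp (-s)))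
      atTop (𝓝 (Real.Gamma n + 0)) := by
    refine ((tendsto_lowerGamma hν).comp (Real.tendsto_exp_atTop.const_mul_atTop hn0)).add ?_
    have h1 : Tendsto (fun s => n * Real.exp (-s)) atTop (𝓝 0) := by
      simpa using Real.tendsto_exp_neg_atTop_nhds_zero.const_mul n
    have h2 := ((hasDerivAt_lowerGamma hν 0).continuousAt.tendsto).comp h1
    rwa [lowerGamma_of_nonpos hν le_rfl] at h2
  have h1 := le_of_tendsto hlim (b := 2 * lowerGamma ν n) (by
    filter_upwards [eventually_ge_atTop 0] with s hs
    refine (hanti self_mem_Ici hs hs).trans_eq ?_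
    simp only [neg_zero, Real.exp_zero, mul_one]
    ring)
  linarith

end

/-- A function vanishing on the negative half-line and at infinity, and decreasing to the left of
a delayed comparison at every critical point, is nonnegative. -/
lemma nonneg_of_delay {D D' : ℝ → ℝ} (hc : Continuous D) (h0 : ∀ u, u ≤ 0 → D u = 0)
    (hlim : Tendsto D atTop (𝓝 0)) (hd : ∀ u, 0 < u → HasDerivAt D (D' u) u)
    (hD : ∀ u, 0 < u → D' u = 0 → D (u - 2) ≤ D u) (u : ℝ) : 0 ≤ D u := by
  by_contra! hu
  obtain ⟨v, hv⟩ : ∃ v, ∀ y, D v ≤ D y := by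
    refine hc.exists_forall_le' u ?_
    rw [cocompact_eq_atBot_atTop, eventually_sup]
    constructor
    · filter_upwards [eventually_le_atBot 0] with y hy
      rw [h0 y hy]
      exact hu.le
    · filter_upwards [hlim.eventually (lt_mem_nhds hu)] with y hy using hy.le
  have hpos : ∀ y, D y < 0 → 0 < y := fun y hy => by
    by_contra! h
    rw [h0 y h] at hy
    exact lt_irrefl _ hy
  have hv0 : D v < 0 := (hv u).trans_lt hu
  have hstep : ∀ k : ℕ, D (v - 2 * k) = D v := fun k => by
    induction k with
    | zero => simp
    | succ k ih =>
      have h1 : 0 < v - 2 * k := hpos _ (by rwa [ih])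
      have h2 : IsLocalMin D (v - 2 * k) := Eventually.of_forall fun y => by
        rw [ih]
        exact hv y
      have h3 := hD _ h1 (h2.hasDerivAt_eq_zero (hd _ h1))
      rw [ih] at h3
      push_cast
      rw [show v - 2 * ((k : ℝ) + 1) = v - 2 * k - 2 by ring]
      exact le_antisymm h3 (hv _)
  obtain ⟨k, hk⟩ := exists_nat_ge v
  have := hpos (v - 2 * k) (by rwa [hstep])
  have := Nat.cast_nonneg (α := ℝ) k
  linarith

lemma lowerGamma_div_le_sig {κ : ℝ} (hκ : 0 < κ) (u : ℝ) :
    lowerGamma (2 * κ) u / Real.Gamma (2 * κ + 1) ≤ sig κ u := by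
  have hν : 0 < 2 * κ := by linarith
  have hG : 0 < Real.Gamma (2 * κ + 1) := Real.Gamma_pos_of_pos (by linarith)
  have hcl : Continuous (lowerGamma (2 * κ)) :=
    continuous_iff_continuousAt.2 fun v => (hasDerivAt_lowerGamma hν v).continuousAt
  have := nonneg_of_delay
    (D := fun u => sig κ u - lowerGamma (2 * κ) u / Real.Gamma (2 * κ + 1))
    (D' := fun u => κ / u * (sig κ u - sig κ (u - 2)) -
      gammaDensity (2 * κ) u / Real.Gamma (2 * κ + 1))
    ((continuous_sig hκ).sub (hcl.div_const _))
    (fun u hu => by simp [sig_of_nonpos hκ hu, lowerGamma_of_nonpos hν hu]) ?_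
    (fun u hu => (hasDerivAt_sig hκ hu).sub ((hasDerivAt_lowerGamma hν u).div_const _))
    (fun u hu hz => ?_) u
  · linarith
  · have := (tendsto_sig hκ).sub ((tendsto_lowerGamma hν).div_const (Real.Gamma (2 * κ + 1)))
    rwa [div_self hG.ne', sub_self] at this
  · have h1 := mul_lowerGamma_sub_le hν hu
    have h2 : κ * (sig κ u - sig κ (u - 2)) =
        u * gammaDensity (2 * κ) u / Real.Gamma (2 * κ + 1) := by
      have h3 : u * (κ / u * (sig κ u - sig κ (u - 2)) -
        gammaDensity (2 * κ) u / Real.Gamma (2 * κ + 1)) = 0 := by rw [hz, mul_zero]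
      field_simp at h3 ⊢
      linarith
    have h4 : κ * ((lowerGamma (2 * κ) u - lowerGamma (2 * κ) (u - 2)) / Real.Gamma (2 * κ + 1)) ≤
        κ * (sig κ u - sig κ (u - 2)) := by
      rw [h2, mul_div_assoc', div_le_div_iff_of_pos_right hG]
      linarith
    have h5 := le_of_mul_le_mul_left h4 hκ
    rw [sub_div] at h5
    linarith

lemma half_le_sig {κ : ℝ} (hκ : 0 < κ) : 1 / 2 ≤ sig κ (2 * κ + 1) := by
  refine le_trans ?_ (lowerGamma_div_le_sig hκ _)
  rw [div_le_div_iff₀ two_pos (Real.Gamma_pos_of_pos (by linarith))]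
  linarith [Gamma_le_two_mul_lowerGamma (ν := 2 * κ) (by linarith)]

namespace SieveData

variable {κ α β : ℝ} {F f : ℝ → ℝ}

lemma lt_of_eighteen_fifths_le (h : SieveData κ F f α β) (hκ : 18 / 5 ≤ κ) : β < α := by
  by_contra! hab
  have hβ : β ≤ 2 * κ + 2 := h.beta_le_of_half_le_sig (by linarith) hab (by linarith) (by
    rw [show 2 * κ + 2 - 1 = 2 * κ + 1 by ring]
    exact half_le_sig (by linarith))
  refine h.false_of_supersolution (by linarith) hab hβ (H := fun s => (s + 29 / 20) ^ 3)
    (H' := fun s => 3 * (s + 29 / 20) ^ 2) (K := 1) (by fun_prop) (fun s hs => ?_)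
    (fun s hs => by positivity) (fun s hs => by positivity) (fun s hs => ?_) (fun s hs => ?_) ?_
  · refine (((hasDerivAt_id s).add_const (29 / 20)).pow 3).congr_deriv ?_
    simp
  · rw [one_mul]
    gcongr
    norm_num
  · set y := s + 29 / 20 with hy
    have hy0 : 0 < y := by linarith
    have h1 : 0 ≤ 16 / 5 * y ^ 3 - 249 / 20 * y ^ 2 + 54 / 5 * y + 18 / 5 := by
      nlinarith [mul_nonneg hy0.le (sq_nonneg (y - 2)), sq_nonneg (y - 2)]
    have h2 : 0 ≤ (κ - 18 / 5) * (2 * y ^ 3 - 3 * y ^ 2 + 3 * y + 1) :=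
      mul_nonneg (by linarith) (by nlinarith [mul_nonneg hy0.le (sq_nonneg (y - 1))])
    rw [show s + 1 + 29 / 20 = y + 1 by ring, show 2 * κ + 2 + s = y + 2 * κ + 11 / 20 by ring]
    nlinarith
  · have e : ∫ s in (0 : ℝ)..1, (s + 29 / 20) ^ 3 = ((49 / 20) ^ 4 - (29 / 20) ^ 4) / 4 := by
      rw [intervalIntegral.integral_comp_add_right (fun s => s ^ 3) (29 / 20), integral_pow]
      norm_num
    rw [e]
    norm_num
    linarith

lemma beta_lt_alpha (h : SieveData κ F f α β) (hκ : 1 < κ) : β < α := by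
  rcases le_total κ (18 / 5) with h1 | h1
  · exact h.lt_of_le_thirteen_fifths (x := κ - 1) (by ring) (by linarith) (by linarith)
  · exact h.lt_of_eighteen_fifths_le h1

end SieveData

lemma exp_neg_mul_le_Lap {κ : ℝ} (hκ : 1 ≤ κ) :
    Real.exp (-(κ * Real.eulerMascheroniConstant)) ≤ Lap (-κ) 1 := by
  set γ := Real.eulerMascheroniConstant with hγ
  have h0 : Lap 0 1 = 1 := by
    have := mul_Lap_sub_integral 0 one_pos
    simpa using this
  have hpt : ∀ x, Real.exp (-1 * x + 0 * Ein x) * (1 - κ)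
      + κ * Real.exp γ * Real.exp (-1 * x + (-1) * Ein x)
      ≤ Real.exp (κ * γ) * Real.exp (-1 * x + (-κ) * Ein x) := fun x => by
    have h1 := one_add_mul_self_le_rpow_one_add
      (s := Real.exp (γ - Ein x) - 1) (by linarith [Real.exp_pos (γ - Ein x)]) hκ
    rw [add_sub_cancel, ← Real.exp_mul] at h1
    have h2 := mul_le_mul_of_nonneg_left h1 (Real.exp_pos (-1 * x + 0 * Ein x)).le
    have h3 : Real.exp (-1 * x + 0 * Ein x) * Real.exp (γ - Ein x)
        = Real.exp γ * Real.exp (-1 * x + (-1) * Ein x) := by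
      rw [← Real.exp_add, ← Real.exp_add]; congr 1; ring
    have h4 : Real.exp (-1 * x + 0 * Ein x) * Real.exp ((γ - Ein x) * κ)
        = Real.exp (κ * γ) * Real.exp (-1 * x + (-κ) * Ein x) := by
      rw [← Real.exp_add, ← Real.exp_add]; congr 1; ring
    rw [h4] at h2
    linear_combination h2 - κ * h3
  have hi := fun c => integrableOn_lap c one_pos
  have h1 := integral_mono (((hi 0).mul_const (1 - κ)).add
    ((hi (-1)).const_mul (κ * Real.exp γ))) ((hi (-κ)).const_mul (Real.exp (κ * γ))) hpt
  rw [integral_add' ((hi 0).mul_const (1 - κ)) ((hi (-1)).const_mul (κ * Real.exp γ)),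
    integral_mul_const, integral_const_mul, integral_const_mul] at h1
  change Lap 0 1 * (1 - κ) + κ * Real.exp γ * Lap (-1) 1 ≤ Real.exp (κ * γ) * Lap (-κ) 1 at h1
  rw [h0, Lap_neg_one_one, ← hγ, mul_assoc, ← Real.exp_add, add_neg_cancel, Real.exp_zero] at h1
  rw [Real.exp_neg, inv_eq_one_div, div_le_iff₀ (Real.exp_pos _)]
  linarith

lemma rpow_le_dhConst {κ : ℝ} (hκ : 1 ≤ κ) :
    (2 * Real.exp Real.eulerMascheroniConstant) ^ κ ≤ dhConst κ := by
  have h1 : 1 ≤ Real.Gamma (κ + 1) := by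
    have := Real.Gamma_strictMonoOn_Ici.monotoneOn (mem_Ici.2 le_rfl)
      (mem_Ici.2 (by linarith : 2 ≤ κ + 1)) (by linarith)
    rwa [Real.Gamma_two] at this
  exact le_mul_of_one_le_right (by positivity) h1

lemma two_le_dhConst_mul_Lap {κ : ℝ} (hκ : 1 ≤ κ) : 2 ≤ dhConst κ * Lap (-κ) 1 := by
  refine le_trans ?_ (mul_le_mul (rpow_le_dhConst hκ) (exp_neg_mul_le_Lap hκ)
    (Real.exp_pos _).le (dhConst_pos (by linarith)).le)
  rw [Real.mul_rpow two_pos.le (Real.exp_pos _).le, ← Real.exp_mul, mul_assoc, ← Real.exp_add,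
    mul_comm κ, add_neg_cancel, Real.exp_zero, mul_one]
  exact Real.self_le_rpow_of_one_le one_le_two hκ

lemma log_two_mul_exp_gamma_ge :
    1269 / 1000 ≤ Real.log 2 + Real.eulerMascheroniConstant := by
  linarith [Real.log_two_gt_d9, lt_eulerMascheroniConstant]

namespace SieveData

variable {κ α β : ℝ} {F f : ℝ → ℝ}

lemma monotoneOn_rpow_mul_upper (h : SieveData κ F f α β) (hκ : 1 < κ)
    (hα : F α = 1 / sig κ α) : MonotoneOn (fun u => u ^ κ * F u) (Ioi 0) := by
  have hκ0 : 0 < κ := by linarith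
  have h2 := h.two_le
  have hF : ∀ u, u ≤ α → F u = 1 / sig κ u := fun u hu => by
    rcases hu.eq_or_lt with e | e
    · rw [e, hα]
    · exact h.eq_inv_sig u e
  rw [← Ioc_union_Ici_eq_Ioi (show 0 < α by linarith)]
  refine MonotoneOn.union_right (c := α) ?_ ?_ ⟨right_mem_Ioc.2 (by linarith), fun x hx => hx.2⟩
    isLeast_Ici
  · intro x hx y hy hxy
    have h3 := antitoneOn_rpow_neg_mul_sig hκ0 (mem_Ioi.2 hx.1) (mem_Ioi.2 hy.1) hxy
    have e : ∀ u, 0 < u → u ≤ α → u ^ κ * F u = (u ^ (-κ) * sig κ u)⁻¹ := fun u h0 hu => by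
      rw [hF u hu, Real.rpow_neg h0.le, mul_inv, inv_inv, one_div]
    simp only [e x hx.1 hx.2, e y hy.1 hy.2]
    exact inv_anti₀ (mul_pos (Real.rpow_pos_of_pos hy.1 _) (sig_pos hκ0 hy.1)) h3
  · have := antitoneOn_Ici_of_hasDerivAt_ne (c := 3) (g := fun u => -(u ^ κ * F u)) (a := α)
      ((Real.continuous_rpow_const hκ0.le).continuousOn.mul (h.continuousOn_upper hκ)).neg
      (fun u hu hu3 => (h.hasDerivAt_upper hκ hu (h.continuousAt_lower_of_ne hκ (by linarith)
        fun e => hu3 (by linarith))).neg) (fun u hu _ => by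
        have := mul_nonneg (mul_nonneg hκ0.le (Real.rpow_nonneg (by linarith : 0 ≤ u) (κ - 1)))
          (h.nonneg (u - 1))
        linarith)
    intro x hx y hy hxy
    simpa using this hx hy hxy

lemma dhConst_le_rpow_mul_upper (h : SieveData κ F f α β) (hκ : 1 < κ)
    (hα : F α = 1 / sig κ α) {u : ℝ} (hu : 0 < u) : dhConst κ ≤ u ^ κ * F u := by
  have hκ0 : 0 < κ := by linarith
  have h2 := h.two_le
  have h0 : 0 < min u 1 := lt_min hu one_pos
  have h1 : min u 1 ≤ 1 := min_le_right _ _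
  refine le_trans (le_of_eq ?_) (h.monotoneOn_rpow_mul_upper hκ hα (mem_Ioi.2 h0)
    (mem_Ioi.2 hu) (min_le_left _ _))
  have := Real.rpow_pos_of_pos h0 κ
  simp only
  rw [h.eq_inv_sig _ (by linarith), sig_of_le_two hκ0 h0.le (by linarith)]
  field_simp

/-- Lower bound for the growth of `f` over an interval where `F x ≥ a * x ^ (-κ)`. -/
lemma rpow_mul_lower_growth (h : SieveData κ F f α β) (hκ : 1 < κ) (hα : F α = 1 / sig κ α)
    {a p q : ℝ} (hp : β ≤ p + 1) (hpq : p ≤ q) (ha : ∀ x, p ≤ x → a ≤ x ^ κ * F x) :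
    (p + 1) ^ κ * (f (p + 1) - 1) + κ * a * (Real.log q - Real.log p) - (q ^ κ - p ^ κ)
      ≤ (q + 1) ^ κ * (f (q + 1) - 1) := by
  have hκ0 : 0 < κ := by linarith
  have h2 := h.two_le_beta
  have hp0 : 1 ≤ p := by linarith
  have hm := monotoneOn_Icc_of_hasDerivAt (a := p + 1) (b := q + 1)
    (g := fun u => u ^ κ * f u - u ^ κ - κ * a * Real.log (u - 1) + (u - 1) ^ κ)
    (g' := fun u => κ * u ^ (κ - 1) * F (u - 1) - κ * u ^ (κ - 1)
      - κ * a * (1 / (u - 1)) + κ * (u - 1) ^ (κ - 1)) ?_ ?_ ?_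
    (left_mem_Icc.2 (by linarith)) (right_mem_Icc.2 (by linarith)) (by linarith)
  · simp only [add_sub_cancel_right] at hm
    linarith
  · refine (((Continuous.continuousOn (Real.continuous_rpow_const hκ0.le)).mul
      ((h.continuousOn_lower hκ).mono fun x hx => hp.trans hx.1)).sub
      (Continuous.continuousOn (Real.continuous_rpow_const hκ0.le))).sub
      (continuousOn_const.mul (ContinuousOn.log (by fun_prop) fun x hx => ?_)) |>.add ?_
    · have := hx.1
      linarith
    · exact ((Real.continuous_rpow_const hκ0.le).comp (continuous_sub_right 1)).continuousOn
  · intro u hu _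
    have h3 : HasDerivAt (fun u : ℝ => u - 1) 1 u := (hasDerivAt_id u).sub_const 1
    refine ((((h.hasDerivAt_lower hκ (by linarith) (h.continuousAt_upper hκ (by linarith)
      fun _ => hα)).sub (Real.hasDerivAt_rpow_const (Or.inr hκ.le))).sub
      ((h3.log (by linarith)).const_mul (κ * a))).add
      (h3.rpow_const (p := κ) (Or.inr hκ.le))).congr_deriv ?_
    ring
  · intro u hu _
    have hv : 0 < u - 1 := by linarith
    have h3 := mul_le_mul_of_nonneg_right (Real.rpow_le_rpow hv.le (by linarith : u - 1 ≤ u)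
      (by linarith : 0 ≤ κ - 1)) (by linarith [h.one_le hv] : 0 ≤ F (u - 1) - 1)
    have h4 := ha (u - 1) (by linarith)
    have h5 : a * (1 / (u - 1)) ≤ (u - 1) ^ (κ - 1) * F (u - 1) := by
      rw [mul_one_div, div_le_iff₀ hv]
      refine h4.trans_eq ?_
      rw [Real.rpow_sub_one hv.ne']
      field_simp
    have h6 := mul_nonneg hκ0.le (sub_nonneg.2 (h3.trans' (sub_le_sub_right h5
      ((u - 1) ^ (κ - 1)) |>.trans_eq (by ring))))
    linarith

lemma lower_two_le (h : SieveData κ F f α β) (hκ : 1 < κ) (hα : F α = 1 / sig κ α) (hβ : β = 2)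
    {a a' b : ℝ} (hb : 1 ≤ b) (hba : b ^ κ ≤ a') (ha : ∀ x, 1 ≤ x → a ≤ x ^ κ * F x)
    (ha' : ∀ x, b ≤ x → a' ≤ x ^ κ * F x) :
    2 ^ κ * f 2 + (a * κ * Real.log b + a' * (Real.log a' - κ * Real.log b - 1) + 1) ≤ 2 ^ κ := by
  have hκ0 : 0 < κ := by linarith
  have ha0 : 0 < a' := (Real.rpow_pos_of_pos (by linarith) κ).trans_le hba
  set q := a' ^ κ⁻¹ with hq
  have hqκ : q ^ κ = a' := Real.rpow_inv_rpow ha0.le hκ0.ne'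
  have hlq : κ * Real.log q = Real.log a' := by
    rw [hq, Real.log_rpow ha0]; field_simp
  have hq0 : 0 < q := Real.rpow_pos_of_pos ha0 _
  have hbq : b ≤ q := by
    rwa [← hqκ, Real.rpow_le_rpow_iff (by linarith) hq0.le hκ0] at hba
  have h1 := h.rpow_mul_lower_growth hκ hα (by linarith : β ≤ 1 + 1) hb ha
  have h2 := h.rpow_mul_lower_growth hκ hα (by linarith : β ≤ b + 1) hbq ha'
  have h3 : (q + 1) ^ κ * (f (q + 1) - 1) ≤ 0 :=
    mul_nonpos_of_nonneg_of_nonpos (Real.rpow_nonneg (by linarith) _)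
      (by linarith [h.le_one (show 0 < q + 1 by linarith)])
  rw [hqκ] at h2
  rw [Real.log_one, Real.one_rpow, one_add_one_eq_two] at h1
  linear_combination h1 + h2 + h3 - a' * hlq

end SieveData

lemma log_two_mul_exp_rpow (κ : ℝ) :
    Real.log ((2 * Real.exp Real.eulerMascheroniConstant) ^ κ)
      = κ * (Real.log 2 + Real.eulerMascheroniConstant) := by
  rw [Real.log_rpow (by positivity), Real.log_mul two_ne_zero (Real.exp_ne_zero _), Real.log_exp]

lemma one_sub_mul_le_rpow_neg {a : ℝ} (ha : 0 < a) (x : ℝ) : 1 - x * Real.log a ≤ a ^ (-x) := by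
  rw [Real.rpow_def_of_pos ha]
  linarith [Real.add_one_le_exp (Real.log a * -x)]

/-- An upper bound for `σ_κ(3)` when the dimension is barely larger than `1`. -/
lemma rpow_mul_inv_sig_three_ge {κ : ℝ} (h1 : 1 < κ) (h2 : κ ≤ 51 / 50) :
    107 / 100 * dhConst κ ≤ 3 ^ κ * (1 / sig κ 3) := by
  have hκ0 : 0 < κ := by linarith
  have hA := dhConst_pos hκ0
  have hd : ∀ u : ℝ, 2 ≤ u → HasDerivAt (fun u => dhConst κ * (u ^ (-κ) * sig κ u)
      + 96714 / 100000 * Real.log u + 1944 / 1000 * u⁻¹)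
      (dhConst κ * (-(κ * u ^ (-κ - 1) * sig κ (u - 2))) + 96714 / 100000 * u⁻¹
        + 1944 / 1000 * (-(u ^ 2)⁻¹)) u := fun u hu =>
    (((hasDerivAt_rpow_neg_mul_sig hκ0 (by linarith)).const_mul _).add
      ((Real.hasDerivAt_log (by linarith)).const_mul _)).add
      ((hasDerivAt_inv (by linarith)).const_mul _)
  have hq : 243 / 1000 ≤ (1 / 4 : ℝ) ^ κ := by
    have h3 := one_sub_mul_le_rpow_neg (a := 4) (by norm_num) (κ - 1)
    have h4 : (4 : ℝ) ^ (-(κ - 1)) = 4 * (1 / 4 : ℝ) ^ κ := by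
      rw [one_div, Real.inv_rpow (by norm_num), ← Real.rpow_neg (by norm_num),
        show -(κ - 1) = 1 + -κ by ring, Real.rpow_one_add' (by norm_num) (by linarith)]
    have h5 : Real.log 4 = 2 * Real.log 2 := by
      rw [show (4 : ℝ) = 2 ^ 2 by norm_num, Real.log_pow]; norm_num
    nlinarith [Real.log_two_lt_d9]
  have hm := antitoneOn_Icc_of_hasDerivAt (a := 2) (b := 3)
    (fun u hu => (hd u hu.1).continuousAt.continuousWithinAt) (fun u hu _ => hd u hu.le)
    (fun u hu hu3 => by
      have hu0 : 0 < u := by linarith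
      have hz : 0 ≤ 1 - 2 / u := by
        rw [sub_nonneg, div_le_one hu0]; exact hu.le
      have h3 : 243 / 1000 * (4 * (1 - 2 / u) - 1 / 50) ≤ κ * (1 - 2 / u) ^ κ := by
        have h4 := Real.rpow_nonneg hz κ
        have h6 : (1 - 2 / u) ^ κ ≤ κ * (1 - 2 / u) ^ κ := le_mul_of_one_le_left h4 h1.le
        rcases le_or_gt (4 * (1 - 2 / u) - 1 / 50) 0 with h5 | h5
        · linarith
        have h7 := one_add_mul_self_le_rpow_one_add (s := 4 * (1 - 2 / u) - 1) (by linarith) h1.le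
        have h8 : (1 - 2 / u) ^ κ = (1 / 4) ^ κ * (1 + (4 * (1 - 2 / u) - 1)) ^ κ := by
          rw [← Real.mul_rpow (by norm_num) (by linarith)]; congr 1; ring
        have h9 : 4 * (1 - 2 / u) - 1 / 50 ≤ (1 + (4 * (1 - 2 / u) - 1)) ^ κ := by
          nlinarith
        refine le_trans ?_ h6
        rw [h8]
        exact mul_le_mul hq h9 h5.le (by positivity)
      have h4 : dhConst κ * sig κ (u - 2) = (u - 2) ^ κ := by
        rw [sig_of_le_two hκ0 (by linarith) (by linarith)]; field_simp
      have h5 : (u - 2) ^ κ = (1 - 2 / u) ^ κ * u ^ κ := by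
        rw [← Real.mul_rpow hz hu0.le]; congr 1; field_simp
      have h6 : u ^ (-κ - 1) * u ^ κ = u⁻¹ := by
        rw [← Real.rpow_add hu0, ← Real.rpow_neg_one]; congr 1; ring
      have h7 := mul_le_mul_of_nonneg_right h3 (inv_pos.2 hu0).le
      have h8 : dhConst κ * (-(κ * u ^ (-κ - 1) * sig κ (u - 2)))
          = -(κ * (1 - 2 / u) ^ κ * u⁻¹) := by
        rw [← h6]
        linear_combination (-κ * u ^ (-κ - 1)) * (h4.trans h5)
      have h9 : 243 / 1000 * (4 * (1 - 2 / u) - 1 / 50) * u⁻¹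
          = 96714 / 100000 * u⁻¹ + 1944 / 1000 * (-(u ^ 2)⁻¹) := by
        field_simp; ring
      linarith)
    (left_mem_Icc.2 (by norm_num)) (right_mem_Icc.2 (by norm_num)) (by norm_num)
  simp only at hm
  have h3 : dhConst κ * ((2 : ℝ) ^ (-κ) * sig κ 2) = 1 := by
    have := rpow_neg_mul_rpow κ two_pos
    rw [sig_of_le_two hκ0 two_pos.le le_rfl]
    field_simp
    linarith
  have h4 : 40404 / 100000 ≤ Real.log 3 - Real.log 2 := by
    linarith [Real.log_three_gt_d9, Real.log_two_lt_d9]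
  have h5 := sig_pos hκ0 three_pos
  have h6 := rpow_neg_mul_rpow κ three_pos
  have h7 := Real.rpow_pos_of_pos three_pos κ
  have h8 : dhConst κ * ((3 : ℝ) ^ (-κ) * sig κ 3) * (107 / 100) ≤ 1 := by
    rw [h3] at hm
    norm_num at hm
    linarith
  rw [mul_one_div, le_div_iff₀ h5]
  calc 107 / 100 * dhConst κ * sig κ 3
      = dhConst κ * ((3 : ℝ) ^ (-κ) * sig κ 3) * (107 / 100) * 3 ^ κ := by
        linear_combination (-(107 / 100 * dhConst κ * sig κ 3)) * h6
    _ ≤ 1 * 3 ^ κ := mul_le_mul_of_nonneg_right h8 h7.le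
    _ = 3 ^ κ := one_mul _

lemma exp_gamma_mul_ge {κ : ℝ} (hκ : 0 ≤ κ) :
    1 + 576 / 1000 * κ + 165888 / 1000000 * κ ^ 2
      ≤ Real.exp (κ * Real.eulerMascheroniConstant) := by
  have h1 := mul_le_mul_of_nonneg_left lt_eulerMascheroniConstant.le hκ
  refine le_trans ?_ (Real.exp_le_exp.2 h1)
  have := Real.quadratic_le_exp_of_nonneg (show 0 ≤ κ * (576 / 1000) by positivity)
  linarith

lemma two_mul_exp_gamma_ge :
    35566 / 10000 ≤ 2 * Real.exp Real.eulerMascheroniConstant := by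
  have h1 := Real.sum_le_exp_of_nonneg (show (0 : ℝ) ≤ 576 / 1000 by norm_num) 6
  have h2 := Real.exp_le_exp.2 lt_eulerMascheroniConstant.le
  norm_num [Finset.sum_range_succ, Nat.factorial] at h1
  linarith

namespace SieveData

variable {κ α β : ℝ} {F f : ℝ → ℝ}

lemma lower_two_eq_zero_of_dim_ge (h : SieveData κ F f α β) (hκ : 51 / 50 ≤ κ)
    (hα : F α = 1 / sig κ α) (hβ : β = 2) : f 2 ≤ 0 := by
  have hκ1 : 1 < κ := by linarith
  set L := Real.log 2 + Real.eulerMascheroniConstant with hL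
  set a := (2 * Real.exp Real.eulerMascheroniConstant) ^ κ with ha
  have hF : ∀ x, 1 ≤ x → a ≤ x ^ κ * F x := fun x hx =>
    (rpow_le_dhConst hκ1.le).trans (h.dhConst_le_rpow_mul_upper hκ1 hα (by linarith))
  have h1 := h.lower_two_le hκ1 hα hβ le_rfl (by
    rw [Real.one_rpow]
    exact Real.one_le_rpow (by linarith [two_mul_exp_gamma_ge]) (by linarith)) hF hF
  have hT : (0 : ℝ) < 2 ^ κ := by positivity
  have h2 : a = 2 ^ κ * Real.exp (κ * Real.eulerMascheroniConstant) := by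
    rw [ha, Real.mul_rpow two_pos.le (Real.exp_pos _).le, ← Real.exp_mul, mul_comm κ]
  rw [Real.log_one, mul_zero, mul_zero, sub_zero, log_two_mul_exp_rpow] at h1
  have h3 := exp_gamma_mul_ge (show 0 ≤ κ by linarith)
  have h4 : 1269 / 1000 * κ - 1 ≤ κ * L - 1 := by
    nlinarith [log_two_mul_exp_gamma_ge]
  have h5 : 1 / 2 - 34658 / 100000 * (κ - 1) ≤ (2 : ℝ) ^ (-κ) := by
    have h6 := one_sub_mul_le_rpow_neg two_pos (κ - 1)
    have h7 : (2 : ℝ) ^ (-(κ - 1)) = 2 * 2 ^ (-κ) := by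
      rw [show -(κ - 1) = 1 + -κ by ring, Real.rpow_one_add' (by norm_num) (by linarith)]
    nlinarith [Real.log_two_lt_d9]
  have h6 := mul_le_mul h3 h4 (by linarith) (Real.exp_pos _).le
  have h7 : 1 ≤ (1 + 576 / 1000 * κ + 165888 / 1000000 * κ ^ 2) * (1269 / 1000 * κ - 1)
      + (1 / 2 - 34658 / 100000 * (κ - 1)) := by
    obtain ⟨t, rfl⟩ : ∃ t, κ = 51 / 50 + t := ⟨κ - 51 / 50, by ring⟩
    have ht : 0 ≤ t := by linarith
    have := pow_nonneg ht 2
    have := pow_nonneg ht 3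
    nlinarith
  have h8 := mul_le_mul_of_nonneg_left (h7.trans (add_le_add h6 h5)) hT.le
  have h9 := rpow_neg_mul_rpow κ two_pos
  have h10 : 2 ^ κ * f 2 ≤ 0 := by
    rw [h2] at h1
    linarith
  exact nonpos_of_mul_nonpos_right h10 hT

lemma lower_two_eq_zero_of_three_lt (h : SieveData κ F f α β) (hκ : 1 < κ) (hκ2 : κ ≤ 51 / 50)
    (hα : F α = 1 / sig κ α) (hβ : β = 2) (hα3 : 3 < α) : f 2 ≤ 0 := by
  have hκ0 : 0 < κ := by linarith
  set L := Real.log 2 + Real.eulerMascheroniConstant with hL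
  have hL' : 1269 / 1000 + 1 / 10000 ≤ L := by
    linarith [Real.log_two_gt_d9, lt_eulerMascheroniConstant]
  set a := (2 * Real.exp Real.eulerMascheroniConstant) ^ κ with ha
  have haA := rpow_le_dhConst hκ.le
  rw [← ha] at haA
  have h3 : ∀ x, 3 ≤ x → 107 / 100 * a ≤ x ^ κ * F x := fun x hx => by
    refine le_trans ?_ (h.monotoneOn_rpow_mul_upper hκ hα (mem_Ioi.2 three_pos)
      (mem_Ioi.2 (by linarith)) hx)
    simp only
    rw [h.eq_inv_sig 3 hα3]
    linarith [rpow_mul_inv_sig_three_ge hκ hκ2]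
  have ha0 : 0 < a := Real.rpow_pos_of_pos (by positivity) _
  have ha1 : 35566 / 10000 ≤ a := two_mul_exp_gamma_ge.trans
    (Real.self_le_rpow_of_one_le (by linarith [two_mul_exp_gamma_ge]) hκ.le)
  have h1 := h.lower_two_le hκ hα hβ (by norm_num : (1 : ℝ) ≤ 3) (a' := 107 / 100 * a) (by
    refine le_trans ?_ (show a ≤ _ by linarith)
    exact Real.rpow_le_rpow (by norm_num) (by linarith [two_mul_exp_gamma_ge]) hκ0.le)
    (fun x hx => haA.trans (h.dhConst_le_rpow_mul_upper hκ hα (by linarith))) h3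
  rw [Real.log_mul (by norm_num) ha0.ne', log_two_mul_exp_rpow] at h1
  have h4 : 6763 / 100000 ≤ Real.log (107 / 100) :=
    le_trans (by norm_num) (le_log_of_nonneg (show (1 : ℝ) ≤ 107 / 100 by norm_num))
  have h5 : (2 : ℝ) ^ κ ≤ 2 * κ := by
    have := rpow_one_add_le_one_add_mul_self (s := 1) (by norm_num)
      (show 0 ≤ κ - 1 by linarith) (by linarith)
    rw [one_add_one_eq_two, Real.rpow_sub_one two_ne_zero] at this
    linarith
  set B := 107 / 100 * (Real.log (107 / 100) + κ * L - 1) - 7 / 100 * (κ * Real.log 3) with hB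
  have h6 : 2833 / 10000 + 128 / 100 * (κ - 1) ≤ B := by
    have := mul_nonneg (show 0 ≤ κ - 1 by linarith) (sub_nonneg.2 hL')
    have := mul_nonneg (show 0 ≤ κ - 1 by linarith) (sub_nonneg.2 Real.log_three_lt_d9.le)
    nlinarith [Real.log_three_lt_d9]
  have h7 : 2 * κ - 1 ≤ a * B := by
    have := mul_le_mul ha1 h6 (by linarith) ha0.le
    nlinarith
  have h8 : 2 ^ κ * f 2 ≤ 0 := by
    have e : a * B = a * κ * Real.log 3 + 107 / 100 * a *
      (Real.log (107 / 100) + κ * L - κ * Real.log 3 - 1) := by rw [hB]; ring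
    linarith
  exact nonpos_of_mul_nonpos_right h8 (by positivity)

lemma pairing_le_two (h : SieveData κ F f α β) (hκ : 1 < κ) {a : ℝ} (ha2 : 2 ≤ a) (ha : α ≤ a)
    (hb : β ≤ a) :
    (F a + f a) * (a * Lap (-κ) a)
      + κ * ∫ x in (a - 1)..a, (F x + f x) * Lap (-κ) (x + 1) ≤ 2 := by
  have hanti := antitoneOn_Ici_of_hasDerivAt_ne (c := 3) (g' := fun _ => -0)
    (h.continuousOn_pairing_add hκ ha2 ha hb).neg
    (fun u hu hu3 => (h.hasDerivAt_pairing_add hκ (by linarith) (by linarith) hu3).neg)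
    (fun _ _ _ => by simp)
  have hlim : Tendsto (fun v => (F v + 1) * (v * Lap (-κ) v)
      + κ * ((F 1 + 1) * Lap (-κ) v)) atTop (𝓝 2) := by
    have := ((h.tendsto_upper.add_const 1).mul (tendsto_mul_Lap (-κ))).add
      (((tendsto_Lap (-κ)).const_mul (F 1 + 1)).const_mul κ)
    norm_num at this
    exact this
  refine ge_of_tendsto hlim ?_
  filter_upwards [eventually_ge_atTop a] with v hv
  refine (neg_le_neg_iff.1 (hanti self_mem_Ici (mem_Ici.2 hv) hv)).trans (add_le_add ?_ ?_)
  · exact mul_le_mul_of_nonneg_right (by linarith [h.le_one (show 0 < v by linarith)])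
      (mul_nonneg (by linarith) (Lap_pos _ (by linarith)).le)
  · refine mul_le_mul_of_nonneg_left ?_ (by linarith)
    have h1 : ∫ x in (v - 1)..v, (F x + f x) * Lap (-κ) (x + 1)
        ≤ ∫ x in (v - 1)..v, (F 1 + 1) * Lap (-κ) v := by
      refine intervalIntegral.integral_mono_on (by linarith)
        ((h.posIntegrable_add.mul_shift (continuousOn_Lap _)) _ _ (by linarith) (by linarith))
        (by simp) fun x hx => ?_
      have hx1 : 1 ≤ x := by linarith [hx.1]
      have h2 := h.antitone (mem_Ioi.2 one_pos) (mem_Ioi.2 (by linarith : 0 < x)) hx1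
      have h3 := h.le_one (show 0 < x by linarith)
      have h4 := antitoneOn_Lap (-κ) (mem_Ioi.2 (by linarith : 0 < v))
        (mem_Ioi.2 (by linarith [hx.1] : 0 < x + 1)) (by linarith [hx.1])
      exact mul_le_mul (by linarith) h4 (Lap_pos _ (by linarith)).le
        (by linarith [h.one_le one_pos])
    rwa [intervalIntegral.integral_const, sub_sub_cancel, one_smul] at h1

lemma lower_two_eq_zero_of_le_three (h : SieveData κ F f α β) (hκ : 1 < κ)
    (hα : F α = 1 / sig κ α) (hβ : β = 2) (hα2 : 2 < α) (hα3 : α ≤ 3) : f 2 ≤ 0 := by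
  have hκ0 : 0 < κ := by linarith
  have hA := dhConst_pos hκ0
  have hh := continuousOn_Lap (-κ)
  have hm := monotoneOn_Icc_of_hasDerivAt (a := 2) (b := α)
    (g := fun v => (F v + f v) * (v * Lap (-κ) v)
      + κ * ∫ x in (v - 1)..v, (F x + f x) * Lap (-κ) (x + 1))
    (g' := fun u => κ * Lap (-κ) u * (sig κ (u - 2) / sig κ u ^ 2))
    ((h.posIntegrable_add.continuousOn_pairing hh one_lt_two
      (ContinuousOn.add (fun x hx => (h.continuousAt_upper hκ (two_pos.trans_le hx)
        fun _ => hα).continuousWithinAt) (hβ ▸ h.continuousOn_lower hκ)) κ).mono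
      fun x hx => hx.1) (fun u hu hua => ?_) (fun u hu hua => ?_)
    (left_mem_Icc.2 hα2.le) (right_mem_Icc.2 hα2.le) hα2.le
  · have h1 := h.pairing_le_two hκ h.two_le le_rfl (by linarith)
    simp only at hm
    have h2 : ∫ x in ((2 : ℝ) - 1)..2, (F x + f x) * Lap (-κ) (x + 1)
        = dhConst κ * ∫ x in ((2 : ℝ) - 1)..2, x ^ (-κ) * Lap (-κ) (x + 1) := by
      rw [← intervalIntegral.integral_const_mul]
      refine intervalIntegral.integral_congr_Ioo_of_le (by norm_num) fun x hx => ?_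
      have hx0 : 0 < x := by linarith [hx.1]
      rw [h.eq_zero x (by linarith [hx.2]), h.eq_inv_sig x (by linarith [hx.2]),
        sig_of_le_two hκ0 hx0.le hx.2.le, Real.rpow_neg hx0.le, add_zero]
      field_simp
    have h3 := congrArg (fun t => dhConst κ * t) (integral_rpow_mul_Lap κ one_lt_two)
    have h4 : F 2 * (2 * Lap (-κ) 2) = dhConst κ * ((2 : ℝ) ^ (1 - κ) * Lap (-κ) 2) := by
      rw [h.eq_inv_sig 2 hα2, sig_of_le_two hκ0 two_pos.le le_rfl,
        show 1 - κ = -κ + 1 by ring, Real.rpow_add_one two_ne_zero, Real.rpow_neg two_pos.le]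
      field_simp
    have h5 := two_le_dhConst_mul_Lap hκ.le
    simp only [show (2 : ℝ) - 1 = 1 by norm_num, Real.one_rpow, one_mul] at h2 h3 hm
    rw [h2] at hm
    have h6 : f 2 * (2 * Lap (-κ) 2) ≤ 0 := by linarith
    exact nonpos_of_mul_nonpos_left h6 (mul_pos two_pos (Lap_pos _ two_pos))
  · have hs := sig_pos hκ0 (show 0 < u by linarith)
    have hd : HasDerivAt F (-(κ / u * (sig κ u - sig κ (u - 2))) / sig κ u ^ 2) u := by
      have : HasDerivAt (fun v => 1 / sig κ v)
          (-(κ / u * (sig κ u - sig κ (u - 2))) / sig κ u ^ 2) u := by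
        simpa using (hasDerivAt_sig hκ0 (show 0 < u by linarith)).fun_inv hs.ne'
      refine this.congr_of_eventuallyEq ?_
      filter_upwards [Iio_mem_nhds hua] with v hv using h.eq_inv_sig v hv
    have hc := (h.continuousAt_upper_of_ne hκ (u := u - 1) (by linarith) (by linarith)).add
      (h.continuousAt_lower_of_ne hκ (u := u - 1) (by linarith) (by linarith))
    refine (h.posIntegrable_add.hasDerivAt_pairing hh (by linarith)
      (hd.add (h.hasDerivAt_lower_of_ne hκ (by linarith) (by linarith))) hc
      (hasDerivAt_mul_Lap (-κ) (by linarith)) κ).congr_deriv ?_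
    have hu0 : u ≠ 0 := by linarith
    rw [h.eq_inv_sig u hua, h.eq_zero (u - 1) (by linarith)]
    field_simp
    ring
  · have := Lap_pos (-κ) (show 0 < u by linarith)
    have := sig_nonneg hκ0 (u - 2)
    positivity

lemma lower_beta_eq_zero (h : SieveData κ F f α β) (hκ : 1 < κ) : f β = 0 := by
  have hβα := h.beta_lt_alpha hκ
  have hα : F α = 1 / sig κ α := h.boundary.resolve_left (by linarith [h.two_le_beta])
  refine h.boundary_lower.elim (fun hβ => ?_) id
  rw [hβ]
  refine le_antisymm ?_ (h.nonneg 2)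
  rcases le_total (51 / 50) κ with h1 | h1
  · exact h.lower_two_eq_zero_of_dim_ge h1 hα hβ
  · rcases le_or_gt α 3 with h2 | h2
    · exact h.lower_two_eq_zero_of_le_three hκ hα hβ (by linarith) h2
    · exact h.lower_two_eq_zero_of_three_lt hκ h1 hα hβ h2

end SieveData

end DiamondHalberstam

open DiamondHalberstam in
/-- Existence of the Diamond–Halberstam sieve functions `σ_κ`, `F_κ`, `f_κ`
of dimension `κ > 1`. -/
theorem stmt4 (κ : ℝ) (hκ : 1 < κ) :
    ∃ (σ F f : ℝ → ℝ) (α β : ℝ),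
      ContinuousOn σ (Set.Ioi (0 : ℝ)) ∧
      (∀ u : ℝ, 0 < u → u ≤ 2 →
        σ u = u ^ κ /
          ((2 * Real.exp Real.eulerMascheroniConstant) ^ κ * Real.Gamma (κ + 1))) ∧
      (∀ u : ℝ, 2 < u →
        HasDerivAt (fun v : ℝ => v ^ (-κ) * σ v) (-(κ * u ^ (-κ - 1) * σ (u - 2))) u) ∧
      2 ≤ β ∧ β ≤ α ∧
      ContinuousOn F (Set.Ioi (0 : ℝ)) ∧ ContinuousOn f (Set.Ioi (0 : ℝ)) ∧
      (∀ u : ℝ, 0 < u → u ≤ α → F u = 1 / σ u) ∧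
      (∀ u : ℝ, 0 < u → u ≤ β → f u = 0) ∧
      (∀ u : ℝ, α < u →
        HasDerivAt (fun v : ℝ => v ^ κ * F v) (κ * u ^ (κ - 1) * f (u - 1)) u) ∧
      (∀ u : ℝ, β < u →
        HasDerivAt (fun v : ℝ => v ^ κ * f v) (κ * u ^ (κ - 1) * F (u - 1)) u) ∧
      AntitoneOn F (Set.Ioi (0 : ℝ)) ∧ MonotoneOn f (Set.Ioi (0 : ℝ)) ∧
      Filter.Tendsto F Filter.atTop (nhds 1) ∧
      Filter.Tendsto f Filter.atTop (nhds 1) ∧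
      (∃ C : ℝ, 0 < C ∧ ∀ u : ℝ, 1 ≤ u →
        |F u - 1| ≤ C * Real.exp (-u) ∧ |f u - 1| ≤ C * Real.exp (-u)) := by
  have hκ0 : 0 < κ := by linarith
  obtain ⟨F, f, α, h⟩ := exists_sievePair hκ
  obtain ⟨β, h⟩ := h.exists_beta hκ
  have hβα := h.beta_lt_alpha hκ
  have hα : F α = 1 / sig κ α := h.boundary.resolve_left (by linarith [h.two_le_beta])
  have hβ := h.lower_beta_eq_zero hκ
  have hβ2 := h.two_le_beta
  have hFc : ∀ u, 0 < u → ContinuousAt F u := fun u hu => h.continuousAt_upper hκ hu fun _ => hα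
  have hfc : ∀ u, 0 < u → ContinuousAt f u := fun u hu => h.continuousAt_lower hκ hu fun _ => hβ
  obtain ⟨C₁, hC₁, hb₁⟩ := h.defect_upper.exists_abs_le
  obtain ⟨C₂, hC₂, hb₂⟩ := h.defect_lower.exists_abs_le
  refine ⟨sig κ, F, f, α, β, (continuous_sig hκ0).continuousOn,
    fun u h0 h2 => sig_of_le_two hκ0 h0.le h2,
    fun u hu => hasDerivAt_rpow_neg_mul_sig hκ0 (by linarith), hβ2, hβα.le,
    fun u hu => (hFc u hu).continuousWithinAt, fun u hu => (hfc u hu).continuousWithinAt,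
    fun u _ hu => ?_, fun u _ hu => ?_, fun u hu => h.hasDerivAt_upper hκ hu (hfc _ (by linarith)),
    fun u hu => h.hasDerivAt_lower hκ hu (hFc _ (by linarith)), h.antitone,
    h.monotone.monotoneOn _, ?_, ?_, C₁ + C₂, by positivity, fun u hu => ⟨?_, ?_⟩⟩
  · rcases hu.eq_or_lt with rfl | hu
    exacts [hα, h.eq_inv_sig u hu]
  · rcases hu.eq_or_lt with rfl | hu
    exacts [hβ, h.eq_zero u hu]
  · exact h.tendsto_upper
  · exact h.tendsto_lower
  · exact (hb₁ u hu).trans (mul_le_mul_of_nonneg_right (by linarith) (Real.exp_pos _).le)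
  · rw [abs_sub_comm]
    exact (hb₂ u hu).trans (mul_le_mul_of_nonneg_right (by linarith) (Real.exp_pos _).le)
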